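/- arXiv:2011.09451 — 4 statements merged into one kernel-verified Lean document; each statement's English description precedes it below -/
import Mathlib

section
/- Let d, n ≥ 1 and let 𝐪 = (Q_1, …, Q_n) be an n-tuple of quadratic forms in d variables with integer coefficients. For every p ≥ 2 and every ε > 0 there exists a constant C such that for every positive integer W, ‖ Σ_{𝐰 ∈ {0,1,…,W}^d} e^{2πi(𝐰·x + 𝐪(𝐰)·y)} ‖_{L^p([0,1]^d × [0,1]^n)} ≤ C · W^{Γ_p(𝐪) + d/p + ε}. -/
open MeasureTheory
open scoped ENNReal

noncomputable section

namespace GOZZK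

/-- A quadratic form in `d` real variables. -/
abbrev QF (d : ℕ) := QuadraticForm ℝ (Fin d → ℝ)

/-- The center of the dyadic subcube of `[0,1]^d` of side length `2⁻ᵏ` indexed by `ν`. -/
def center {d : ℕ} (k : ℕ) (ν : Fin d → Fin (2 ^ k)) : Fin d → ℝ :=
  fun j => (ν j : ℕ) / 2 ^ k + 1 / 2 ^ (k + 1)

/-- The uncertainty parallelepiped `𝒰_□ = (a, 𝐪(a)) + L_□ᵀ([-C,C]^{d+n})` attached to the
cube of side `δ` centered at `a`; here `∇𝐪(a)ᵀ x = (polar Qᵢ (a, x))ᵢ`. -/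
def Ubox {d n : ℕ} (Q : Fin n → QF d) (δ C : ℝ) (a : Fin d → ℝ) :
    Set ((Fin d → ℝ) × (Fin n → ℝ)) :=
  { z | ∃ (u : Fin d → ℝ) (v : Fin n → ℝ), (∀ j, |u j| ≤ C) ∧ (∀ i, |v i| ≤ C) ∧
      z.1 = (fun j => a j + δ * u j) ∧
      z.2 = (fun i => Q i a + QuadraticMap.polar (⇑(Q i)) a (δ • u) + δ ^ 2 * v i) }

/-- The Fourier transform of a function on `ℝ^d × ℝⁿ`. -/
def fourierT {d n : ℕ} (f : ((Fin d → ℝ) × (Fin n → ℝ)) → ℂ)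
    (ξ : (Fin d → ℝ) × (Fin n → ℝ)) : ℂ :=
  ∫ z : (Fin d → ℝ) × (Fin n → ℝ),
    Complex.exp (((-(2 * Real.pi * ((∑ j, z.1 j * ξ.1 j) + ∑ i, z.2 i * ξ.2 i)) : ℝ) : ℂ)
      * Complex.I) * f z

/-- The `ℓ^q` norm of a finite tuple of extended nonnegative reals (interpreted as a
supremum when `q = ∞`). -/
def lqNorm {ι : Type*} [Fintype ι] (q : ℝ≥0∞) (a : ι → ℝ≥0∞) : ℝ≥0∞ :=
  if q = ∞ then ⨆ i, a i else (∑ i : ι, a i ^ q.toReal) ^ (1 / q.toReal)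

/-- The `ℓ^q L^p` decoupling constant `Dec_{q,p}(𝐪, δ)` at scale `δ = 2⁻ᵏ`, with
uncertainty boxes of size parameter `C`: the smallest constant `D` such that
`‖∑_□ f_□‖_{L^p(ℝ^{d+n})} ≤ D (∑_□ ‖f_□‖_{L^p(ℝ^{d+n})}^q)^{1/q}` holds for every tuple
of Schwartz functions `f_□` whose Fourier transform is supported in `𝒰_□`. -/
def DecConst {d n : ℕ} (Q : Fin n → QF d) (C : ℝ) (q p : ℝ≥0∞) (k : ℕ) : ℝ :=
  sInf { D : ℝ | 0 ≤ D ∧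
    ∀ f : (Fin d → Fin (2 ^ k)) → SchwartzMap ((Fin d → ℝ) × (Fin n → ℝ)) ℂ,
      (∀ ν, Function.support (fourierT (⇑(f ν))) ⊆ Ubox Q (1 / 2 ^ k) C (center k ν)) →
      eLpNorm (fun z => ∑ ν, f ν z) p volume ≤
        ENNReal.ofReal D * lqNorm q (fun ν => eLpNorm (⇑(f ν)) p volume) }

/-- The decoupling exponent `Γ_{q,p}(𝐪)`: the smallest `Γ` such that for every `ε > 0`
there is `C_ε` with `Dec_{q,p}(𝐪, δ) ≤ C_ε δ^{-Γ-ε}` for all dyadic `δ = 2⁻ᵏ < 1`. -/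
def Gamma {d n : ℕ} (Q : Fin n → QF d) (C : ℝ) (q p : ℝ≥0∞) : ℝ :=
  sInf { G : ℝ | ∀ ε : ℝ, 0 < ε → ∃ Cε : ℝ, ∀ k : ℕ, 1 ≤ k →
    DecConst Q C q p k ≤ Cε * (1 / 2 ^ k : ℝ) ^ (-(G + ε)) }


/-- The dot product. -/
def ip {d n : ℕ} (z ξ : (Fin d → ℝ) × (Fin n → ℝ)) : ℝ :=
  (∑ j, z.1 j * ξ.1 j) + ∑ i, z.2 i * ξ.2 i

lemma temperate_exp {E : Type*} [NormedAddCommGroup E] [NormedSpace ℝ E] (L : E →L[ℝ] ℝ) :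
    Function.HasTemperateGrowth (fun z : E => Complex.exp (((L z : ℝ) : ℂ) * Complex.I)) := by
  have h1 : Function.HasTemperateGrowth (fun t : ℝ => Complex.exp ((t : ℂ) * Complex.I)) := by
    have hd : ∀ m : ℕ, iteratedDeriv m (fun t : ℝ => Complex.exp ((t : ℂ) * Complex.I)) =
        fun t : ℝ => Complex.I ^ m * Complex.exp ((t : ℂ) * Complex.I) := by
      intro m
      induction m with
      | zero => simp
      | succ m ih =>
        rw [iteratedDeriv_succ, ih]
        funext t
        have : HasDerivAt (fun t : ℝ => Complex.I ^ m * Complex.exp ((t : ℂ) * Complex.I))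
            (Complex.I ^ m * (Complex.exp ((t : ℂ) * Complex.I) * (1 * Complex.I))) t := by
          refine HasDerivAt.const_mul _ (HasDerivAt.cexp ?_)
          exact (Complex.ofRealCLM.hasDerivAt (x := t)).mul_const Complex.I
        rw [this.deriv]; ring
    refine ⟨?_, fun m => ⟨0, 1, fun t => ?_⟩⟩
    · exact (Complex.ofRealCLM.contDiff.mul contDiff_const).cexp
    · rw [norm_iteratedFDeriv_eq_norm_iteratedDeriv, hd]
      simp [Complex.norm_exp_ofReal_mul_I]
  exact h1.comp L.hasTemperateGrowth

lemma map_clequiv {E : Type*} [NormedAddCommGroup E] [NormedSpace ℝ E] [FiniteDimensional ℝ E]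
    [MeasurableSpace E] [BorelSpace E] (μ : Measure E) [μ.IsAddHaarMeasure] (P : E ≃L[ℝ] E) :
    ∃ c : ℝ, 0 < c ∧ Measure.map P μ = ENNReal.ofReal c • μ := by
  have hdet : LinearMap.det (P : E →ₗ[ℝ] E) ≠ 0 := by
    have := (LinearEquiv.isUnit_det' P.toLinearEquiv)
    exact this.ne_zero
  refine ⟨|(LinearMap.det (P : E →ₗ[ℝ] E))⁻¹|, by positivity, ?_⟩
  exact Measure.map_linearMap_addHaar_eq_smul_addHaar μ hdet

lemma haar_inst (d n : ℕ) :
    (volume : Measure ((Fin d → ℝ) × (Fin n → ℝ))).IsAddHaarMeasure :=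
  Measure.prod.instIsAddHaarMeasure volume volume

/-- modulated, linearly composed Schwartz functions -/
lemma modulate {d n : ℕ} (φ : SchwartzMap ((Fin d → ℝ) × (Fin n → ℝ)) ℂ)
    (P : ((Fin d → ℝ) × (Fin n → ℝ)) ≃L[ℝ] ((Fin d → ℝ) × (Fin n → ℝ)))
    (P' : ((Fin d → ℝ) × (Fin n → ℝ)) → ((Fin d → ℝ) × (Fin n → ℝ)))
    (hP : ∀ z ζ, ip z ζ = ip (P z) (P' ζ)) (b : (Fin d → ℝ) × (Fin n → ℝ)) :
    ∃ f : SchwartzMap ((Fin d → ℝ) × (Fin n → ℝ)) ℂ,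
      (∀ z, f z = Complex.exp (((2 * Real.pi * ip z b : ℝ) : ℂ) * Complex.I) * φ (P z)) ∧
      ∀ ξ, fourierT (⇑f) ξ ≠ 0 → fourierT (⇑φ) (P' (ξ - b)) ≠ 0 := by
  let L : ((Fin d → ℝ) × (Fin n → ℝ)) →ₗ[ℝ] ℝ :=
    { toFun := fun z => 2 * Real.pi * ip z b
      map_add' := by
        intro x y; simp only [ip, Prod.fst_add, Prod.snd_add, Pi.add_apply, add_mul,
          Finset.sum_add_distrib]; ring
      map_smul' := by
        intro x y; simp only [ip, Prod.smul_fst, Prod.smul_snd, Pi.smul_apply, smul_eq_mul,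
          mul_assoc, ← Finset.mul_sum, RingHom.id_apply]; ring }
  have hL := temperate_exp L.toContinuousLinearMap
  refine ⟨SchwartzMap.smulLeftCLM ℂ
    (fun z => Complex.exp (((L.toContinuousLinearMap z : ℝ) : ℂ) * Complex.I))
    (SchwartzMap.compCLMOfContinuousLinearEquiv ℂ P φ), ?_, ?_⟩
  · intro z
    rw [SchwartzMap.smulLeftCLM_apply_apply hL]
    rfl
  · intro ξ
    contrapose!
    intro h
    have := haar_inst d n
    obtain ⟨c, hc, hmap⟩ := map_clequiv
      (volume : Measure ((Fin d → ℝ) × (Fin n → ℝ))) P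
    unfold fourierT at h ⊢
    have key : ∀ z, Complex.exp (((-(2 * Real.pi * ((∑ j, z.1 j * ξ.1 j) +
        ∑ i, z.2 i * ξ.2 i)) : ℝ) : ℂ) * Complex.I) *
        (SchwartzMap.smulLeftCLM ℂ
          (fun z => Complex.exp (((L.toContinuousLinearMap z : ℝ) : ℂ) * Complex.I))
          (SchwartzMap.compCLMOfContinuousLinearEquiv ℂ P φ)) z =
        (fun y => Complex.exp (((-(2 * Real.pi * (ip y (P' (ξ - b)))) : ℝ) : ℂ)
          * Complex.I) * φ y) (P z) := by
      intro z
      rw [SchwartzMap.smulLeftCLM_apply_apply hL]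
      simp only [← hP]
      rw [smul_eq_mul, ← mul_assoc, ← Complex.exp_add]
      have h0 : (SchwartzMap.compCLMOfContinuousLinearEquiv ℂ P φ) z = φ (P z) := rfl
      rw [h0]
      congr 2
      have : ip z (ξ - b) = ((∑ j, z.1 j * ξ.1 j) + ∑ i, z.2 i * ξ.2 i) - ip z b := by
        simp only [ip, Prod.fst_sub, Prod.snd_sub, Pi.sub_apply, mul_sub,
          Finset.sum_sub_distrib]; ring
      rw [this]
      have h2 : L.toContinuousLinearMap z = 2 * Real.pi * ip z b := rfl
      rw [h2]
      push_cast
      ring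
    simp_rw [key]
    have := integral_map_equiv (μ := volume) P.toHomeomorph.toMeasurableEquiv
      (fun y => Complex.exp (((-(2 * Real.pi * (ip y (P' (ξ - b)))) : ℝ) : ℂ)
          * Complex.I) * φ y)
    have h3 : Measure.map (P.toHomeomorph.toMeasurableEquiv)
      (volume : Measure ((Fin d → ℝ) × (Fin n → ℝ))) = ENNReal.ofReal c • volume := hmap
    rw [h3, integral_smul_measure] at this
    refine Eq.trans this.symm ?_
    have h4 : ∫ z, Complex.exp (((-(2 * Real.pi * (ip z (P' (ξ - b)))) : ℝ) : ℂ)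
          * Complex.I) * φ z = 0 := h
    rw [h4, smul_zero]

/-- The Euclidean model of `ℝ^d × ℝ^n`. -/
def eEquiv (d n : ℕ) : ((Fin d → ℝ) × (Fin n → ℝ)) ≃L[ℝ] EuclideanSpace ℝ (Fin d ⊕ Fin n) :=
  (LinearEquiv.sumArrowLequivProdArrow (Fin d) (Fin n) ℝ ℝ).symm.toContinuousLinearEquiv.trans
    (EuclideanSpace.equiv (Fin d ⊕ Fin n) ℝ).symm

lemma eEquiv_inl {d n : ℕ} (z : (Fin d → ℝ) × (Fin n → ℝ)) (j : Fin d) :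
    eEquiv d n z (Sum.inl j) = z.1 j := rfl

lemma eEquiv_inr {d n : ℕ} (z : (Fin d → ℝ) × (Fin n → ℝ)) (j : Fin n) :
    eEquiv d n z (Sum.inr j) = z.2 j := rfl

lemma eEquiv_mp (d n : ℕ) : MeasurePreserving (eEquiv d n) volume volume := by
  have h1 := volume_measurePreserving_sumPiEquivProdPi_symm (fun _ : Fin d ⊕ Fin n => ℝ)
  have h2 := PiLp.volume_preserving_toLp (Fin d ⊕ Fin n)
  have h3 := h2.comp h1
  exact h3

lemma eEquiv_inner {d n : ℕ} (z ξ : (Fin d → ℝ) × (Fin n → ℝ)) :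
    inner ℝ (eEquiv d n z) (eEquiv d n ξ) = ip z ξ := by
  rw [PiLp.inner_apply, Fintype.sum_sum_type]
  simp [ip, eEquiv_inl, eEquiv_inr, mul_comm]

open scoped FourierTransform in
lemma base_schwartz (d n : ℕ) : ∃ φ : SchwartzMap ((Fin d → ℝ) × (Fin n → ℝ)) ℂ,
    ∃ r c : ℝ, 0 < r ∧ 0 < c ∧ (∀ z, ‖z‖ ≤ r → c ≤ ‖φ z‖) ∧
      ∀ ξ, fourierT (⇑φ) ξ ≠ 0 → ‖ξ‖ ≤ 2 := by
  let ψ : ContDiffBump (0 : EuclideanSpace ℝ (Fin d ⊕ Fin n)) := ⟨1, 2, by norm_num, by norm_num⟩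
  have hcs : HasCompactSupport (fun x => ((ψ x : ℝ) : ℂ)) :=
    ψ.hasCompactSupport.comp_left (g := fun t : ℝ => (t : ℂ)) (by simp)
  have hcd : ContDiff ℝ (⊤ : ℕ∞) (fun x => ((ψ x : ℝ) : ℂ)) :=
    Complex.ofRealCLM.contDiff.comp ψ.contDiff
  let ψs := hcs.toSchwartzMap hcd
  have hψs : ∀ x, ψs x = ((ψ x : ℝ) : ℂ) := fun x => rfl
  let g := 𝓕⁻ ψs
  have hg : 𝓕 g = ψs := FourierTransform.fourier_fourierInv_eq ψs
  let φ := SchwartzMap.compCLMOfContinuousLinearEquiv ℂ (eEquiv d n) g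
  have hφ : ∀ z, φ z = g (eEquiv d n z) := fun z => rfl
  have hg0 : g 0 ≠ 0 := by
    have : g 0 = ∫ x, ((ψ x : ℝ) : ℂ) := by
      have h1 : g 0 = 𝓕⁻ (⇑ψs) 0 := by
        rw [← SchwartzMap.fourierInv_coe]
      rw [h1, Real.fourierInv_eq']
      simp [hψs]
    rw [this, integral_complex_ofReal]
    exact_mod_cast (ψ.integral_pos (μ := volume)).ne'
  have hφ0 : 0 < ‖φ 0‖ := by
    rw [hφ, map_zero]; exact norm_pos_iff.2 hg0
  have hev : ∀ᶠ z in nhds (0 : (Fin d → ℝ) × (Fin n → ℝ)), ‖φ 0‖ / 2 < ‖φ z‖ :=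
    (φ.continuous.norm.tendsto 0).eventually (lt_mem_nhds (by linarith))
  obtain ⟨r, hr, hball⟩ := Metric.eventually_nhds_iff.1 hev
  refine ⟨φ, r / 2, ‖φ 0‖ / 2, by positivity, by positivity, ?_, ?_⟩
  · intro z hz
    refine (hball ?_).le
    rw [dist_zero_right]; linarith
  · intro ξ hξ
    have h1 : fourierT (⇑φ) ξ = ψs (eEquiv d n ξ) := by
      rw [← hg, SchwartzMap.fourier_coe, Real.fourier_eq',
        ← (eEquiv_mp d n).integral_comp
          (eEquiv d n).toHomeomorph.measurableEmbedding]
      unfold fourierT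
      congr 1
      funext z
      rw [eEquiv_inner, hφ, smul_eq_mul]
      congr 3
      simp [ip]
    rw [h1, hψs] at hξ
    have h2 : ψ (eEquiv d n ξ) ≠ 0 := by exact_mod_cast hξ
    have h3 : eEquiv d n ξ ∈ Function.support ψ := h2
    rw [ψ.support_eq, mem_ball_zero_iff] at h3
    have h4 : ‖eEquiv d n ξ‖ < 2 := h3
    have h5 : ∀ s, ‖eEquiv d n ξ s‖ ≤ 2 := fun s => (PiLp.norm_apply_le _ s).trans h4.le
    refine norm_prod_le_iff.2 ⟨?_, ?_⟩
    · exact (pi_norm_le_iff_of_nonneg (by norm_num)).2 fun j => h5 (Sum.inl j)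
    · exact (pi_norm_le_iff_of_nonneg (by norm_num)).2 fun j => h5 (Sum.inr j)

/-- rescaled bump -/
lemma base_schwartz' (d n : ℕ) : ∃ φ : SchwartzMap ((Fin d → ℝ) × (Fin n → ℝ)) ℂ,
    ∃ ρ c : ℝ, 0 < ρ ∧ 0 < c ∧ (∀ z, ‖z‖ ≤ 1 → c ≤ ‖φ z‖) ∧
      ∀ ξ, fourierT (⇑φ) ξ ≠ 0 → ‖ξ‖ ≤ ρ := by
  obtain ⟨φ, r, c, hr, hc, h1, h2⟩ := base_schwartz d n
  obtain ⟨f, hf, hf'⟩ := modulate φ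
    (ContinuousLinearEquiv.smulLeft (Units.mk0 r hr.ne')) (fun ζ => r⁻¹ • ζ) (by
      intro z ζ
      simp only [ip, ContinuousLinearEquiv.smulLeft_apply_apply, Prod.smul_fst, Prod.smul_snd,
        Pi.smul_apply, smul_eq_mul, Units.smul_def, Units.val_mk0]
      congr 1 <;> refine Finset.sum_congr rfl fun j _ => ?_ <;> field_simp) 0
  refine ⟨f, 2 * r, c, by positivity, hc, ?_, ?_⟩
  · intro z hz
    rw [hf, norm_mul, Complex.norm_exp_ofReal_mul_I, one_mul]
    refine h1 _ ?_
    change ‖r • z‖ ≤ r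
    rw [norm_smul, Real.norm_of_nonneg hr.le]
    nlinarith
  · intro ξ hξ
    have := h2 _ (hf' ξ hξ)
    rw [sub_zero, norm_smul, Real.norm_of_nonneg (by positivity)] at this
    rw [inv_mul_le_iff₀ hr] at this
    linarith

/-- dilation modulo one on the unit interval -/
lemma fract_mp (K : ℕ) (hK : 0 < K) : ∃ τ : ℝ → ℝ,
    MeasurePreserving τ (volume.restrict (Set.Ioc 0 1)) (volume.restrict (Set.Ioc 0 1)) ∧
    ∀ x, ∃ m : ℤ, (K : ℝ) * x = τ x + m := by
  have h1 := UnitAddCircle.measurePreserving_mk 0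
  have h2 : MeasurePreserving (fun y : UnitAddCircle => (K : ℤ) • y) volume volume :=
    Measure.measurePreserving_zsmul volume (by exact_mod_cast hK.ne')
  have h3 : MeasurePreserving (AddCircle.equivIoc (1 : ℝ) 0) volume _ :=
    AddCircle.measurePreserving_equivIoc 1
  have h4 := measurePreserving_subtype_coe (μa := (volume : Measure ℝ))
    (measurableSet_Ioc (a := (0 : ℝ)) (b := 0 + 1))
  have h5 := h4.comp (h3.comp (h2.comp h1))
  have h50 : (volume : Measure ℝ).restrict (Set.Ioc 0 (0 + 1)) =
      volume.restrict (Set.Ioc 0 1) := by rw [zero_add]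
  rw [h50] at h5
  refine ⟨_, h5, fun x => ?_⟩
  have h6 := (AddCircle.equivIoc (1 : ℝ) 0).symm_apply_apply ((K : ℤ) • (x : UnitAddCircle))
  have h7 : ((((AddCircle.equivIoc (1 : ℝ) 0) ((K : ℤ) • (x : UnitAddCircle)) : ℝ)) :
      UnitAddCircle) = (((K : ℝ) * x : ℝ) : UnitAddCircle) := by
    refine Eq.trans h6 ?_
    rw [← AddCircle.coe_zsmul]; simp
  have h8 : (((K : ℝ) * x - ((AddCircle.equivIoc (1 : ℝ) 0) ((K : ℤ) • (x : UnitAddCircle)) : ℝ) :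
      ℝ) : UnitAddCircle) = 0 := by
    rw [AddCircle.coe_sub, h7, sub_self]
  obtain ⟨m, hm⟩ := (AddCircle.coe_eq_zero_iff (1 : ℝ)).1 h8
  refine ⟨m, ?_⟩
  simp only [zsmul_eq_mul, mul_one] at hm
  simp only [Function.comp]
  linarith

/-- the unit cube measure -/
lemma cube_measure (d n : ℕ) :
    (volume.restrict ((Set.univ.pi fun _ : Fin d => Set.Icc (0 : ℝ) 1) ×ˢ
          (Set.univ.pi fun _ : Fin n => Set.Icc (0 : ℝ) 1)) :
          Measure ((Fin d → ℝ) × (Fin n → ℝ))) =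
      (Measure.pi fun _ : Fin d => volume.restrict (Set.Ioc (0 : ℝ) 1)).prod
        (Measure.pi fun _ : Fin n => volume.restrict (Set.Ioc (0 : ℝ) 1)) := by
  rw [Measure.volume_eq_prod, ← Measure.prod_restrict, volume_pi, volume_pi,
    Measure.restrict_pi_pi, Measure.restrict_pi_pi]
  simp only [restrict_Ioc_eq_restrict_Icc]

lemma dilate_mp (d n : ℕ) (K : ℕ) (hK : 0 < K) (p : ℝ≥0∞)
    (F : (Fin d → ℝ) × (Fin n → ℝ) → ℂ) (hF : Continuous F)
    (hper : ∀ z, ∀ m : Fin d → ℤ, ∀ l : Fin n → ℤ,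
      F (fun j => z.1 j + m j, fun i => z.2 i + l i) = F z) :
    eLpNorm F p (volume.restrict ((Set.univ.pi fun _ : Fin d => Set.Icc (0 : ℝ) 1) ×ˢ
          (Set.univ.pi fun _ : Fin n => Set.Icc (0 : ℝ) 1))) =
    eLpNorm (fun z => F ((K : ℝ) • z)) p
      (volume.restrict ((Set.univ.pi fun _ : Fin d => Set.Icc (0 : ℝ) 1) ×ˢ
          (Set.univ.pi fun _ : Fin n => Set.Icc (0 : ℝ) 1))) := by
  obtain ⟨τ, hτ, hτ'⟩ := fract_mp K hK
  choose m hm using hτ'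
  rw [cube_measure]
  have hA := measurePreserving_pi (fun _ : Fin d => volume.restrict (Set.Ioc (0 : ℝ) 1))
    (fun _ : Fin d => volume.restrict (Set.Ioc (0 : ℝ) 1)) (fun _ => hτ)
  have hB := measurePreserving_pi (fun _ : Fin n => volume.restrict (Set.Ioc (0 : ℝ) 1))
    (fun _ : Fin n => volume.restrict (Set.Ioc (0 : ℝ) 1)) (fun _ => hτ)
  have hAB := hA.prod hB
  rw [← eLpNorm_comp_measurePreserving hF.aestronglyMeasurable hAB]
  congr 1
  funext z
  have := hper (Prod.map (fun a i => τ (a i)) (fun a i => τ (a i)) z)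
    (fun j => m (z.1 j)) (fun i => m (z.2 i))
  simp only [Function.comp]
  rw [← this]
  congr 1
  ext j
  · simp [← hm]
  · simp [← hm]

lemma le_lqNorm {ι : Type*} [Fintype ι] (p : ℝ≥0∞) (hp0 : 0 < p.toReal) (hp : p ≠ ∞)
    (a : ι → ℝ≥0∞) (i : ι) : a i ≤ lqNorm p a := by
  rw [lqNorm, if_neg hp, one_div]
  rw [ENNReal.le_rpow_inv_iff hp0]
  exact Finset.single_le_sum (f := fun i => a i ^ p.toReal) (fun _ _ => zero_le)
    (Finset.mem_univ i)

lemma lqNorm_le {ι : Type*} [Fintype ι] (p : ℝ≥0∞) (hp0 : 0 < p.toReal) (hp : p ≠ ∞)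
    (a : ι → ℝ≥0∞) (X : ℝ≥0∞) (h : ∀ i, a i ≤ X) :
    lqNorm p a ≤ (Fintype.card ι : ℝ≥0∞) ^ (1 / p.toReal) * X := by
  rw [lqNorm, if_neg hp]
  calc (∑ i : ι, a i ^ p.toReal) ^ (1 / p.toReal)
      ≤ (∑ _i : ι, X ^ p.toReal) ^ (1 / p.toReal) := by
        gcongr with i; exact h i
    _ = (Fintype.card ι : ℝ≥0∞) ^ (1 / p.toReal) * X := by
        rw [Finset.sum_const, Finset.card_univ, nsmul_eq_mul,
          ENNReal.mul_rpow_of_nonneg _ _ (by positivity), ← ENNReal.rpow_mul,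
          mul_one_div_cancel hp0.ne', ENNReal.rpow_one]

/-- the set of admissible constants -/
def decSet {d n : ℕ} (Q : Fin n → QF d) (C : ℝ) (q p : ℝ≥0∞) (k : ℕ) : Set ℝ :=
  { D : ℝ | 0 ≤ D ∧
    ∀ f : (Fin d → Fin (2 ^ k)) → SchwartzMap ((Fin d → ℝ) × (Fin n → ℝ)) ℂ,
      (∀ ν, Function.support (fourierT (⇑(f ν))) ⊆ Ubox Q (1 / 2 ^ k) C (center k ν)) →
      eLpNorm (fun z => ∑ ν, f ν z) p volume ≤
        ENNReal.ofReal D * lqNorm q (fun ν => eLpNorm (⇑(f ν)) p volume) }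

lemma trivial_dec {d n : ℕ} (Q : Fin n → QF d) (C : ℝ) (p : ℝ≥0∞) (hp2 : 2 ≤ p) (hp : p ≠ ∞)
    (k : ℕ) : ((2 ^ k) ^ d : ℝ) ∈ decSet Q C p p k := by
  have hp0 : 0 < p.toReal := ENNReal.toReal_pos (by rintro rfl; simp at hp2) hp
  refine ⟨by positivity, fun f _ => ?_⟩
  have h1 : eLpNorm (fun z => ∑ ν, f ν z) p volume ≤ ∑ ν, eLpNorm (⇑(f ν)) p volume := by
    have := eLpNorm_sum_le (μ := (volume : Measure ((Fin d → ℝ) × (Fin n → ℝ))))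
      (f := fun ν => ⇑(f ν)) (s := Finset.univ) (p := p)
      (fun ν _ => (f ν).continuous.aestronglyMeasurable) (le_trans (by norm_num) hp2)
    convert this using 2
    funext z; simp
  refine h1.trans ?_
  refine (Finset.sum_le_sum fun ν _ => le_lqNorm p hp0 hp
    (fun ν => eLpNorm (⇑(f ν)) p volume) ν).trans ?_
  rw [Finset.sum_const, Finset.card_univ, nsmul_eq_mul]
  gcongr
  rw [ENNReal.ofReal_pow (by positivity), ENNReal.ofReal_pow (by positivity)]
  simp

lemma gamma_spec {d n : ℕ} (Q : Fin n → QF d) (C : ℝ) (p : ℝ≥0∞) (hp2 : 2 ≤ p) (hp : p ≠ ∞)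
    (ε : ℝ) (hε : 0 < ε) : ∃ B : ℝ, 0 < B ∧ ∀ k : ℕ, 1 ≤ k →
      DecConst Q C p p k < B * (2 ^ k : ℝ) ^ (Gamma Q C p p + ε) := by
  have hne : { G : ℝ | ∀ ε : ℝ, 0 < ε → ∃ Cε : ℝ, ∀ k : ℕ, 1 ≤ k →
      DecConst Q C p p k ≤ Cε * (1 / 2 ^ k : ℝ) ^ (-(G + ε)) }.Nonempty := by
    refine ⟨d, fun ε hε => ⟨1, fun k _ => ?_⟩⟩
    have h1 : DecConst Q C p p k ≤ (2 ^ k) ^ d :=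
      csInf_le ⟨0, fun D hD => hD.1⟩ (trivial_dec Q C p hp2 hp k)
    refine h1.trans ?_
    rw [one_mul, one_div, Real.inv_rpow (by positivity), ← Real.rpow_neg (by positivity),
      neg_neg, ← Real.rpow_natCast]
    exact Real.rpow_le_rpow_of_exponent_le (one_le_pow₀ (by norm_num)) (by linarith)
  have hlt : Gamma Q C p p < Gamma Q C p p + ε / 2 := by linarith
  obtain ⟨G, hG, hGlt⟩ := exists_lt_of_csInf_lt hne hlt
  obtain ⟨Cε, hC⟩ := hG (ε / 2) (by linarith)
  refine ⟨|Cε| + 1, by positivity, fun k hk => (hC k hk).trans_lt ?_⟩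
  rw [one_div, Real.inv_rpow (by positivity), ← Real.rpow_neg (by positivity), neg_neg]
  have h2 : (2 ^ k : ℝ) ^ (G + ε / 2) ≤ (2 ^ k : ℝ) ^ (Gamma Q C p p + ε) :=
    Real.rpow_le_rpow_of_exponent_le (one_le_pow₀ (by norm_num)) (by linarith)
  have h3 : 0 < (2 ^ k : ℝ) ^ (Gamma Q C p p + ε) := by positivity
  have h4 : 0 < (2 ^ k : ℝ) ^ (G + ε / 2) := by positivity
  nlinarith [le_abs_self Cε, abs_nonneg Cε]

/-- shear-dilation -/
def shear {d n : ℕ} (s t : ℝ) (hs : s ≠ 0) (ht : t ≠ 0) (β : Fin n → Fin d → ℝ) :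
    ((Fin d → ℝ) × (Fin n → ℝ)) ≃L[ℝ] ((Fin d → ℝ) × (Fin n → ℝ)) :=
  LinearEquiv.toContinuousLinearEquiv
  { toFun := fun z => (fun j => s * z.1 j + t * ∑ i, β i j * z.2 i, fun i => t * z.2 i)
    map_add' := by
      intro x y
      ext j
      · simp only [Prod.fst_add, Prod.snd_add, Pi.add_apply, mul_add, Finset.sum_add_distrib]; ring
      · simp only [Prod.snd_add, Pi.add_apply, mul_add]
    map_smul' := by
      intro c y
      ext j
      · simp only [Prod.smul_fst, Prod.smul_snd, Pi.smul_apply, smul_eq_mul, RingHom.id_apply,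
          mul_left_comm _ c, ← Finset.mul_sum]; ring
      · simp only [Prod.smul_snd, Pi.smul_apply, smul_eq_mul, RingHom.id_apply]; ring
    invFun := fun z => (fun j => s⁻¹ * (z.1 j - ∑ i, β i j * z.2 i), fun i => t⁻¹ * z.2 i)
    left_inv := by
      intro z
      ext j
      · simp only [mul_left_comm _ t, ← Finset.mul_sum]; field_simp; ring
      · simp only; field_simp
    right_inv := by
      intro z
      ext j
      · simp only [mul_left_comm _ t⁻¹, ← Finset.mul_sum]; field_simp; ring
      · simp only; field_simp }

lemma shear_apply {d n : ℕ} (s t : ℝ) (hs : s ≠ 0) (ht : t ≠ 0) (β : Fin n → Fin d → ℝ)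
    (z : (Fin d → ℝ) × (Fin n → ℝ)) :
    shear s t hs ht β z = (fun j => s * z.1 j + t * ∑ i, β i j * z.2 i, fun i => t * z.2 i) := rfl

lemma shear_ip {d n : ℕ} (s t : ℝ) (hs : s ≠ 0) (ht : t ≠ 0) (β : Fin n → Fin d → ℝ)
    (z ζ : (Fin d → ℝ) × (Fin n → ℝ)) :
    ip z ζ = ip (shear s t hs ht β z)
      (fun j => s⁻¹ * ζ.1 j, fun i => t⁻¹ * ζ.2 i - s⁻¹ * ∑ j, β i j * ζ.1 j) := by
  rw [shear_apply]
  simp only [ip]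
  have h1 : ∑ j, (s * z.1 j + t * ∑ i, β i j * z.2 i) * (s⁻¹ * ζ.1 j) =
      ∑ j, z.1 j * ζ.1 j + t * s⁻¹ * ∑ j, ∑ i, β i j * z.2 i * ζ.1 j := by
    rw [Finset.mul_sum, ← Finset.sum_add_distrib]
    refine Finset.sum_congr rfl fun j _ => ?_
    rw [← Finset.sum_mul]; field_simp
  have h2 : ∑ i, t * z.2 i * (t⁻¹ * ζ.2 i - s⁻¹ * ∑ j, β i j * ζ.1 j) =
      ∑ i, z.2 i * ζ.2 i - t * s⁻¹ * ∑ i, ∑ j, β i j * z.2 i * ζ.1 j := by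
    rw [Finset.mul_sum, ← Finset.sum_sub_distrib]
    refine Finset.sum_congr rfl fun i _ => ?_
    have : ∑ j, β i j * z.2 i * ζ.1 j = z.2 i * ∑ j, β i j * ζ.1 j := by
      rw [Finset.mul_sum]; exact Finset.sum_congr rfl fun j _ => by ring
    rw [this]; field_simp
  rw [h1, h2, Finset.sum_comm]
  ring

lemma polar_sum {d : ℕ} (q : QF d) (x y : Fin d → ℝ) :
    QuadraticMap.polar (⇑q) x y = ∑ j, QuadraticMap.polar (⇑q) (Pi.single j 1) y * x j := by
  have h : ((QuadraticMap.polarBilin q).flip y) x =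
      ∑ j, ((QuadraticMap.polarBilin q).flip y) (Pi.single j 1) * x j := by
    rw [LinearMap.pi_apply_eq_sum_univ ((QuadraticMap.polarBilin q).flip y) x]
    refine Finset.sum_congr rfl fun j _ => ?_
    rw [smul_eq_mul, mul_comm]
    congr 3
    funext i; simp [Pi.single_apply, eq_comm]
  exact h

lemma polar_bound {d : ℕ} (q : QF d) : ∃ B : ℝ, 0 ≤ B ∧ ∀ x y : Fin d → ℝ,
    |QuadraticMap.polar (⇑q) x y| ≤ B * ‖x‖ * ‖y‖ := by
  refine ⟨∑ j, ∑ l, |QuadraticMap.polar (⇑q) (Pi.single l 1) (Pi.single j 1)|, by positivity,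
    fun x y => ?_⟩
  rw [polar_sum, Finset.sum_mul, Finset.sum_mul]
  refine (Finset.abs_sum_le_sum_abs _ _).trans (Finset.sum_le_sum fun j _ => ?_)
  rw [QuadraticMap.polar_comm, polar_sum, abs_mul]
  have h1 : |x j| ≤ ‖x‖ := norm_le_pi_norm x j
  have h2 : |∑ l, QuadraticMap.polar (⇑q) (Pi.single l 1) (Pi.single j 1) * y l| ≤
      (∑ l, |QuadraticMap.polar (⇑q) (Pi.single l 1) (Pi.single j 1)|) * ‖y‖ := by
    rw [Finset.sum_mul]
    refine (Finset.abs_sum_le_sum_abs _ _).trans (Finset.sum_le_sum fun l _ => ?_)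
    rw [abs_mul]
    gcongr
    exact norm_le_pi_norm y l
  calc _ ≤ ((∑ l, |QuadraticMap.polar (⇑q) (Pi.single l 1) (Pi.single j 1)|) * ‖y‖) * ‖x‖ := by
        gcongr
    _ = _ := by ring

/-- the exponential sum -/
def expSum {d n : ℕ} (Q : Fin n → QF d) (W : ℕ) (z : (Fin d → ℝ) × (Fin n → ℝ)) : ℂ :=
  ∑ w : Fin d → Fin (W + 1),
    Complex.exp (((2 * Real.pi * ((∑ j, ((w j : ℕ) : ℝ) * z.1 j)
      + ∑ i, Q i (fun j => ((w j : ℕ) : ℝ)) * z.2 i) : ℝ) : ℂ) * Complex.I)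

lemma expSum_cont {d n : ℕ} (Q : Fin n → QF d) (W : ℕ) : Continuous (expSum Q W) := by
  unfold expSum
  refine continuous_finsetSum _ fun w _ => ?_
  refine Complex.continuous_exp.comp (Continuous.mul (Complex.continuous_ofReal.comp ?_)
    continuous_const)
  fun_prop

lemma expSum_per {d n : ℕ} (Q : Fin n → QF d) (W : ℕ)
    (hint : ∀ i, ∀ w : Fin d → ℤ, ∃ z : ℤ, Q i (fun j => (w j : ℝ)) = (z : ℝ))
    (z : (Fin d → ℝ) × (Fin n → ℝ)) (m : Fin d → ℤ) (l : Fin n → ℤ) :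
    expSum Q W (fun j => z.1 j + m j, fun i => z.2 i + l i) = expSum Q W z := by
  unfold expSum
  refine Finset.sum_congr rfl fun w _ => ?_
  have hq : ∀ i, ∃ a : ℤ, Q i (fun j => ((w j : ℕ) : ℝ)) = (a : ℝ) := fun i => by
    obtain ⟨a, ha⟩ := hint i (fun j => ((w j : ℕ) : ℤ))
    exact ⟨a, by simpa using ha⟩
  choose a ha using hq
  rw [Complex.exp_eq_exp_iff_exists_int]
  refine ⟨(∑ j, ((w j : ℕ) : ℤ) * m j) + ∑ i, a i * l i, ?_⟩
  simp only [ha, mul_add, Finset.sum_add_distrib]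
  push_cast
  ring

lemma phase {d n : ℕ} (Q : Fin n → QF d) (k : ℕ) (K : ℝ) (hK : K ≠ 0)
    (s t : ℝ) (hs : s ≠ 0) (ht : t ≠ 0)
    (hsK : K * s = 1 / 2 ^ k) (htK : K * t = (1 / 2 ^ k) * (1 / 2 ^ k))
    (z : (Fin d → ℝ) × (Fin n → ℝ)) :
    ∃ θ : ℝ, ∀ ν : Fin d → Fin (2 ^ k),
      ip z (center k ν, fun i => Q i (center k ν)) =
        ((∑ j, ((ν j : ℕ) : ℝ) * ((K • shear s t hs ht (fun i j => QuadraticMap.polar (⇑(Q i))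
            (Pi.single j 1) (fun _ => 1 / 2)) z).1 j))
        + ∑ i, Q i (fun j => ((ν j : ℕ) : ℝ)) * ((K • shear s t hs ht
          (fun i j => QuadraticMap.polar (⇑(Q i))
            (Pi.single j 1) (fun _ => 1 / 2)) z).2 i)) + θ := by
  refine ⟨(∑ j, z.1 j * (1 / 2 ^ k * (1 / 2))) +
    ∑ i, z.2 i * ((1 / 2 ^ k) * (1 / 2 ^ k) * Q i (fun _ => 1 / 2)), fun ν => ?_⟩
  have hc : center k ν = (1 / 2 ^ k : ℝ) • ((fun j => ((ν j : ℕ) : ℝ)) + fun _ => (1 / 2 : ℝ)) := by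
    funext j
    simp only [center, Pi.smul_apply, Pi.add_apply, smul_eq_mul, pow_succ]
    field_simp
  have hQ : ∀ i, Q i (center k ν) = (1 / 2 ^ k) * (1 / 2 ^ k) *
      (Q i (fun j => ((ν j : ℕ) : ℝ)) + Q i (fun _ => 1 / 2) +
        ∑ j, QuadraticMap.polar (⇑(Q i)) (Pi.single j 1) (fun _ => 1 / 2) * ((ν j : ℕ) : ℝ)) := by
    intro i
    rw [hc, QuadraticMap.map_smul, QuadraticMap.map_add (⇑(Q i)), smul_eq_mul, polar_sum]
  simp only [ip, hQ, shear_apply, Prod.smul_fst, Prod.smul_snd, Pi.smul_apply, smul_eq_mul]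
  have e1 : ∀ j, K * (s * z.1 j + t * ∑ i, QuadraticMap.polar (⇑(Q i)) (Pi.single j 1)
      (fun _ => 1 / 2) * z.2 i) = (1 / 2 ^ k) * z.1 j + (1 / 2 ^ k) * (1 / 2 ^ k) *
      ∑ i, QuadraticMap.polar (⇑(Q i)) (Pi.single j 1) (fun _ => 1 / 2) * z.2 i := by
    intro j
    rw [mul_add, ← mul_assoc, ← mul_assoc, hsK, htK]
  have e2 : ∀ i, K * (t * z.2 i) = (1 / 2 ^ k) * (1 / 2 ^ k) * z.2 i := by
    intro i; rw [← mul_assoc, htK]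
  simp only [e1, e2, hc, Pi.smul_apply, Pi.add_apply, smul_eq_mul]
  generalize (1 / 2 ^ k : ℝ) = δ
  have e3 : ∑ j, ((ν j : ℕ) : ℝ) * (δ * z.1 j + δ * δ *
      ∑ i, QuadraticMap.polar (⇑(Q i)) (Pi.single j 1) (fun _ => 1 / 2) * z.2 i) =
      ∑ j, z.1 j * (δ * ((ν j : ℕ) : ℝ)) + ∑ i, z.2 i * (δ * δ *
        ∑ j, QuadraticMap.polar (⇑(Q i)) (Pi.single j 1) (fun _ => 1 / 2) * ((ν j : ℕ) : ℝ)) := by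
    simp only [mul_add, Finset.sum_add_distrib, Finset.mul_sum]
    congr 1
    · exact Finset.sum_congr rfl fun j _ => by ring
    · rw [Finset.sum_comm]
      exact Finset.sum_congr rfl fun j _ => Finset.sum_congr rfl fun i _ => by ring
  rw [e3]
  simp only [mul_add, Finset.sum_add_distrib]
  have e4 : ∑ i, z.2 i * (δ * δ * Q i (fun j => ((ν j : ℕ) : ℝ))) =
      ∑ i, Q i (fun j => ((ν j : ℕ) : ℝ)) * (δ * δ * z.2 i) :=
    Finset.sum_congr rfl fun i _ => by ring
  rw [e4]
  ring

lemma in_box {d n : ℕ} (Q : Fin n → QF d) (Cb : ℝ) (hCb : 1 ≤ Cb) (k : ℕ)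
    (K ρ B : ℝ) (hK : 0 < K) (hρ : 0 < ρ) (hB0 : 0 ≤ B)
    (hB : ∀ i, ∀ x y : Fin d → ℝ, |QuadraticMap.polar (⇑(Q i)) x y| ≤ B * ‖x‖ * ‖y‖)
    (hKρ : ρ * (1 + B * 2 ^ k) ≤ K)
    (s t : ℝ) (hs : s⁻¹ = K * 2 ^ k) (ht : t⁻¹ = K * 2 ^ k * 2 ^ k)
    (ν : Fin d → Fin (2 ^ k)) (ξ : (Fin d → ℝ) × (Fin n → ℝ))
    (h : ‖((fun j => s⁻¹ * (ξ - (center k ν, fun i => Q i (center k ν))).1 j,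
      fun i => t⁻¹ * (ξ - (center k ν, fun i => Q i (center k ν))).2 i - s⁻¹ *
        ∑ j, QuadraticMap.polar (⇑(Q i)) (Pi.single j 1) (fun _ => 1 / 2) *
          (ξ - (center k ν, fun i => Q i (center k ν))).1 j) :
          (Fin d → ℝ) × (Fin n → ℝ))‖ ≤ ρ) :
    ξ ∈ Ubox Q (1 / 2 ^ k) Cb (center k ν) := by
  have hN : (0 : ℝ) < 2 ^ k := by positivity
  set a := center k ν with ha
  have hc : a = (1 / 2 ^ k : ℝ) • ((fun j => ((ν j : ℕ) : ℝ)) + fun _ => (1 / 2 : ℝ)) := by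
    funext j
    simp only [ha, center, Pi.smul_apply, Pi.add_apply, smul_eq_mul, pow_succ]
    field_simp
  obtain ⟨h1, h2⟩ := norm_prod_le_iff.1 h
  simp only [hs, ht] at h1 h2
  have hKρ' : ρ ≤ K := le_trans (by nlinarith [mul_nonneg hρ.le (mul_nonneg hB0 hN.le)]) hKρ
  let η : Fin d → ℝ := fun j => K * 2 ^ k * (ξ.1 j - a j)
  have hη : ‖η‖ ≤ ρ := h1
  have h2' : ∀ i, |K * 2 ^ k * 2 ^ k * (ξ.2 i - Q i a) -
      QuadraticMap.polar (⇑(Q i)) η (fun _ => 1 / 2)| ≤ ρ := by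
    intro i
    refine le_trans (le_of_eq ?_) ((norm_le_pi_norm _ i).trans h2)
    rw [polar_sum, Real.norm_eq_abs]
    congr 1
    simp only [Prod.fst_sub, Prod.snd_sub, Pi.sub_apply, η]
    rw [Finset.mul_sum]
    congr 1
    exact Finset.sum_congr rfl fun j _ => by ring
  have hu : (1 / 2 ^ k : ℝ) • ((1 / K) • η) = ξ.1 - a := by
    funext j
    simp only [Pi.smul_apply, smul_eq_mul, η, Pi.sub_apply]
    field_simp
  have hν : ‖fun j => ((ν j : ℕ) : ℝ)‖ ≤ 2 ^ k := by
    refine (pi_norm_le_iff_of_nonneg hN.le).2 fun j => ?_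
    rw [Real.norm_of_nonneg (by positivity)]
    exact_mod_cast (ν j).2.le
  refine ⟨(1 / K) • η, fun i => (2 ^ k * 2 ^ k) * (ξ.2 i - Q i a -
    QuadraticMap.polar (⇑(Q i)) a (ξ.1 - a)), ?_, ?_, ?_, ?_⟩
  · intro j
    rw [Pi.smul_apply, smul_eq_mul, abs_mul, abs_of_pos (by positivity)]
    have : |η j| ≤ ρ := (norm_le_pi_norm η j).trans hη
    rw [one_div, inv_mul_le_iff₀ hK]
    nlinarith
  · intro i
    have hpol : (2 ^ k * 2 ^ k) * QuadraticMap.polar (⇑(Q i)) a (ξ.1 - a) =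
        (1 / K) * (QuadraticMap.polar (⇑(Q i)) (fun j => ((ν j : ℕ) : ℝ)) η +
          QuadraticMap.polar (⇑(Q i)) η (fun _ => 1 / 2)) := by
      rw [← hu, hc]
      simp only [QuadraticMap.polar_smul_left, QuadraticMap.polar_smul_right,
        QuadraticMap.polar_add_left, smul_eq_mul]
      rw [QuadraticMap.polar_comm (⇑(Q i)) (fun _ => 1 / 2) η]
      field_simp
    have e : (2 ^ k * 2 ^ k) * (ξ.2 i - Q i a - QuadraticMap.polar (⇑(Q i)) a (ξ.1 - a)) =
        (1 / K) * ((K * 2 ^ k * 2 ^ k * (ξ.2 i - Q i a) -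
          QuadraticMap.polar (⇑(Q i)) η (fun _ => 1 / 2)) -
          QuadraticMap.polar (⇑(Q i)) (fun j => ((ν j : ℕ) : ℝ)) η) := by
      rw [mul_sub, hpol]
      field_simp
      ring
    simp only [e]
    rw [abs_mul, abs_of_pos (by positivity : 0 < 1 / K), one_div, inv_mul_le_iff₀ hK]
    refine (abs_sub _ _).trans ?_
    have h3 := hB i (fun j => ((ν j : ℕ) : ℝ)) η
    have h4 : B * ‖fun j => ((ν j : ℕ) : ℝ)‖ * ‖η‖ ≤ B * 2 ^ k * ρ := by gcongr
    have h5 := h2' i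
    nlinarith
  · funext j
    have := congrFun hu j
    simp only [Pi.smul_apply, smul_eq_mul, Pi.sub_apply] at this ⊢
    linarith
  · funext i
    rw [hu]
    field_simp
    ring

lemma main_ineq {d n : ℕ} (Q : Fin n → QF d) (Cb : ℝ) (hCb : 1 ≤ Cb)
    (hint : ∀ i, ∀ w : Fin d → ℤ, ∃ z : ℤ, Q i (fun j => (w j : ℝ)) = (z : ℝ))
    (p : ℝ≥0∞) (hp2 : 2 ≤ p) (hp : p ≠ ∞) :
    ∃ C0 : ℝ, 0 < C0 ∧ ∀ (k W : ℕ) (D : ℝ), W + 1 ≤ 2 ^ k → D ∈ decSet Q Cb p p k →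
      eLpNorm (expSum Q W) p
        (volume.restrict ((Set.univ.pi fun _ : Fin d => Set.Icc (0 : ℝ) 1) ×ˢ
          (Set.univ.pi fun _ : Fin n => Set.Icc (0 : ℝ) 1))) ≤
      ENNReal.ofReal (C0 * D * (2 ^ k : ℝ) ^ ((d : ℝ) / p.toReal)) := by
  have hp0 : 0 < p.toReal := ENNReal.toReal_pos (by rintro rfl; simp at hp2) hp
  obtain ⟨φ, ρ, c, hρ, hc, hφ1, hφ2⟩ := base_schwartz' d n
  choose Bi hBi0 hBi using fun i => polar_bound (Q i)
  set B := ∑ i, Bi i with hBdef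
  have hB0 : 0 ≤ B := Finset.sum_nonneg fun i _ => hBi0 i
  have hB : ∀ i, ∀ x y : Fin d → ℝ,
      |QuadraticMap.polar (⇑(Q i)) x y| ≤ B * ‖x‖ * ‖y‖ := by
    intro i x y
    refine (hBi i x y).trans ?_
    gcongr
    exact Finset.single_le_sum (f := Bi) (fun i _ => hBi0 i) (Finset.mem_univ i)
  obtain ⟨A, hA⟩ := exists_nat_gt (ρ * (1 + B))
  have hA0 : (0 : ℝ) < A := lt_of_le_of_lt (by positivity) hA
  have hφfin : eLpNorm (⇑φ) p volume ≠ ∞ := by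
    have := haar_inst d n
    exact (φ.memLp p volume).2.ne
  refine ⟨((eLpNorm (⇑φ) p volume).toReal + 1) / c, by positivity, fun k W D hW hD => ?_⟩
  have hN : (1 : ℝ) ≤ 2 ^ k := one_le_pow₀ (by norm_num)
  set K : ℕ := A * 2 ^ k with hKdef
  have hKpos : 0 < K := Nat.mul_pos (by exact_mod_cast hA0) (by positivity)
  have hKR : (0 : ℝ) < K := by exact_mod_cast hKpos
  have hKρ : ρ * (1 + B * 2 ^ k) ≤ K := by
    rw [hKdef]; push_cast
    have : ρ * (1 + B * 2 ^ k) ≤ ρ * (1 + B) * 2 ^ k := by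
      nlinarith
    refine this.trans ?_
    gcongr
  set s : ℝ := (K * 2 ^ k : ℝ)⁻¹ with hs
  set t : ℝ := (K * 2 ^ k * 2 ^ k : ℝ)⁻¹ with ht
  have hs0 : s ≠ 0 := by positivity
  have ht0 : t ≠ 0 := by positivity
  set β : Fin n → Fin d → ℝ := fun i j => QuadraticMap.polar (⇑(Q i))
            (Pi.single j 1) (fun _ => 1 / 2) with hβ
  set P := shear s t hs0 ht0 β with hP
  have hmod := fun b => modulate φ P _ (shear_ip s t hs0 ht0 β) b
  choose g hg1 hg2 using hmod
  -- the tuple of functions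
  let f : (Fin d → Fin (2 ^ k)) → SchwartzMap ((Fin d → ℝ) × (Fin n → ℝ)) ℂ := fun ν =>
    if ∀ j, (ν j : ℕ) < W + 1 then g (center k ν, fun i => Q i (center k ν)) else 0
  have hfsupp : ∀ ν, Function.support (fourierT (⇑(f ν))) ⊆
      Ubox Q (1 / 2 ^ k) Cb (center k ν) := by
    intro ν ξ hξ
    by_cases hν : ∀ j, (ν j : ℕ) < W + 1
    · simp only [f, if_pos hν] at hξ
      have h1 := hφ2 _ (hg2 _ ξ hξ)
      exact in_box Q Cb hCb k K ρ B hKR hρ hB0 hB hKρ s t (by rw [hs, inv_inv])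
        (by rw [ht, inv_inv]) ν ξ h1
    · simp only [f, if_neg hν] at hξ
      exact absurd (by simp [fourierT]) hξ
  have hdec := hD.2 f hfsupp
  obtain ⟨cP, hcP, hmap⟩ := (by
    have := haar_inst d n
    exact map_clequiv (volume : Measure ((Fin d → ℝ) × (Fin n → ℝ))) P)
  have hmeas : Measurable P := P.continuous.measurable
  set κ : ℝ≥0∞ := ENNReal.ofReal cP ^ (1 / p).toReal with hκ
  have hcP0 : ENNReal.ofReal cP ≠ 0 := by simpa using hcP
  have hκ0 : κ ≠ 0 := by
    rw [hκ]; exact (ENNReal.rpow_pos (by simpa using hcP) ENNReal.ofReal_ne_top).ne'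
  have hκt : κ ≠ ∞ := ENNReal.rpow_ne_top_of_nonneg (by positivity) ENNReal.ofReal_ne_top
  have hcomp : ∀ u : (Fin d → ℝ) × (Fin n → ℝ) → ℂ, Continuous u →
      eLpNorm (fun z => u (P z)) p volume = κ * eLpNorm u p volume := by
    intro u hu
    have h1 := eLpNorm_map_measure (μ := volume) (p := p) (f := P) (g := u)
      hu.aestronglyMeasurable hmeas.aemeasurable
    rw [hmap, eLpNorm_smul_measure_of_ne_top hp, smul_eq_mul] at h1
    exact h1.symm
  -- left side
  have hsum : eLpNorm (fun z => ∑ ν, f ν z) p volume =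
      κ * eLpNorm (fun z => expSum Q W ((K : ℝ) • z) * φ z) p volume := by
    rw [← hcomp (fun z => expSum Q W ((K : ℝ) • z) * φ z) (((expSum_cont Q W).comp (continuous_const_smul _)).mul φ.continuous)]
    refine eLpNorm_congr_norm_ae (Filter.Eventually.of_forall fun z => ?_)
    obtain ⟨θ, hθ⟩ := phase Q k K hKR.ne' s t hs0 ht0 (by rw [hs]; field_simp)
      (by rw [ht]; field_simp) z
    have h1 : ∑ ν, f ν z = Complex.exp (((2 * Real.pi * θ : ℝ) : ℂ) * Complex.I) *
        (expSum Q W ((K : ℝ) • P z) * φ (P z)) := by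
      rw [expSum, Finset.sum_mul, Finset.mul_sum]
      symm
      refine Fintype.sum_of_injective
        (fun (w : Fin d → Fin (W + 1)) (j : Fin d) => Fin.castLE hW (w j)) ?_ _ _ ?_ ?_
      · intro w w' h
        funext j
        exact Fin.castLE_injective hW (congrFun h j)
      · intro ν hν
        have : ¬ ∀ j, (ν j : ℕ) < W + 1 := fun h => hν ⟨fun j => ⟨ν j, h j⟩, rfl⟩
        simp only [f, if_neg this]; rfl
      · intro w
        have : ∀ j, ((Fin.castLE hW (w j) : Fin (2 ^ k)) : ℕ) < W + 1 := fun j => (w j).2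
        simp only [f, if_pos this]
        rw [hg1, hθ, ← mul_assoc, ← Complex.exp_add]
        congr 2
        simp only [Fin.val_castLE]
        push_cast
        ring
    rw [h1, norm_mul, Complex.norm_exp_ofReal_mul_I, one_mul]
  -- right side
  have hfn : ∀ ν, eLpNorm (⇑(f ν)) p volume ≤ κ * eLpNorm (⇑φ) p volume := by
    intro ν
    rw [← hcomp _ φ.continuous]
    refine eLpNorm_mono fun z => ?_
    by_cases hν : ∀ j, (ν j : ℕ) < W + 1
    · simp only [f, if_pos hν]
      rw [hg1, norm_mul, Complex.norm_exp_ofReal_mul_I, one_mul]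
    · simp only [f, if_neg hν]
      simp
  have hlq := lqNorm_le p hp0 hp _ _ hfn
  have hmain : eLpNorm (fun z => expSum Q W ((K : ℝ) • z) * φ z) p volume ≤
      ENNReal.ofReal D * (Fintype.card (Fin d → Fin (2 ^ k)) : ℝ≥0∞) ^ (1 / p.toReal) *
        eLpNorm (⇑φ) p volume := by
    rw [hsum] at hdec
    have h1 := hdec.trans (mul_le_mul_right hlq (ENNReal.ofReal D))
    rw [← ENNReal.mul_le_mul_iff_right hκ0 hκt]
    refine h1.trans (le_of_eq ?_)
    ring
  have hlow : ENNReal.ofReal c * eLpNorm (expSum Q W) p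
        (volume.restrict ((Set.univ.pi fun _ : Fin d => Set.Icc (0 : ℝ) 1) ×ˢ
          (Set.univ.pi fun _ : Fin n => Set.Icc (0 : ℝ) 1))) ≤
      eLpNorm (fun z => expSum Q W ((K : ℝ) • z) * φ z) p volume := by
    rw [dilate_mp d n K hKpos p _ (expSum_cont Q W) (expSum_per Q W hint)]
    have h1 : ENNReal.ofReal c = ‖(c : ℂ)‖ₑ := by
      rw [← ofReal_norm, Complex.norm_real, Real.norm_of_nonneg hc.le]
    rw [h1, ← eLpNorm_const_smul]
    refine le_trans ?_ (eLpNorm_mono_measure _ (Measure.restrict_le_self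
      (s := (Set.univ.pi fun _ : Fin d => Set.Icc (0 : ℝ) 1) ×ˢ
          (Set.univ.pi fun _ : Fin n => Set.Icc (0 : ℝ) 1))))
    refine eLpNorm_mono_ae ?_
    refine (ae_restrict_iff' ((MeasurableSet.univ_pi fun _ => measurableSet_Icc).prod
      (MeasurableSet.univ_pi fun _ => measurableSet_Icc))).2
      (Filter.Eventually.of_forall fun z hz => ?_)
    have hz1 : ‖z‖ ≤ 1 := by
      refine norm_prod_le_iff.2 ⟨(pi_norm_le_iff_of_nonneg (by norm_num)).2 fun j => ?_,
        (pi_norm_le_iff_of_nonneg (by norm_num)).2 fun j => ?_⟩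
      · have := hz.1 j trivial
        rw [Real.norm_of_nonneg this.1]; exact this.2
      · have := hz.2 j trivial
        rw [Real.norm_of_nonneg this.1]; exact this.2
    rw [Pi.smul_apply, norm_smul, norm_mul, Complex.norm_real, Real.norm_of_nonneg hc.le, mul_comm]
    gcongr
    exact hφ1 z hz1
  have hfin := hlow.trans hmain
  have hcard : (Fintype.card (Fin d → Fin (2 ^ k)) : ℝ≥0∞) ^ (1 / p.toReal) =
      ENNReal.ofReal ((2 ^ k : ℝ) ^ ((d : ℝ) / p.toReal)) := by
    rw [div_eq_mul_one_div (d : ℝ), Real.rpow_mul (by positivity), Real.rpow_natCast,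
      ← ENNReal.ofReal_rpow_of_nonneg (by positivity) (by positivity)]
    congr 1
    rw [ENNReal.ofReal_pow (by positivity), ENNReal.ofReal_pow (by positivity)]
    simp
  have hφr : eLpNorm (⇑φ) p volume ≤ ENNReal.ofReal ((eLpNorm (⇑φ) p volume).toReal + 1) := by
    rw [ENNReal.le_ofReal_iff_toReal_le hφfin (by positivity)]
    linarith
  have hDnn := hD.1
  rw [← ENNReal.mul_le_mul_iff_right (a := ENNReal.ofReal c) (by simpa using hc)
    ENNReal.ofReal_ne_top, ← ENNReal.ofReal_mul hc.le]
  refine hfin.trans ?_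
  rw [hcard]
  refine (mul_le_mul_right hφr _).trans (le_of_eq ?_)
  rw [← ENNReal.ofReal_mul hDnn, ← ENNReal.ofReal_mul (by positivity)]
  congr 1
  field_simp

/-- exponential sum estimate: if the quadratic forms `Qᵢ` have integer
coefficients (equivalently, take integer values on integer points), then for `p ≥ 2` and
`ε > 0` there is a constant `C` such that for every `W ≥ 1`,
`‖∑_{𝐰 ∈ {0,…,W}^d} e^{2πi(𝐰·x + 𝐪(𝐰)·y)}‖_{L^p([0,1]^d × [0,1]^n)}
  ≤ C W^{Γ_p(𝐪) + d/p + ε}`. -/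
theorem statement_5 (d n : ℕ) (hd : 1 ≤ d) (hn : 1 ≤ n)
    (Q : Fin n → QF d) (Cb : ℝ) (hCb : 1 ≤ Cb)
    (hint : ∀ i, ∀ w : Fin d → ℤ, ∃ z : ℤ, Q i (fun j => (w j : ℝ)) = (z : ℝ))
    (p : ℝ≥0∞) (hp2 : 2 ≤ p) (hp : p ≠ ∞) (ε : ℝ) (hε : 0 < ε) :
    ∃ Cc : ℝ, ∀ W : ℕ, 0 < W →
      eLpNorm
        (fun z : (Fin d → ℝ) × (Fin n → ℝ) =>
          ∑ w : Fin d → Fin (W + 1),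
            Complex.exp
              (((2 * Real.pi * ((∑ j, ((w j : ℕ) : ℝ) * z.1 j)
                + ∑ i, Q i (fun j => ((w j : ℕ) : ℝ)) * z.2 i) : ℝ) : ℂ) * Complex.I))
        p
        (volume.restrict ((Set.univ.pi fun _ : Fin d => Set.Icc (0 : ℝ) 1) ×ˢ
          (Set.univ.pi fun _ : Fin n => Set.Icc (0 : ℝ) 1)))
      ≤ ENNReal.ofReal (Cc * (W : ℝ) ^ (Gamma Q Cb p p + (d : ℝ) / p.toReal + ε)) := by
  obtain ⟨C0, hC0, hmain⟩ := main_ineq Q Cb hCb hint p hp2 hp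
  obtain ⟨B, hB, hdec⟩ := gamma_spec Q Cb p hp2 hp ε hε
  set e : ℝ := Gamma Q Cb p p + ε with he
  have hp0 : 0 < p.toReal := ENNReal.toReal_pos (by rintro rfl; simp at hp2) hp
  refine ⟨C0 * (B * (4 : ℝ) ^ |e|) * (4 : ℝ) ^ ((d : ℝ) / p.toReal), fun W hW => ?_⟩
  obtain ⟨k, hk1, hk2, hk3⟩ : ∃ k : ℕ, 1 ≤ k ∧ W + 1 ≤ 2 ^ k ∧ 2 ^ k ≤ 4 * W := by
    refine ⟨Nat.log 2 W + 1, by omega, Nat.lt_pow_succ_log_self (by norm_num) W, ?_⟩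
    have := Nat.pow_log_le_self 2 hW.ne'
    rw [pow_succ]; omega
  have hlt := hdec k hk1
  have hne : (decSet Q Cb p p k).Nonempty := ⟨_, trivial_dec Q Cb p hp2 hp k⟩
  obtain ⟨D, hD, hDlt⟩ := exists_lt_of_csInf_lt hne hlt
  refine (hmain k W D hk2 hD).trans (ENNReal.ofReal_le_ofReal ?_)
  have hWR : (1 : ℝ) ≤ W := by exact_mod_cast hW
  have hW0 : (0 : ℝ) < W := by linarith
  have hk2' : (W : ℝ) ≤ 2 ^ k := by
    have : W ≤ 2 ^ k := by omega
    exact_mod_cast this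
  have hk3' : (2 ^ k : ℝ) ≤ 4 * W := by exact_mod_cast hk3
  have h1 : (2 ^ k : ℝ) ^ e ≤ (4 : ℝ) ^ |e| * (W : ℝ) ^ e := by
    rcases le_or_gt 0 e with h | h
    · rw [abs_of_nonneg h, ← Real.mul_rpow (by norm_num) hW0.le]
      exact Real.rpow_le_rpow (by positivity) hk3' h
    · have h2 : (2 ^ k : ℝ) ^ e ≤ (W : ℝ) ^ e := Real.rpow_le_rpow_of_nonpos hW0 hk2' h.le
      have h3 : 1 ≤ (4 : ℝ) ^ |e| := Real.one_le_rpow (by norm_num) (abs_nonneg e)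
      have h4 : 0 < (W : ℝ) ^ e := by positivity
      nlinarith
  have h2 : (2 ^ k : ℝ) ^ ((d : ℝ) / p.toReal) ≤
      (4 : ℝ) ^ ((d : ℝ) / p.toReal) * (W : ℝ) ^ ((d : ℝ) / p.toReal) := by
    rw [← Real.mul_rpow (by norm_num) hW0.le]
    exact Real.rpow_le_rpow (by positivity) hk3' (by positivity)
  have h3 : Gamma Q Cb p p + (d : ℝ) / p.toReal + ε = e + (d : ℝ) / p.toReal := by
    rw [he]; ring
  rw [h3, Real.rpow_add hW0]
  have hD1 : D ≤ B * ((4 : ℝ) ^ |e| * (W : ℝ) ^ e) :=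
    hDlt.le.trans (by gcongr)
  calc C0 * D * (2 ^ k : ℝ) ^ ((d : ℝ) / p.toReal)
      ≤ C0 * (B * ((4 : ℝ) ^ |e| * (W : ℝ) ^ e)) *
        ((4 : ℝ) ^ ((d : ℝ) / p.toReal) * (W : ℝ) ^ ((d : ℝ) / p.toReal)) := by
        gcongr
    _ = _ := by ring

end GOZZK
end
end

section
/- Let d ≥ 3 and let 𝐪 = (Q_1, Q_2) be two linearly independent quadratic forms on ℝ^d. Then the following are equivalent: (a) for every choice of d−2 linearly independent vectors u_1, …, u_{d−2} ∈ ℝ^d, the polynomial ξ ↦ det[∇Q_1(ξ); ∇Q_2(ξ); u_1; …; u_{d−2}] does not vanish identically; (b) 𝔡_2(𝐪) = d and 𝔡_1(𝐪) ≥ d − 1. -/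
open MeasureTheory
open scoped ENNReal

noncomputable section

namespace GOZZK

/-- `NV 𝐩`: the number of variables that some component of the tuple `𝐩` of quadratic
forms depends on (equivalently, the number of indices `j` such that `∂_{ξ_j} P ≢ 0` for some
component `P` of `𝐩`). -/
def NV {d : ℕ} {ι : Type*} (Q : ι → QF d) : ℕ :=
  Set.ncard { j : Fin d | ∃ i, ∃ ξ : Fin d → ℝ, Q i (Function.update ξ j 0) ≠ Q i ξ }

/-- `𝔡_{d',n'}(𝐪)`: the infimum of `NV (M' · (𝐪 ∘ M))` over all real `d × d` matrices `M`
of rank `d'` and all real `n × n` matrices `M'` of rank `n'`. -/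
def numvar {d : ℕ} {ι : Type*} [Fintype ι] [DecidableEq ι]
    (Q : ι → QF d) (d' n' : ℕ) : ℕ :=
  sInf { k | ∃ (M : Matrix (Fin d) (Fin d) ℝ) (M' : Matrix ι ι ℝ),
    M.rank = d' ∧ M'.rank = n' ∧
    NV (fun i => ∑ i' : ι, M' i i' • (Q i').comp (Matrix.vecMulLinear M)) = k }

/-- The gradient of a quadratic form `Q` at `ξ`. -/
def grad {d : ℕ} (Qf : QF d) (ξ : Fin d → ℝ) : Fin d → ℝ :=
  fun j => QuadraticMap.polar (⇑Qf) ξ (Pi.single j 1)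

lemma polar_comp' {d : ℕ} {ι : Type*} [Fintype ι] (Q : ι → QF d)
    (M : Matrix (Fin d) (Fin d) ℝ) (c : ι → ℝ) (x y : Fin d → ℝ) :
    QuadraticMap.polar (⇑(∑ i' : ι, c i' • (Q i').comp (Matrix.vecMulLinear M) : QF d)) x y
      = ∑ i', c i' * QuadraticMap.polar (Q i') (Matrix.vecMul x M) (Matrix.vecMul y M) := by
  simp only [QuadraticMap.polar, sum_apply, smul_apply,
    QuadraticMap.comp_apply, Matrix.vecMulLinear_apply, Matrix.add_vecMul, smul_eq_mul,
    ← Finset.sum_sub_distrib, mul_sub]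

lemma unc_iff {d : ℕ} (P : QF d) (j : Fin d) :
    (∀ ξ : Fin d → ℝ, P (Function.update ξ j 0) = P ξ) ↔
      ∀ ξ, QuadraticMap.polar P ξ (Pi.single j 1) = 0 := by
  constructor
  · intro h ξ
    have h1 : Function.update (ξ + Pi.single j 1) j 0 = Function.update ξ j 0 := by
      ext k
      by_cases hk : k = j
      · subst hk; simp
      · simp [hk]
    have h2 : Function.update (Pi.single j (1:ℝ)) j 0 = (0 : Fin d → ℝ) := by
      ext k
      by_cases hk : k = j
      · subst hk; simp
      · simp [hk]
    have e1 := h (ξ + Pi.single j 1)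
    have e2 := h ξ
    have e3 := h (Pi.single j 1)
    rw [h1] at e1
    rw [h2, QuadraticMap.map_zero] at e3
    simp only [QuadraticMap.polar]
    linarith
  · intro h ξ
    have h1 : ξ = Function.update ξ j 0 + ξ j • Pi.single j (1:ℝ) := by
      ext k
      by_cases hk : k = j
      · subst hk; simp
      · simp [hk]
    have h2 : P (Pi.single j 1) = 0 := by
      have := h (Pi.single j 1)
      rw [QuadraticMap.polar_self] at this
      simpa using this
    conv_rhs => rw [h1]
    rw [QuadraticMap.map_add (⇑P), QuadraticMap.map_smul, QuadraticMap.polar_smul_right, h, h2]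
    simp

lemma unc_comp {d : ℕ} {ι : Type*} [Fintype ι] (Q : ι → QF d)
    (M : Matrix (Fin d) (Fin d) ℝ) (hM : IsUnit M) (M' : Matrix ι ι ℝ) (j : Fin d) :
    j ∉ { j : Fin d | ∃ i, ∃ ξ : Fin d → ℝ,
      (fun i => ∑ i' : ι, M' i i' • (Q i').comp (Matrix.vecMulLinear M)) i (Function.update ξ j 0) ≠
      (fun i => ∑ i' : ι, M' i i' • (Q i').comp (Matrix.vecMulLinear M)) i ξ } ↔
    ∀ i ξ, ∑ i', M' i i' * QuadraticMap.polar (Q i') ξ (M j) = 0 := by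
  simp only [Set.mem_ofPred_eq, not_exists, not_not]
  refine forall_congr' fun i => ?_
  rw [unc_iff]
  simp only [polar_comp', Matrix.single_one_vecMul]
  constructor
  · intro h ξ
    obtain ⟨η, hη⟩ := (Matrix.vecMul_surjective_iff_isUnit.2 hM) ξ
    rw [← hη]; exact h η
  · intro h ξ; exact h _

lemma isUnit_of_rank {n : Type*} [Fintype n] [DecidableEq n] (M : Matrix n n ℝ)
    (h : M.rank = Fintype.card n) : IsUnit M := by
  rw [← Matrix.linearIndependent_rows_iff_isUnit, linearIndependent_iff_card_eq_finrank_span,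
    Set.finrank, ← Matrix.rank_eq_finrank_span_row, h]

lemma extend_rows {d k : ℕ} (v : Fin k → Fin d → ℝ) (hv : LinearIndependent ℝ v) :
    ∃ (M : Matrix (Fin d) (Fin d) ℝ) (g : Fin k → Fin d), IsUnit M ∧ Function.Injective g ∧
      ∀ a, M (g a) = v a := by
  classical
  let b := Module.Basis.sumExtend hv
  have : Fintype (Fin k ⊕ Module.Basis.sumExtendIndex hv) :=
    FiniteDimensional.fintypeBasisIndex b
  have hc := Module.finrank_eq_card_basis b
  rw [Module.finrank_fin_fun] at hc
  let f : (Fin k ⊕ Module.Basis.sumExtendIndex hv) ≃ Fin d :=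
    Fintype.equivOfCardEq (by rw [← hc, Fintype.card_fin])
  refine ⟨Matrix.of (b.reindex f), fun a => f (Sum.inl a), ?_, ?_, ?_⟩
  · rw [← Matrix.linearIndependent_rows_iff_isUnit]
    exact (b.reindex f).linearIndependent
  · intro a a' h; simpa using h
  · intro a
    show b.reindex f (f (Sum.inl a)) = v a
    rw [Module.Basis.reindex_apply, Equiv.symm_apply_apply]
    simp [b, Module.Basis.sumExtend]
    rfl

lemma numvar_le {d : ℕ} {ι : Type*} [Fintype ι] [DecidableEq ι] (Q : ι → QF d) (n' : ℕ)
    (hex : ∃ M' : Matrix ι ι ℝ, M'.rank = n') : numvar Q d n' ≤ d := by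
  obtain ⟨M', h⟩ := hex
  have hle : numvar Q d n' ≤ NV (fun i => ∑ i' : ι, M' i i' • (Q i').comp
      (Matrix.vecMulLinear (1 : Matrix (Fin d) (Fin d) ℝ))) :=
    Nat.sInf_le ⟨1, M', by simp, h, rfl⟩
  refine hle.trans ?_
  simpa [NV] using Set.ncard_le_card (α := Fin d) _

lemma numvar_key {d : ℕ} {ι : Type*} [Fintype ι] [DecidableEq ι] (Q : ι → QF d) (n' k : ℕ)
    (hex : ∃ M' : Matrix ι ι ℝ, M'.rank = n') :
    numvar Q d n' + k ≤ d ↔ ∃ M' : Matrix ι ι ℝ, M'.rank = n' ∧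
      ∃ v : Fin k → Fin d → ℝ, LinearIndependent ℝ v ∧
        ∀ a i ξ, ∑ i', M' i i' * QuadraticMap.polar (Q i') ξ (v a) = 0 := by
  constructor
  · intro h
    have hne : { k | ∃ (M : Matrix (Fin d) (Fin d) ℝ) (M' : Matrix ι ι ℝ),
      M.rank = d ∧ M'.rank = n' ∧
      NV (fun i => ∑ i' : ι, M' i i' • (Q i').comp (Matrix.vecMulLinear M)) = k }.Nonempty := by
      obtain ⟨M', h⟩ := hex
      exact ⟨_, 1, M', by simp, h, rfl⟩
    obtain ⟨M, M', hM, hM', hk⟩ := Nat.sInf_mem hne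
    have hMu := isUnit_of_rank M (by simpa using hM)
    refine ⟨M', hM', ?_⟩
    have hk' : NV (fun i => ∑ i' : ι, M' i i' • (Q i').comp (Matrix.vecMulLinear M)) + k ≤ d := by
      rw [hk]; exact h
    unfold NV at hk'
    set S := { j : Fin d | ∃ i, ∃ ξ : Fin d → ℝ,
      (fun i => ∑ i' : ι, M' i i' • (Q i').comp (Matrix.vecMulLinear M)) i (Function.update ξ j 0) ≠
      (fun i => ∑ i' : ι, M' i i' • (Q i').comp (Matrix.vecMulLinear M)) i ξ } with hS
    have hadd := Set.ncard_add_ncard_compl S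
    rw [Nat.card_eq_fintype_card, Fintype.card_fin] at hadd
    have hkc : k ≤ Sᶜ.ncard := by omega
    have : Fintype (Sᶜ : Set (Fin d)) := Fintype.ofFinite _
    have : Nonempty (Fin k ↪ (Sᶜ : Set (Fin d))) := by
      apply Function.Embedding.nonempty_of_card_le
      rw [Fintype.card_fin, ← Nat.card_eq_fintype_card]
      exact hkc
    obtain ⟨g⟩ := this
    have hli := Matrix.linearIndependent_rows_iff_isUnit.2 hMu
    refine ⟨fun a => M (g a), hli.comp (fun a => (g a : Fin d))
      (Subtype.val_injective.comp g.injective), fun a => ?_⟩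
    exact (unc_comp Q M hMu M' (g a)).1 (g a).2
  · rintro ⟨M', hM', v, hv, h⟩
    obtain ⟨M, g, hM, hg, hMv⟩ := extend_rows v hv
    have hle : numvar Q d n' ≤ NV (fun i => ∑ i' : ι, M' i i' • (Q i').comp (Matrix.vecMulLinear M)) :=
      Nat.sInf_le ⟨M, M', by simpa using Matrix.rank_of_isUnit M hM, hM', rfl⟩
    refine (Nat.add_le_add_right hle k).trans ?_
    unfold NV
    set S := { j : Fin d | ∃ i, ∃ ξ : Fin d → ℝ,
      (fun i => ∑ i' : ι, M' i i' • (Q i').comp (Matrix.vecMulLinear M)) i (Function.update ξ j 0) ≠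
      (fun i => ∑ i' : ι, M' i i' • (Q i').comp (Matrix.vecMulLinear M)) i ξ } with hS
    have hadd := Set.ncard_add_ncard_compl S
    rw [Nat.card_eq_fintype_card, Fintype.card_fin] at hadd
    have hsub : Set.range g ⊆ Sᶜ := by
      rintro _ ⟨a, rfl⟩
      refine (unc_comp Q M hM M' (g a)).2 fun i ξ => ?_
      rw [hMv]; exact h a i ξ
    have h1 := Set.ncard_le_ncard hsub (Set.toFinite _)
    rw [Set.ncard_range_of_injective hg] at h1
    simp at h1
    omega

lemma grad_dot {d : ℕ} (Q : QF d) (ξ w : Fin d → ℝ) :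
    grad Q ξ ⬝ᵥ w = QuadraticMap.polar Q ξ w := by
  conv_rhs => rw [← QuadraticMap.polarBilin_apply_apply, pi_eq_sum_univ' w]
  simp only [map_sum, map_smul, dotProduct, grad, QuadraticMap.polarBilin_apply_apply, smul_eq_mul]
  refine Finset.sum_congr rfl fun i _ => ?_
  rw [mul_comm]

lemma exists_perp {d k m : ℕ} (h : k + m ≤ d) (v : Fin k → Fin d → ℝ) :
    ∃ u : Fin m → Fin d → ℝ, LinearIndependent ℝ u ∧ ∀ i a, u i ⬝ᵥ v a = 0 := by
  let L : (Fin d → ℝ) →ₗ[ℝ] (Fin k → ℝ) := Matrix.mulVecLin (Matrix.of v)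
  have h1 := L.finrank_range_add_finrank_ker
  have h2 := Submodule.finrank_le (LinearMap.range L)
  rw [Module.finrank_fin_fun] at h1 h2
  have h3 : m ≤ Module.finrank ℝ (LinearMap.ker L) := by omega
  let b := Module.finBasis ℝ (LinearMap.ker L)
  refine ⟨fun i => (b (Fin.castLE h3 i) : Fin d → ℝ), ?_, ?_⟩
  · have := b.linearIndependent.comp (Fin.castLE h3) (Fin.castLE_injective h3)
    exact this.map' (LinearMap.ker L).subtype (Submodule.ker_subtype _)
  · intro i a
    have := (b (Fin.castLE h3 i)).2
    rw [LinearMap.mem_ker] at this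
    have := congrFun this a
    rw [dotProduct_comm]
    exact this

lemma prod_zero {V : Type*} [AddCommGroup V] [Module ℝ V] (K : Submodule ℝ V)
    (f g : V →ₗ[ℝ] ℝ) (h : ∀ x ∈ K, f x * g x = 0) :
    (∀ x ∈ K, f x = 0) ∨ (∀ x ∈ K, g x = 0) := by
  by_contra! hc
  obtain ⟨⟨x, hx, hfx⟩, y, hy, hgy⟩ := hc
  have h1 := (mul_eq_zero.1 (h x hx)).resolve_left hfx
  have h2 := (mul_eq_zero.1 (h y hy)).resolve_right hgy
  have := h (x + y) (K.add_mem hx hy)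
  simp [h1, h2, hfx, hgy] at this

lemma prop_of_ker {V : Type*} [AddCommGroup V] [Module ℝ V] (f g : V →ₗ[ℝ] ℝ)
    (hf : f ≠ 0) (h : ∀ x ∈ LinearMap.ker f, g x = 0) : ∃ c : ℝ, g = c • f := by
  obtain ⟨x, hx⟩ := DFunLike.ne_iff.1 hf
  simp only [LinearMap.zero_apply] at hx
  refine ⟨g x / f x, ?_⟩
  ext y
  have := h (y - (f y / f x) • x) (by simp [LinearMap.mem_ker, hx])
  simp only [map_sub, map_smul, smul_eq_mul, sub_eq_zero] at this
  rw [this, LinearMap.smul_apply, smul_eq_mul]; ring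

/-- A `2 × 2` matrix of linear forms with zero determinant has proportional rows or columns. -/
lemma forms {V : Type*} [AddCommGroup V] [Module ℝ V] (a1 a2 b1 b2 : V →ₗ[ℝ] ℝ)
    (h : ∀ x, a1 x * b2 x = a2 x * b1 x) :
    (∃ s t : ℝ, (s ≠ 0 ∨ t ≠ 0) ∧ s • a1 + t • a2 = 0 ∧ s • b1 + t • b2 = 0) ∨
    (∃ s t : ℝ, (s ≠ 0 ∨ t ≠ 0) ∧ s • a1 + t • b1 = 0 ∧ s • a2 + t • b2 = 0) := by
  by_cases ha : a1 = 0
  · subst ha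
    rcases prod_zero ⊤ a2 b1 (fun x _ => by rw [← h x]; simp) with h1 | h1
    · right
      have : a2 = 0 := by ext x; exact h1 x trivial
      exact ⟨1, 0, by simp, by simp, by simp [this]⟩
    · left
      have : b1 = 0 := by ext x; exact h1 x trivial
      exact ⟨1, 0, by simp, by simp, by simp [this]⟩
  · have hz : ∀ g : V →ₗ[ℝ] ℝ, (∀ x, a1 x * g x = 0) → g = 0 := by
      intro g hg
      rcases prod_zero ⊤ a1 g (fun x _ => hg x) with h1 | h1
      · exact absurd (LinearMap.ext fun x => h1 x trivial) ha
      · ext x; exact h1 x trivial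
    rcases prod_zero (LinearMap.ker a1) a2 b1 (fun x hx => by
      rw [← h x, LinearMap.mem_ker.1 hx, zero_mul]) with h1 | h1
    · left
      obtain ⟨c, rfl⟩ := prop_of_ker a1 a2 ha h1
      have := hz (b2 - c • b1) (fun x => by
        have := h x
        simp only [LinearMap.smul_apply, smul_eq_mul, LinearMap.sub_apply] at this ⊢
        linarith)
      exact ⟨-c, 1, by simp, by module, by rw [sub_eq_zero.1 this]; module⟩
    · right
      obtain ⟨c, rfl⟩ := prop_of_ker a1 b1 ha h1
      have := hz (b2 - c • a2) (fun x => by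
        have := h x
        simp only [LinearMap.smul_apply, smul_eq_mul, LinearMap.sub_apply] at this ⊢
        linarith)
      exact ⟨-c, 1, by simp, by module, by rw [sub_eq_zero.1 this]; module⟩

lemma two_det {p q r s : ℝ} (h : p * s = q * r) :
    ∃ x y : ℝ, (x ≠ 0 ∨ y ≠ 0) ∧ x * p + y * q = 0 ∧ x * r + y * s = 0 := by
  by_cases h1 : p = 0 ∧ q = 0
  · by_cases h2 : r = 0 ∧ s = 0
    · exact ⟨1, 0, by simp, by simp [h1], by simp [h2]⟩
    · refine ⟨s, -r, ?_, by simp [h1], by ring⟩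
      by_contra! hc
      exact h2 ⟨by simpa using hc.2, hc.1⟩
  · refine ⟨q, -p, ?_, by ring, by linarith⟩
    by_contra! hc
    exact h1 ⟨by simpa using hc.2, hc.1⟩

/-- The determinant condition, in terms of the orthogonal complement of the `u_i`. -/
lemma det_iff (e : ℕ) (Q₁ Q₂ : QF (e + 2)) :
    (∃ u : Fin e → (Fin (e + 2) → ℝ), LinearIndependent ℝ u ∧ ∀ ξ : Fin (e + 2) → ℝ,
        (Matrix.of (Fin.cons (grad Q₁ ξ) (Fin.cons (grad Q₂ ξ) u))
          : Matrix (Fin (e + 2)) (Fin (e + 2)) ℝ).det = 0) ↔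
    ∃ v : Fin 2 → (Fin (e + 2) → ℝ), LinearIndependent ℝ v ∧ ∀ ξ,
      QuadraticMap.polar Q₁ ξ (v 0) * QuadraticMap.polar Q₂ ξ (v 1) =
      QuadraticMap.polar Q₁ ξ (v 1) * QuadraticMap.polar Q₂ ξ (v 0) := by
  constructor
  · rintro ⟨u, hu, h⟩
    obtain ⟨v, hv, hvu⟩ := exists_perp (m := 2) le_rfl u
    refine ⟨v, hv, fun ξ => ?_⟩
    obtain ⟨c, hc0, hc⟩ := Matrix.exists_vecMul_eq_zero_iff.2 (h ξ)
    have key : c 0 • grad Q₁ ξ + (c 1 • grad Q₂ ξ + ∑ i : Fin e, c i.succ.succ • u i) = 0 := by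
      rw [Matrix.vecMul_eq_sum, Fin.sum_univ_succ, Fin.sum_univ_succ] at hc
      exact hc
    have hd : ∀ a, c 0 * QuadraticMap.polar Q₁ ξ (v a) + c 1 * QuadraticMap.polar Q₂ ξ (v a) = 0 := by
      intro a
      have := congrArg (fun x => x ⬝ᵥ v a) key
      simp only [add_dotProduct, smul_dotProduct, grad_dot, sum_dotProduct, zero_dotProduct,
        smul_eq_mul] at this
      rw [Finset.sum_eq_zero (fun i _ => by rw [dotProduct_comm, hvu]; simp)] at this
      linarith
    have h0 := hd 0
    have h1 := hd 1
    by_cases hc0' : c 0 = 0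
    · by_cases hc1 : c 1 = 0
      · exfalso
        rw [hc0', hc1] at key
        simp only [zero_smul, zero_add] at key
        have := Fintype.linearIndependent_iff.1 hu _ key
        apply hc0
        ext i
        refine Fin.cases hc0' (fun i => Fin.cases hc1 (fun i => this i) i) i
      · apply mul_left_cancel₀ hc1
        linear_combination QuadraticMap.polar Q₁ ξ (v 0) * h1 - QuadraticMap.polar Q₁ ξ (v 1) * h0
    · apply mul_left_cancel₀ hc0'
      linear_combination QuadraticMap.polar Q₂ ξ (v 1) * h0 - QuadraticMap.polar Q₂ ξ (v 0) * h1
  · rintro ⟨v, hv, h⟩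
    obtain ⟨u, hu, huv⟩ := exists_perp (k := 2) (m := e) (by omega) v
    refine ⟨u, hu, fun ξ => ?_⟩
    obtain ⟨x, y, hxy, e1, e2⟩ := two_det (h ξ)
    refine Matrix.exists_mulVec_eq_zero_iff.1 ⟨x • v 0 + y • v 1, ?_, ?_⟩
    · intro h0
      have := LinearIndependent.pair_iff.1 (by
        convert hv using 1; ext i; fin_cases i <;> rfl : LinearIndependent ℝ ![v 0, v 1]) x y h0
      tauto
    · ext i
      refine Fin.cases ?_ (fun i => Fin.cases ?_ (fun i => ?_) i) i
      · show grad Q₁ ξ ⬝ᵥ _ = 0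
        simp only [dotProduct_add, dotProduct_smul, grad_dot, smul_eq_mul]; exact e1
      · show grad Q₂ ξ ⬝ᵥ _ = 0
        simp only [dotProduct_add, dotProduct_smul, grad_dot, smul_eq_mul]; exact e2
      · show u i ⬝ᵥ _ = 0
        simp [huv]

lemma rank_one_ex (s t : ℝ) (h : s ≠ 0 ∨ t ≠ 0) : (!![s, t; 0, 0] : Matrix (Fin 2) (Fin 2) ℝ).rank = 1 := by
  have : (!![s, t; 0, 0] : Matrix (Fin 2) (Fin 2) ℝ) = Matrix.vecMulVec ![1, 0] ![s, t] := by
    ext i j; fin_cases i <;> fin_cases j <;> simp [Matrix.vecMulVec_apply]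
  apply le_antisymm
  · rw [this]; exact Matrix.rank_vecMulVec_le _ _
  · rw [Nat.one_le_iff_ne_zero, Ne]
    intro h0
    rw [Matrix.rank, Submodule.finrank_eq_zero, LinearMap.range_eq_bot] at h0
    have h1 := congrFun (LinearMap.congr_fun h0 ![1, 0]) 0
    have h2 := congrFun (LinearMap.congr_fun h0 ![0, 1]) 0
    simp [Matrix.mulVec, dotProduct, Fin.sum_univ_two] at h1 h2
    tauto

lemma exists_pair {d : ℕ} (w : Fin (d + 2) → ℝ) (hw : w ≠ 0) :
    ∃ w', LinearIndependent ℝ ![w, w'] := by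
  obtain ⟨M, g, hM, -, hg⟩ := extend_rows ![w] (by
    rw [linearIndependent_unique_iff]; simpa using hw)
  have hli := Matrix.linearIndependent_rows_iff_isUnit.2 hM
  obtain ⟨j, hj⟩ := exists_ne (g 0)
  refine ⟨M j, ?_⟩
  have := hli.comp ![g 0, j] (by
    intro a b hab
    fin_cases a <;> fin_cases b <;> simp_all)
  have he : ![w, M j] = M.row ∘ ![g 0, j] := by
    ext a : 1
    fin_cases a
    · exact (hg 0).symm
    · rfl
  rw [he]; exact this

/-- Lemma 3.2: for `d = e + 2 ≥ 3` and linearly independent quadratic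
forms `Q₁, Q₂` on `ℝ^d`, the non-vanishing of all the determinants
`det[∇Q₁(ξ); ∇Q₂(ξ); u₁; …; u_{d-2}]` (as polynomials in `ξ`, for all linearly
independent `u₁, …, u_{d-2}`) is equivalent to `𝔡₂(𝐪) = d` and `𝔡₁(𝐪) ≥ d - 1`. -/
theorem statement_9 (e : ℕ) (he : 1 ≤ e)
    (Q₁ Q₂ : QF (e + 2)) (hli : LinearIndependent ℝ ![Q₁, Q₂]) :
    (∀ u : Fin e → (Fin (e + 2) → ℝ), LinearIndependent ℝ u →
        ∃ ξ : Fin (e + 2) → ℝ,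
          (Matrix.of (Fin.cons (grad Q₁ ξ) (Fin.cons (grad Q₂ ξ) u))).det ≠ 0) ↔
      (numvar ![Q₁, Q₂] (e + 2) 2 = e + 2 ∧ e + 1 ≤ numvar ![Q₁, Q₂] (e + 2) 1) := by
  have hr2 : ∃ M' : Matrix (Fin 2) (Fin 2) ℝ, M'.rank = 2 := ⟨1, by simp⟩
  have hr1 : ∃ M' : Matrix (Fin 2) (Fin 2) ℝ, M'.rank = 1 :=
    ⟨_, rank_one_ex 1 0 (by simp)⟩
  have k2 := numvar_key ![Q₁, Q₂] 2 1 hr2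
  have k1 := numvar_key ![Q₁, Q₂] 1 2 hr1
  have l2 := numvar_le ![Q₁, Q₂] 2 hr2
  have hL : (∀ u : Fin e → (Fin (e + 2) → ℝ), LinearIndependent ℝ u →
        ∃ ξ : Fin (e + 2) → ℝ,
          (Matrix.of (Fin.cons (grad Q₁ ξ) (Fin.cons (grad Q₂ ξ) u))
            : Matrix (Fin (e + 2)) (Fin (e + 2)) ℝ).det ≠ 0) ↔
      ¬ ∃ u : Fin e → (Fin (e + 2) → ℝ), LinearIndependent ℝ u ∧ ∀ ξ : Fin (e + 2) → ℝ,
        (Matrix.of (Fin.cons (grad Q₁ ξ) (Fin.cons (grad Q₂ ξ) u))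
          : Matrix (Fin (e + 2)) (Fin (e + 2)) ℝ).det = 0 := by
    push Not; rfl
  have hR : (numvar ![Q₁, Q₂] (e + 2) 2 = e + 2 ∧ e + 1 ≤ numvar ![Q₁, Q₂] (e + 2) 1) ↔
      ¬ (numvar ![Q₁, Q₂] (e + 2) 2 + 1 ≤ e + 2 ∨ numvar ![Q₁, Q₂] (e + 2) 1 + 2 ≤ e + 2) := by
    omega
  rw [hR]
  refine hL.trans (not_congr ?_)
  rw [det_iff, k1, k2]
  simp only [Fin.sum_univ_two, Matrix.cons_val_zero, Matrix.cons_val_one]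
  constructor
  · rintro ⟨v, hv, h⟩
    have hv' : LinearIndependent ℝ ![v 0, v 1] := by
      convert hv using 1; ext i; fin_cases i <;> rfl
    have hp := LinearIndependent.pair_iff.1 hv'
    rcases forms ((QuadraticMap.polarBilin Q₁).flip (v 0)) ((QuadraticMap.polarBilin Q₁).flip (v 1))
      ((QuadraticMap.polarBilin Q₂).flip (v 0)) ((QuadraticMap.polarBilin Q₂).flip (v 1))
      (fun x => h x) with ⟨s, t, hst, h1, h2⟩ | ⟨s, t, hst, h1, h2⟩
    · left
      refine ⟨1, by simp, ![s • v 0 + t • v 1], ?_, ?_⟩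
      · rw [linearIndependent_unique_iff]
        intro h0
        have := hp s t (by simpa using h0)
        tauto
      · intro a i ξ
        have e1 := LinearMap.congr_fun h1 ξ
        have e2 := LinearMap.congr_fun h2 ξ
        simp at e1 e2
        fin_cases a
        fin_cases i
        · simpa [Matrix.one_apply, QuadraticMap.polar_add_right, QuadraticMap.polar_smul_right] using e1
        · simpa [Matrix.one_apply, QuadraticMap.polar_add_right, QuadraticMap.polar_smul_right] using e2
    · right
      refine ⟨_, rank_one_ex s t hst, v, hv, ?_⟩
      intro a i ξ
      have e1 := LinearMap.congr_fun h1 ξ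
      have e2 := LinearMap.congr_fun h2 ξ
      simp at e1 e2
      fin_cases i
      · fin_cases a
        · simpa using e1
        · simpa using e2
      · simp
  · rintro (⟨M', hM', v, hv, h⟩ | ⟨M', hM', v, hv, h⟩)
    · have hu := isUnit_of_rank M' (by simpa using hM')
      have hw : v 0 ≠ 0 := hv.ne_zero 0
      obtain ⟨w', hw'⟩ := exists_pair (v 0) hw
      refine ⟨_, hw', fun ξ => ?_⟩
      have hz : ![QuadraticMap.polar Q₁ ξ (v 0), QuadraticMap.polar Q₂ ξ (v 0)] = 0 := by
        apply Matrix.mulVec_injective_of_isUnit hu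
        rw [Matrix.mulVec_zero]
        ext i
        simpa [Matrix.mulVec, dotProduct, Fin.sum_univ_two] using h 0 i ξ
      have z1 := congrFun hz 0
      have z2 := congrFun hz 1
      simp at z1 z2
      simp [z1, z2]
    · refine ⟨v, hv, fun ξ => ?_⟩
      have hne : M' ≠ 0 := by
        rintro rfl
        simp at hM'
      obtain ⟨i, j, hij⟩ : ∃ i j, M' i j ≠ 0 := by
        by_contra! hc
        exact hne (Matrix.ext hc)
      have h0 := h 0 i ξ
      have h1 := h 1 i ξ
      fin_cases j
      · apply mul_left_cancel₀ hij
        simp only [Fin.zero_eta]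
        linear_combination QuadraticMap.polar Q₂ ξ (v 1) * h0 - QuadraticMap.polar Q₂ ξ (v 0) * h1
      · apply mul_left_cancel₀ hij
        simp only [Fin.mk_one]
        linear_combination QuadraticMap.polar Q₁ ξ (v 0) * h1 - QuadraticMap.polar Q₁ ξ (v 1) * h0

end GOZZK
end
end

section
/- Let d ≥ 1, let 0 ≤ b ≤ d, and let 𝐪_b be the tuple of quadratic forms in d variables consisting of all monomials ξ_{j_1}ξ_{j_2} with 1 ≤ j_1 < j_2 ≤ d together with the squares ξ_j² for d − b + 1 ≤ j ≤ d (so the tuple has n = d(d−1)/2 + b components; this is the quadratic part of the ACK system with exponents k_1 ≤ … ≤ k_d where exactly the last b exponents equal 2). Then 𝐪_b is non-degenerate if and only if b = 0 or b ≥ d/2. -/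
open MeasureTheory
open scoped ENNReal

noncomputable section

namespace GOZZK

/-- The quadratic form `ξ ↦ ξ_i ξ_j` in `d` variables. -/
def mono {d : ℕ} (i j : Fin d) : QF d :=
  LinearMap.BilinMap.toQuadraticMap
    (LinearMap.mk₂ ℝ (fun ξ η : Fin d → ℝ => ξ i * η j)
      (fun x y z => by simp [add_mul])
      (fun c x y => by simp [mul_assoc])
      (fun x y z => by simp [mul_add])
      (fun c x y => by simp [smul_eq_mul]; ring))

/-- `𝐪` is non-degenerate: `𝔡_{d-m,n'}(𝐪) ≥ n'd/n - 2m` for every `0 ≤ n' ≤ n` and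
every `0 ≤ m ≤ d/2`. -/
def NonDeg {d : ℕ} {ι : Type*} [Fintype ι] [DecidableEq ι] (Q : ι → QF d) : Prop :=
  ∀ n' m : ℕ, n' ≤ Fintype.card ι → 2 * m ≤ d →
    (n' : ℝ) * d / (Fintype.card ι : ℝ) - 2 * m ≤ (numvar Q (d - m) n' : ℝ)

/-- The standard basis vector. -/
abbrev ee {d : ℕ} (j : Fin d) : Fin d → ℝ := Pi.single j 1

lemma extend_basis {d : ℕ} (W : Submodule ℝ (Fin d → ℝ)) (Z : Finset (Fin d))
    (hZ : LinearIndepOn ℝ (fun j => W.mkQ (ee j)) (Z : Set (Fin d))) :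
    ∃ Y : Finset (Fin d), Z ⊆ Y ∧ LinearIndepOn ℝ (fun j => W.mkQ (ee j)) (Y : Set (Fin d)) ∧
      W ⊔ Submodule.span ℝ (ee '' (Y : Set (Fin d))) = ⊤ ∧
      Y.card + Module.finrank ℝ W = d := by
  classical
  obtain ⟨b, -, hZb, hspan, hli⟩ := exists_linearIndepOn_extension hZ (Set.subset_univ _)
  have hY : ((Set.toFinite b).toFinset : Set (Fin d)) = b := by simp
  have htop : Submodule.span ℝ ((fun j => W.mkQ (ee j)) '' b) = ⊤ := by
    rw [eq_top_iff]
    have h1 : Submodule.span ℝ (Set.range (fun j : Fin d => (ee j : Fin d → ℝ))) = ⊤ := by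
      have := (Pi.basisFun ℝ (Fin d)).span_eq
      convert this using 3
      ext j; simp
    have h2 : (⊤ : Submodule ℝ ((Fin d → ℝ) ⧸ W)) = Submodule.map W.mkQ ⊤ := by
      rw [Submodule.map_top, Submodule.range_mkQ]
    rw [h2, ← h1, Submodule.map_span, Submodule.span_le]
    rintro _ ⟨_, ⟨j, rfl⟩, rfl⟩
    exact hspan ⟨j, trivial, rfl⟩
  refine ⟨(Set.toFinite b).toFinset, ?_, ?_, ?_, ?_⟩
  · intro z hz; simpa using hZb hz
  · rw [hY]; exact hli
  · rw [hY, eq_top_iff]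
    have h3 : Submodule.map W.mkQ (Submodule.span ℝ (ee '' b)) = ⊤ := by
      rw [Submodule.map_span, ← htop, Set.image_image]
    have := Submodule.comap_map_mkQ W (Submodule.span ℝ (ee '' b))
    rw [h3, Submodule.comap_top] at this
    exact this.le
  · have h4 := W.finrank_quotient_add_finrank
    have h5 : Module.finrank ℝ ((Fin d → ℝ) ⧸ W) = (Set.toFinite b).toFinset.card := by
      have : LinearIndependent ℝ (fun j : b => W.mkQ (ee j.1)) := hli
      have h6 := finrank_span_eq_card this
      rw [← finrank_top, ← htop, Set.image_eq_range]
      rw [h6]; rw [Set.Finite.card_toFinset]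
    rw [← h5, h4]; simp

lemma finrank_le_card {ι : Type*} [Fintype ι] [DecidableEq ι] (S : Submodule ℝ (ι → ℝ)) (I : Finset ι)
    (h : ∀ c ∈ S, (∀ i ∈ I, c i = 0) → c = 0) : Module.finrank ℝ S ≤ I.card := by
  let f : S →ₗ[ℝ] (I → ℝ) := (LinearMap.funLeft ℝ ℝ (fun i : I => i.1)) ∘ₗ S.subtype
  have hf : Function.Injective f := by
    rw [← LinearMap.ker_eq_bot, LinearMap.ker_eq_bot']
    rintro ⟨c, hc⟩ h0
    have := h c hc (fun i hi => by
      have := congrFun h0 ⟨i, hi⟩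
      simpa [f, LinearMap.funLeft] using this)
    simpa using this
  have := LinearMap.finrank_le_finrank_of_injective hf
  simpa using this

/-- Bilinear form attached to a coefficient vector. -/
def BF {d : ℕ} {ι : Type*} [Fintype ι] (Q : ι → QF d) (c : ι → ℝ) :
    LinearMap.BilinForm ℝ (Fin d → ℝ) :=
  Fintype.linearCombination ℝ (fun i => (Q i).polarBilin) c

lemma BF_apply {d : ℕ} {ι : Type*} [Fintype ι] (Q : ι → QF d) (c : ι → ℝ) (x y : Fin d → ℝ) :
    BF Q c x y = ∑ i, c i * QuadraticMap.polar (Q i) x y := by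
  simp [BF, Fintype.linearCombination_apply, LinearMap.sum_apply]

lemma polar_zero_of {d : ℕ} (P : QF d) (j : Fin d)
    (h : ∀ ξ, P (Function.update ξ j 0) = P ξ) (ξ : Fin d → ℝ) :
    QuadraticMap.polar P ξ (ee j) = 0 := by
  have h1 : P (ξ + ee j) = P ξ := by
    rw [← h (ξ + ee j), ← h ξ]
    congr 1
    ext k
    by_cases hk : k = j
    · subst hk; simp
    · simp [hk]
  have h2 : P (ee j) = 0 := by
    rw [← h (ee j)]
    have : Function.update (ee j : Fin d → ℝ) j 0 = 0 := by
      ext k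
      by_cases hk : k = j
      · subst hk; simp
      · simp [hk]
    rw [this]; simp
  simp [QuadraticMap.polar, h1, h2]

/-- The key linear algebra reduction. -/
lemma exists_data {d : ℕ} {ι : Type*} [Fintype ι] [DecidableEq ι] (Q : ι → QF d)
    (M : Matrix (Fin d) (Fin d) ℝ) (M' : Matrix ι ι ℝ) (m : ℕ) (hm : m ≤ d)
    (hM : M.rank = d - m) :
    ∃ (Z Y : Finset (Fin d)) (S : Submodule ℝ (ι → ℝ)),
      Z ⊆ Y ∧ Z.card = m ∧
      Y.card ≤ NV (fun i => ∑ i' : ι, M' i i' • (Q i').comp (Matrix.vecMulLinear M)) + m ∧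
      Module.finrank ℝ S = M'.rank ∧
      ∀ c ∈ S, (∀ i ∈ Y, ∀ j ∈ Y, BF Q c (ee i) (ee j) = 0) →
        (∀ i ∉ Y, ∀ j ∈ Z, BF Q c (ee i) (ee j) = 0) → BF Q c = 0 := by
  classical
  set P : ι → QF d := fun i => ∑ i' : ι, M' i i' • (Q i').comp (Matrix.vecMulLinear M) with hP
  set T : Set (Fin d) := { j : Fin d | ∃ i, ∃ ξ : Fin d → ℝ, P i (Function.update ξ j 0) ≠ P i ξ }
    with hT
  have hNV : NV P = T.ncard := rfl
  rw [hNV]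
  set f : (Fin d → ℝ) →ₗ[ℝ] (Fin d → ℝ) := Matrix.vecMulLinear M with hf
  set V : Submodule ℝ (Fin d → ℝ) := LinearMap.range f with hV
  set U : Submodule ℝ (Fin d → ℝ) := Submodule.span ℝ (ee '' Tᶜ) with hU
  set R : Submodule ℝ (Fin d → ℝ) := U.map f with hR
  have hVr : Module.finrank ℝ V = d - m := by
    rw [← hM, Matrix.rank_eq_finrank_span_row, hV, hf]
    rw [range_vecMulLinear]
  have hRV : R ≤ V := LinearMap.map_le_range
  have hVRT : Module.finrank ℝ V ≤ Module.finrank ℝ R + T.ncard := by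
    set E : Submodule ℝ (Fin d → ℝ) := Submodule.span ℝ ((fun j => f (ee j)) '' T)
    have hE : Module.finrank ℝ E ≤ T.ncard := by
      have h1 : Module.finrank ℝ E ≤ ((fun j => f (ee j)) '' T).toFinset.card :=
        finrank_span_le_card _
      refine h1.trans ?_
      rw [← Set.ncard_eq_toFinset_card']
      exact Set.ncard_image_le (Set.toFinite _)
    have hle : V ≤ R ⊔ E := by
      rintro _ ⟨x, rfl⟩
      have hx : x = ∑ j, x j • ee j := by
        ext k; simp [Finset.sum_apply, Pi.single_apply]
      rw [hx, map_sum]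
      refine Submodule.sum_mem _ (fun j _ => ?_)
      rw [map_smul]
      refine Submodule.smul_mem _ _ ?_
      by_cases hj : j ∈ T
      · exact Submodule.mem_sup_right (Submodule.subset_span ⟨j, hj, rfl⟩)
      · exact Submodule.mem_sup_left ⟨_, Submodule.subset_span ⟨j, hj, rfl⟩, rfl⟩
    have := Submodule.finrank_mono hle
    have := Submodule.finrank_add_le_finrank_add_finrank R E
    omega
  obtain ⟨Z, -, hZli, hZtop, hZc⟩ := extend_basis V ∅ (by simp)
  have hZli' : LinearIndepOn ℝ (fun j => R.mkQ (ee j)) (Z : Set (Fin d)) := by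
    have := hZli
    have h2 : (fun j : Fin d => V.mkQ (ee j)) =
        (Submodule.factor hRV) ∘ (fun j => R.mkQ (ee j)) := by
      ext j; simp
    rw [h2] at this
    exact LinearIndependent.of_comp (Submodule.factor hRV) this
  obtain ⟨Y, hZY, -, hYtop, hYc⟩ := extend_basis R Z hZli'
  refine ⟨Z, Y, Submodule.span ℝ (Set.range M'.row), hZY, by omega, by omega,
    M'.rank_eq_finrank_span_row.symm, ?_⟩
  intro c hc
  have hVR : ∀ v ∈ V, ∀ u ∈ R, BF Q c v u = 0 := by
    rintro _ ⟨x, rfl⟩ _ ⟨w, hw, rfl⟩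
    induction hc using Submodule.span_induction with
    | mem c hc =>
      obtain ⟨i, rfl⟩ := hc
      have key : ∀ a b, BF Q (M'.row i) (f a) (f b) = QuadraticMap.polar (P i) a b := by
        intro a b
        rw [BF_apply]
        simp [hP, QuadraticMap.polar, mul_sub, Finset.sum_sub_distrib,
          Matrix.row, hf]
      rw [key]
      refine Submodule.span_induction (p := fun w _ => QuadraticMap.polar (P i) x w = 0)
        ?_ ?_ ?_ ?_ hw
      · rintro _ ⟨j, hj, rfl⟩
        apply polar_zero_of
        intro ξ
        by_contra hne
        exact hj ⟨i, ξ, hne⟩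
      · simp
      · intro a b _ _ ha hb; simp [ha, hb]
      · intro t a _ ha; simp [ha]
    | zero => simp [BF_apply]
    | add a b _ _ ha hb =>
      have : BF Q (a + b) = BF Q a + BF Q b := by simp [BF]
      rw [this, LinearMap.add_apply, LinearMap.add_apply, ha, hb, add_zero]
    | smul t a _ ha =>
      have : BF Q (t • a) = t • BF Q a := by simp [BF]
      rw [this, LinearMap.smul_apply, LinearMap.smul_apply, ha, smul_zero]
  intro hYY hYZ
  have hsymm : ∀ x y, BF Q c x y = BF Q c y x := by
    intro x y
    simp only [BF_apply]
    exact Finset.sum_congr rfl (fun i _ => by rw [QuadraticMap.polar_comm])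
  have hZ : ∀ x, ∀ z ∈ Submodule.span ℝ (ee '' (Z : Set (Fin d))), BF Q c x z = 0 := by
    intro x z hz
    have hle : Submodule.span ℝ (ee '' (Z : Set (Fin d))) ≤ LinearMap.ker (BF Q c x) := by
      rw [Submodule.span_le]
      rintro _ ⟨j, hj, rfl⟩
      rw [SetLike.mem_coe, LinearMap.mem_ker]
      have hx : x = ∑ k, x k • ee k := by
        ext k; simp [Finset.sum_apply, Pi.single_apply]
      rw [hx, map_sum, LinearMap.sum_apply]
      refine Finset.sum_eq_zero (fun k _ => ?_)
      rw [map_smul, LinearMap.smul_apply]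
      by_cases hk : k ∈ Y
      · rw [hYY k hk j (hZY hj), smul_zero]
      · rw [hYZ k hk j hj, smul_zero]
    exact hle hz
  have hRall : ∀ u ∈ R, ∀ x, BF Q c u x = 0 := by
    intro u hu x
    have hx : x ∈ V ⊔ Submodule.span ℝ (ee '' (Z : Set (Fin d))) := by rw [hZtop]; trivial
    obtain ⟨v, hv, z, hz, rfl⟩ := Submodule.mem_sup.1 hx
    rw [map_add, hZ u z hz, hsymm, hVR v hv u hu, add_zero]
  have hYall : ∀ x ∈ Submodule.span ℝ (ee '' (Y : Set (Fin d))),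
      ∀ y ∈ Submodule.span ℝ (ee '' (Y : Set (Fin d))), BF Q c x y = 0 := by
    intro x hx y hy
    induction hx using Submodule.span_induction with
    | mem x hx =>
      obtain ⟨i, hi, rfl⟩ := hx
      induction hy using Submodule.span_induction with
      | mem y hy =>
        obtain ⟨j, hj, rfl⟩ := hy
        exact hYY i hi j hj
      | zero => simp
      | add a b _ _ ha hb => rw [map_add, ha, hb, add_zero]
      | smul t a _ ha => rw [map_smul, ha, smul_zero]
    | zero => simp
    | add a b _ _ ha hb => rw [map_add, LinearMap.add_apply, ha, hb, add_zero]
    | smul t a _ ha => rw [map_smul, LinearMap.smul_apply, ha, smul_zero]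
  refine LinearMap.ext fun x => LinearMap.ext fun y => ?_
  have hx : x ∈ R ⊔ Submodule.span ℝ (ee '' (Y : Set (Fin d))) := by rw [hYtop]; trivial
  have hy : y ∈ R ⊔ Submodule.span ℝ (ee '' (Y : Set (Fin d))) := by rw [hYtop]; trivial
  obtain ⟨u, hu, a, ha, rfl⟩ := Submodule.mem_sup.1 hx
  obtain ⟨w, hw, b, hb, rfl⟩ := Submodule.mem_sup.1 hy
  have e1 := hRall u hu (w + b)
  have e2 := hRall w hw a
  have e3 := hYall a ha b hb
  have e4 : BF Q c (u + a) (w + b) = BF Q c u (w + b) + (BF Q c a w + BF Q c a b) := by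
    rw [← map_add (BF Q c a), map_add (BF Q c), LinearMap.add_apply]
  rw [e4, e1, hsymm a w, e2, e3]
  simp

/-- The tuple of the statement. -/
abbrev qq (d b : ℕ) :=
  Sum.elim
    (fun jj : {jj : Fin d × Fin d // jj.1 < jj.2} => (mono jj.1.1 jj.1.2 : QF d))
    (fun j : {j : Fin d // d - b ≤ (j : ℕ)} => mono j.1 j.1)

lemma polar_mono {d : ℕ} (i j : Fin d) (x y : Fin d → ℝ) :
    QuadraticMap.polar (mono i j) x y = x i * y j + y i * x j := by
  simp [QuadraticMap.polar, mono]
  ring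

lemma card_lt_filter {d : ℕ} (A : Finset (Fin d × Fin d)) (hA : ∀ p ∈ A, p.swap ∈ A) :
    2 * (Finset.univ.filter
      (fun jj : {jj : Fin d × Fin d // jj.1 < jj.2} => jj.1 ∈ A)).card =
      (A.filter (fun p => p.1 ≠ p.2)).card := by
  classical
  have h1 : (Finset.univ.filter
      (fun jj : {jj : Fin d × Fin d // jj.1 < jj.2} => jj.1 ∈ A)).card
      = (A.filter (fun p => p.1 < p.2)).card := by
    refine Finset.card_bij (fun jj _ => jj.1) ?_ ?_ ?_
    · intro a ha; simp at ha ⊢; exact ⟨ha, a.2⟩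
    · intro a _ b _ h; exact Subtype.ext h
    · intro p hp
      rw [Finset.mem_filter] at hp
      exact ⟨⟨p, hp.2⟩, by simpa using hp.1, rfl⟩
  have h2 : (A.filter (fun p => p.1 < p.2)).card = (A.filter (fun p => p.2 < p.1)).card := by
    refine Finset.card_bij (fun p _ => p.swap) ?_ ?_ ?_
    · intro a ha
      rw [Finset.mem_filter] at ha ⊢; exact ⟨hA _ ha.1, ha.2⟩
    · intro a _ b _ h; exact Prod.swap_injective h
    · intro p hp
      rw [Finset.mem_filter] at hp
      exact ⟨p.swap, by rw [Finset.mem_filter]; exact ⟨hA _ hp.1, hp.2⟩, by simp⟩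
  have h3 : A.filter (fun p => p.1 ≠ p.2) =
      A.filter (fun p => p.1 < p.2) ∪ A.filter (fun p => p.2 < p.1) := by
    ext p; simp only [Finset.mem_filter, Finset.mem_union, ne_iff_lt_or_gt]; tauto
  rw [h3, Finset.card_union_of_disjoint, h1, ← h2, two_mul]
  rw [Finset.disjoint_left]
  intro p hp hp'
  rw [Finset.mem_filter] at hp hp'
  exact absurd hp.2 (not_lt.2 hp'.2.le)

lemma card_squares (d b : ℕ) (hb : b ≤ d) :
    Fintype.card {j : Fin d // d - b ≤ (j : ℕ)} = b := by
  let e : {j : Fin d // d - b ≤ (j : ℕ)} ≃ Fin b :=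
    { toFun := fun j => ⟨j.1.1 - (d - b), by have := j.1.2; have := j.2; omega⟩
      invFun := fun k => ⟨⟨k.1 + (d - b), by have := k.2; omega⟩, by simp⟩
      left_inv := by
        rintro ⟨⟨j, hj⟩, h⟩
        simp only at h
        simp only [Subtype.mk.injEq, Fin.mk.injEq]
        omega
      right_inv := by
        rintro ⟨k, hk⟩
        simp }
  rw [Fintype.card_congr e]
  simp

lemma card_index (d b : ℕ) (hb : b ≤ d) :
    2 * Fintype.card ({jj : Fin d × Fin d // jj.1 < jj.2} ⊕ {j : Fin d // d - b ≤ (j : ℕ)}) + d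
      = d * d + 2 * b := by
  have h1 := card_lt_filter (d := d) Finset.univ (by simp)
  have h2 : ((Finset.univ : Finset (Fin d × Fin d)).filter (fun p => p.1 ≠ p.2)).card
      = d * d - d := by
    have : (Finset.univ : Finset (Fin d × Fin d)).filter (fun p => p.1 ≠ p.2)
        = (Finset.univ : Finset (Fin d)).offDiag := by
      ext p; simp [Finset.mem_offDiag]
    rw [this, Finset.offDiag_card]; simp
  have h3 : Fintype.card {j : Fin d // d - b ≤ (j : ℕ)} = b := by
    exact card_squares d b hb
  rw [Fintype.card_sum, h3]
  have h4 : Fintype.card {jj : Fin d × Fin d // jj.1 < jj.2} = (Finset.univ.filter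
      (fun jj : {jj : Fin d × Fin d // jj.1 < jj.2} => jj.1 ∈ (Finset.univ : Finset (Fin d × Fin d)))).card := by
    simp
  rw [h4]
  have : d ≤ d * d := Nat.le_mul_self d
  omega

lemma BF_zero {d b : ℕ} (c) (h : BF (qq d b) c = 0) : c = 0 := by
  classical
  ext i
  rcases i with ⟨⟨p, q⟩, hpq⟩ | ⟨j, hj⟩
  · have h1 : BF (qq d b) c (ee p) (ee q) = 0 := by rw [h]; rfl
    rw [BF_apply, Fintype.sum_sum_type] at h1
    simp only [Sum.elim_inl, Sum.elim_inr, polar_mono] at h1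
    rw [Finset.sum_eq_single ⟨(p, q), hpq⟩, Finset.sum_eq_zero] at h1
    · have : p ≠ q := ne_of_lt hpq
      simpa [this, this.symm] using h1
    · rintro ⟨j, hj⟩ -
      have : p ≠ q := ne_of_lt hpq
      by_cases h2 : j = p
      · subst h2; simp [this]
      · simp [h2]
    · rintro ⟨⟨p', q'⟩, hpq'⟩ - hne
      simp only [Pi.single_apply]
      simp only at hpq hpq'
      have h2 : ¬ (p' = p ∧ q' = q) := by
        rintro ⟨rfl, rfl⟩; exact hne rfl
      have h3 : ¬ (p' = q ∧ q' = p) := by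
        rintro ⟨rfl, rfl⟩; exact absurd hpq (not_lt.2 hpq'.le)
      split_ifs <;> simp_all
    · intro h; simp at h
  · have h1 : BF (qq d b) c (ee j) (ee j) = 0 := by rw [h]; rfl
    rw [BF_apply, Fintype.sum_sum_type] at h1
    simp only [Sum.elim_inl, Sum.elim_inr, polar_mono] at h1
    rw [Finset.sum_eq_zero, Finset.sum_eq_single ⟨j, hj⟩] at h1
    · simpa using h1
    · rintro ⟨j', hj'⟩ - hne
      have : j' ≠ j := fun h => hne (Subtype.ext h)
      simp [this]
    · intro h; simp at h
    · rintro ⟨⟨p', q'⟩, hpq'⟩ -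
      simp only at hpq'
      have h2 : ¬ (p' = j ∧ q' = j) := by
        rintro ⟨rfl, rfl⟩; exact lt_irrefl _ hpq'
      simp only [Pi.single_apply]
      split_ifs <;> simp_all

set_option maxHeartbeats 2000000 in
lemma count_bound {d b : ℕ} (Z Y : Finset (Fin d)) (hZY : Z ⊆ Y)
    (S : Submodule ℝ (({jj : Fin d × Fin d // jj.1 < jj.2} ⊕ {j : Fin d // d - b ≤ (j : ℕ)}) → ℝ))
    (hS : ∀ c ∈ S, (∀ i ∈ Y, ∀ j ∈ Y, BF (qq d b) c (ee i) (ee j) = 0) →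
        (∀ i ∉ Y, ∀ j ∈ Z, BF (qq d b) c (ee i) (ee j) = 0) → BF (qq d b) c = 0) (y : ℕ) (hy : Y.card = y) (hb : b ≤ d) :
    2 * Module.finrank ℝ S + y ≤ y * y + 2 * ((d - y) * Z.card) + 2 * min y b := by
  classical
  set A : Finset (Fin d × Fin d) := Finset.univ.filter (fun p =>
    (p.1 ∈ Y ∧ p.2 ∈ Y) ∨ (p.1 ∉ Y ∧ p.2 ∈ Z) ∨ (p.1 ∈ Z ∧ p.2 ∉ Y)) with hA
  set I1 := Finset.univ.filter
      (fun jj : {jj : Fin d × Fin d // jj.1 < jj.2} => jj.1 ∈ A) with hI1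
  set I2 := Finset.univ.filter
      (fun j : {j : Fin d // d - b ≤ (j : ℕ)} => j.1 ∈ Y) with hI2
  have h1 : Module.finrank ℝ S ≤ (I1.disjSum I2).card := by
    apply finrank_le_card
    intro c hc h0
    have hc1 : ∀ jj ∈ I1, c (Sum.inl jj) = 0 := fun jj hjj => h0 _ (by simpa using hjj)
    have hc2 : ∀ jj ∈ I2, c (Sum.inr jj) = 0 := fun jj hjj => h0 _ (by simpa using hjj)
    have aux : ∀ i j, (i, j) ∈ A → (j, i) ∈ A → (i = j → i ∈ Y) → BF (qq d b) c (ee i) (ee j) = 0 := by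
      intro i j hij hji hY
      rw [BF_apply, Fintype.sum_sum_type]
      simp only [Sum.elim_inl, Sum.elim_inr, polar_mono]
      rw [Finset.sum_eq_zero, Finset.sum_eq_zero, add_zero]
      · rintro ⟨k, hk⟩ -
        by_cases hkY : k ∈ Y
        · rw [hc2 ⟨k, hk⟩ (by simpa [hI2] using hkY), zero_mul]
        · have : ¬ (k = i ∧ k = j) := by
            rintro ⟨rfl, rfl⟩; exact hkY (hY rfl)
          simp only [Pi.single_apply]
          split_ifs <;> simp_all
      · rintro ⟨⟨p, q⟩, hpq⟩ -
        by_cases hA' : (p, q) ∈ A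
        · rw [hc1 ⟨(p, q), hpq⟩ (by simpa only [hI1, Finset.mem_filter_univ] using hA'), zero_mul]
        · have h2 : ¬ (p = i ∧ q = j) := by
            rintro ⟨rfl, rfl⟩; exact hA' hij
          have h3 : ¬ (p = j ∧ q = i) := by
            rintro ⟨rfl, rfl⟩; exact hA' hji
          clear hA' hij hji hc1 hc2 h0
          simp only [Pi.single_apply]
          split_ifs <;> simp_all
    apply BF_zero
    apply hS c hc
    · intro i hi j hj
      exact aux i j (by simp [hA, hi, hj]) (by simp [hA, hi, hj]) (fun _ => hi)
    · intro i hi j hj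
      exact aux i j (by simp [hA, hi, hj]) (by simp [hA, hi, hj]) (fun h => h ▸ hZY hj)
  rw [Finset.card_disjSum] at h1
  have h2 : 2 * I1.card = (A.filter (fun p => p.1 ≠ p.2)).card := by
   convert card_lt_filter A (by
    intro p hp
    simp only [hA, Finset.mem_filter_univ, Prod.fst_swap, Prod.snd_swap] at hp ⊢
    tauto)
  have h3 : (A.filter (fun p => p.1 ≠ p.2)).card ≤ (y * y - y) + 2 * ((d - y) * Z.card) := by
    have hsub : A.filter (fun p => p.1 ≠ p.2) ⊆ Y.offDiag ∪ (Yᶜ ×ˢ Z ∪ Z ×ˢ Yᶜ) := by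
      intro p hp
      simp only [hA, Finset.mem_filter, Finset.mem_univ, true_and] at hp
      simp only [Finset.mem_union, Finset.mem_offDiag, Finset.mem_product, Finset.mem_compl]
      tauto
    refine (Finset.card_le_card hsub).trans ((Finset.card_union_le _ _).trans ?_)
    have := Finset.card_union_le (Yᶜ ×ˢ Z) (Z ×ˢ Yᶜ)
    rw [Finset.card_product, Finset.card_product, Finset.card_compl, Fintype.card_fin, hy,
      mul_comm Z.card] at this
    rw [Finset.offDiag_card, hy]
    omega
  have h4 : I2.card ≤ y := by
    rw [← hy]
    exact Finset.card_le_card_of_injOn (fun j => j.1) (fun j hj => by simpa [hI2] using hj)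
      (fun a _ b _ h => Subtype.ext h)
  have h5 : I2.card ≤ b := by
    calc I2.card ≤ _ := Finset.card_le_univ _
      _ = b := card_squares d b hb
  have : y ≤ y * y := Nat.le_mul_self y
  have : I2.card ≤ min y b := le_min h4 h5
  omega

lemma exists_rank {κ : Type*} [Fintype κ] [DecidableEq κ] (r : ℕ) (hr : r ≤ Fintype.card κ) :
    ∃ M : Matrix κ κ ℝ, M.rank = r := by
  classical
  obtain ⟨s, -, hs⟩ := Finset.exists_subset_card_eq (s := (Finset.univ : Finset κ)) (by simpa using hr)
  refine ⟨Matrix.diagonal (fun i => if i ∈ s then 1 else 0), ?_⟩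
  rw [Matrix.rank_diagonal, Fintype.card_subtype, ← hs]
  congr 1
  ext i; simp

lemma arith {d b n n' y m k : ℕ} (hn : 2 * n + d = d * d + 2 * b) (hn' : n' ≤ n)
    (h : 2 * n' + y ≤ y * y + 2 * ((d - y) * m) + 2 * min y b) (hmy : m ≤ y) (hyd : y ≤ d)
    (hyk : y ≤ k + m) (hb : b = 0 ∨ d ≤ 2 * b) : n' * d ≤ n * (k + 2 * m) := by
  have goal1 : n' * d ≤ n * (y + m) := by
    by_cases hdy : d ≤ y + m
    · exact Nat.mul_le_mul hn' hdy
    · push Not at hdy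
      obtain ⟨s, rfl⟩ := Nat.exists_eq_add_of_le hmy
      obtain ⟨e, rfl⟩ := Nat.exists_eq_add_of_lt hdy
      have e1 : m + s + m + e + 1 - (m + s) = m + e + 1 := by omega
      rw [e1] at h
      have hm0 : (0 : ℤ) ≤ m * ((m : ℤ) - 1) := by
        rcases Nat.eq_zero_or_pos m with rfl | hm
        · simp
        · have : (1 : ℤ) ≤ m := by exact_mod_cast hm
          exact mul_nonneg (by positivity) (by linarith)
      have hd0 : (0 : ℤ) ≤ (m + s + m + e + 1 : ℤ) := by positivity
      rcases hb with rfl | hb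
      · simp only [Nat.min_zero] at h
        zify at h hn ⊢
        have f0 : (0 : ℤ) ≤ s * (m + e + 1) + (m * ((m : ℤ) - 1) + m * s) := by positivity
        have g1 := mul_nonneg hd0 f0
        have g2 := mul_le_mul_of_nonneg_right h hd0
        have g3 := congrArg (fun t : ℤ => t * (m + s + m)) hn
        nlinarith
      · have h' := h.trans (Nat.add_le_add_left (Nat.mul_le_mul_left 2 (min_le_left _ _)) _)
        zify at h' hn hb ⊢
        have f0 : (0 : ℤ) ≤ 2 * s * m + s * e + m * ((m : ℤ) - 1) := by positivity
        have g1 := mul_nonneg hd0 f0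
        have g2 := mul_le_mul_of_nonneg_right h' hd0
        have g3 := congrArg (fun t : ℤ => t * (m + s + m)) hn
        have g4 := mul_le_mul_of_nonneg_right hb (by positivity : (0 : ℤ) ≤ m + s + m)
        nlinarith
  refine goal1.trans (Nat.mul_le_mul_left _ (by omega))

lemma nondeg_of {d b : ℕ} (hb : b ≤ d) (h : b = 0 ∨ d ≤ 2 * b) : NonDeg (qq d b) := by
  intro n' m hn' hm
  have hmd : m ≤ d := by omega
  have hne : { k | ∃ (M : Matrix (Fin d) (Fin d) ℝ) (M' : Matrix ({jj : Fin d × Fin d // jj.1 < jj.2} ⊕ {j : Fin d // d - b ≤ (j : ℕ)})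
      ({jj : Fin d × Fin d // jj.1 < jj.2} ⊕ {j : Fin d // d - b ≤ (j : ℕ)}) ℝ),
    M.rank = d - m ∧ M'.rank = n' ∧
    NV (fun i => ∑ i', M' i i' • ((qq d b) i').comp (Matrix.vecMulLinear M)) = k }.Nonempty := by
    obtain ⟨M, hM⟩ := exists_rank (κ := Fin d) (d - m) (by simp)
    obtain ⟨M', hM'⟩ := exists_rank n' hn'
    exact ⟨_, M, M', hM, hM', rfl⟩
  obtain ⟨M, M', hM, hM', hk⟩ := Nat.sInf_mem hne
  change _ = numvar (qq d b) (d - m) n' at hk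
  obtain ⟨Z, Y, S, hZY, hZ, hY, hS, hK⟩ := exists_data (qq d b) M M' m hmd hM
  rw [hk] at hY
  have hc := count_bound Z Y hZY S hK _ rfl hb
  rw [hS, hM', hZ] at hc
  have hYd : Y.card ≤ d := by simpa using Finset.card_le_univ Y
  have hmY : m ≤ Y.card := hZ ▸ Finset.card_le_card hZY
  have hA := arith (card_index d b hb) hn' hc hmY hYd hY h
  set n := Fintype.card ({jj : Fin d × Fin d // jj.1 < jj.2} ⊕ {j : Fin d // d - b ≤ (j : ℕ)})
  rcases Nat.eq_zero_or_pos n with h0 | hpos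
  · rw [h0]
    have h1 : (0 : ℝ) ≤ numvar (qq d b) (d - m) n' := Nat.cast_nonneg _
    have h2 : (0 : ℝ) ≤ m := Nat.cast_nonneg _
    simp only [Nat.cast_zero, div_zero]
    linarith
  · rw [sub_le_iff_le_add, div_le_iff₀ (by exact_mod_cast hpos)]
    have : (n' : ℝ) * d ≤ n * (numvar (qq d b) (d - m) n' + 2 * m) := by exact_mod_cast hA
    linarith

lemma of_nondeg {d b : ℕ} (hd : 1 ≤ d) (hb : b ≤ d) (h : NonDeg (qq d b)) :
    b = 0 ∨ d ≤ 2 * b := by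
  classical
  by_contra hcon
  push Not at hcon
  obtain ⟨hb0, hdb⟩ := hcon
  let l : Fin d := ⟨d - 1, by omega⟩
  let M : Matrix (Fin d) (Fin d) ℝ := Matrix.diagonal (fun i => if i = l then 0 else 1)
  let w : ({jj : Fin d × Fin d // jj.1 < jj.2} ⊕ {j : Fin d // d - b ≤ (j : ℕ)}) → ℝ :=
    Sum.elim (fun jj => if jj.1.2 = l then 1 else 0) (fun j => if j.1 = l then 1 else 0)
  have hM : M.rank = d - 1 := by
    rw [Matrix.rank_diagonal, Fintype.card_subtype]
    have : (Finset.univ.filter (fun i : Fin d => (if i = l then (0:ℝ) else 1) ≠ 0))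
        = Finset.univ.erase l := by
      ext i; simp
    rw [this, Finset.card_erase_of_mem (Finset.mem_univ _)]; simp
  have hw : (Matrix.diagonal w).rank = d := by
    rw [Matrix.rank_diagonal]
    let e : {i // w i ≠ 0} ≃ Fin d :=
      { toFun := fun i => Sum.elim (fun jj => jj.1.1) (fun j => j.1) i.1
        invFun := fun i => if hi : i = l then ⟨Sum.inr ⟨l, by simp [l]; omega⟩, by simp [w]⟩
          else ⟨Sum.inl ⟨(i, l), by
            have : (i : ℕ) ≠ d - 1 := fun h => hi (Fin.ext h)
            have := i.2
            simp only [Fin.lt_def, l]; omega⟩, by simp [w]⟩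
        left_inv := by
          rintro ⟨⟨⟨p, q⟩, hpq⟩ | ⟨j, hj⟩, hi⟩
          · simp only [w, Sum.elim_inl, ne_eq, ite_eq_right_iff, one_ne_zero, imp_false,
              not_not] at hi
            subst hi
            have : p ≠ l := ne_of_lt hpq
            simp [this]
          · simp only [w, Sum.elim_inr, ne_eq, ite_eq_right_iff, one_ne_zero, imp_false,
              not_not] at hi
            subst hi
            simp
        right_inv := by
          intro i
          by_cases hi : i = l
          · simp [hi]
          · simp [hi] }
    rw [Fintype.card_congr e]
    simp
  have hNV : NV (fun i => ∑ i', (Matrix.diagonal w) i i' •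
      ((qq d b) i').comp (Matrix.vecMulLinear M)) = 0 := by
    have hz : ∀ i, w i • ((qq d b) i).comp (Matrix.vecMulLinear M) = 0 := by
      rintro (⟨⟨p, q⟩, hpq⟩ | ⟨j, hj⟩)
      · by_cases hq : q = l
        · ext x
          simp [mono, M, hq, Matrix.vecMul_diagonal]
        · simp [w, hq]
      · by_cases hq : j = l
        · ext x
          simp [mono, M, hq, Matrix.vecMul_diagonal]
        · simp [w, hq]
    have hz2 : ∀ i, ∑ i', (Matrix.diagonal w) i i' •
      ((qq d b) i').comp (Matrix.vecMulLinear M) = 0 := by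
      intro i
      rw [Finset.sum_eq_single i]
      · rw [Matrix.diagonal_apply_eq]; exact hz i
      · intro j _ hj
        rw [Matrix.diagonal_apply_ne _ (Ne.symm hj), zero_smul]
      · simp
    unfold NV
    simp only [hz2]
    simp
  have hnum : numvar (qq d b) (d - 1) d = 0 := by
    apply Nat.eq_zero_of_le_zero
    exact Nat.sInf_le ⟨M, Matrix.diagonal w, hM, hw, hNV⟩
  have hcard := card_index d b hb
  have hle : d ≤ Fintype.card
      ({jj : Fin d × Fin d // jj.1 < jj.2} ⊕ {j : Fin d // d - b ≤ (j : ℕ)}) := by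
    exact hw.symm.le.trans (Matrix.diagonal w).rank_le_card_width
  have := h d 1 hle (by omega)
  rw [hnum] at this
  set n := Fintype.card ({jj : Fin d × Fin d // jj.1 < jj.2} ⊕ {j : Fin d // d - b ≤ (j : ℕ)})
  have hpos : (0 : ℝ) < n := by
    have : 0 < n := by omega
    exact_mod_cast this
  rw [sub_le_iff_le_add, div_le_iff₀ hpos] at this
  have h2 : (d * d : ℝ) ≤ 2 * n := by push_cast at this; linarith
  have h3 : d * d ≤ 2 * n := by exact_mod_cast h2
  omega

/-- Claim 3.3 for quadratic ACK systems: the tuple consisting of all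
mixed monomials `ξ_{j₁}ξ_{j₂}` (`j₁ < j₂`) together with the squares `ξ_j²` for the last `b`
indices is non-degenerate if and only if `b = 0` or `b ≥ d/2`. -/
theorem statement_13 (d b : ℕ) (hd : 1 ≤ d) (hb : b ≤ d) :
    NonDeg (Sum.elim
        (fun jj : {jj : Fin d × Fin d // jj.1 < jj.2} => mono jj.1.1 jj.1.2)
        (fun j : {j : Fin d // d - b ≤ (j : ℕ)} => mono j.1 j.1)) ↔
      (b = 0 ∨ d ≤ 2 * b) := by
  exact ⟨of_nondeg hd hb, nondeg_of hb⟩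

end GOZZK
end
end

section
/- For every 2 ≤ q ≤ p < ∞, every ε > 0, and every n-tuple 𝐪 = (Q_1, …, Q_n) of real quadratic forms in d variables, there exist a constant C_ε < ∞ and a neighborhood 𝒬 of 𝐪 in the (finite-dimensional coefficient) space of n-tuples of quadratic forms in d variables such that for every 𝐪̃ ∈ 𝒬 and every dyadic δ ∈ (0,1), Dec_{q,p}(𝐪̃, δ) ≤ C_ε δ^{−Γ_{q,p}(𝐪) − ε}. -/
open MeasureTheory
open scoped ENNReal

noncomputable section

namespace GOZZK

section helpers
open FourierTransform SchwartzMap Convolution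

/-- The physical/frequency space. -/
abbrev EE (d n : ℕ) := (Fin d → ℝ) × (Fin n → ℝ)

/-- The Euclidean version of the space. -/
abbrev VV (d n : ℕ) := WithLp 2 (EuclideanSpace ℝ (Fin d) × EuclideanSpace ℝ (Fin n))

/-- The identification of the two. -/
def eqv (d n : ℕ) : EE d n ≃L[ℝ] VV d n :=
  ((EuclideanSpace.equiv (Fin d) ℝ).symm.prodCongr (EuclideanSpace.equiv (Fin n) ℝ).symm).trans
    (WithLp.prodContinuousLinearEquiv 2 ℝ _ _).symm

lemma eqv_mp (d n : ℕ) : MeasurePreserving (eqv d n) volume volume :=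
  (WithLp.volume_preserving_toLp _ _).comp
    ((PiLp.volume_preserving_toLp (Fin d)).prod (PiLp.volume_preserving_toLp (Fin n)))

/-- The dual pairing. -/
def pr {d n : ℕ} (z ξ : EE d n) : ℝ := (∑ j, z.1 j * ξ.1 j) + ∑ i, z.2 i * ξ.2 i

lemma pr_eq {d n : ℕ} (z ξ : EE d n) : inner ℝ (eqv d n z) (eqv d n ξ) = pr z ξ := by
  simp [pr, eqv, WithLp.prod_inner_apply, PiLp.inner_apply, mul_comm]

lemma eqv_emb (d n : ℕ) : MeasurableEmbedding (eqv d n) :=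
  (eqv d n).toHomeomorph.measurableEmbedding

lemma fourierT_eq {d n : ℕ} (f : EE d n → ℂ) (ξ : EE d n) :
    fourierT f ξ = 𝓕 (fun v => f ((eqv d n).symm v)) (eqv d n ξ) := by
  rw [Real.fourier_eq', ← (eqv_mp d n).integral_comp (eqv_emb d n)]
  unfold fourierT
  congr 1
  ext z
  rw [pr_eq]
  simp only [pr, ContinuousLinearEquiv.symm_apply_apply, smul_eq_mul]
  congr 3
  push_cast
  ring

/-- Transport a Schwartz function to the Euclidean space. -/
def toV {d n : ℕ} (f : 𝓢(EE d n, ℂ)) : 𝓢(VV d n, ℂ) :=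
  compCLMOfContinuousLinearEquiv ℂ (eqv d n).symm f

/-- Transport a Schwartz function from the Euclidean space. -/
def ofV {d n : ℕ} (f : 𝓢(VV d n, ℂ)) : 𝓢(EE d n, ℂ) :=
  compCLMOfContinuousLinearEquiv ℂ (eqv d n) f

lemma toV_ofV {d n : ℕ} (f : 𝓢(VV d n, ℂ)) : toV (ofV f) = f := by
  ext x; simp [toV, ofV]

lemma fourierT_toV {d n : ℕ} (f : 𝓢(EE d n, ℂ)) (ξ : EE d n) :
    fourierT f ξ = (𝓕 (toV f)) (eqv d n ξ) := by
  rw [fourierT_eq, fourier_coe]; rfl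

lemma fourierT_inj {d n : ℕ} {f g : 𝓢(EE d n, ℂ)} (h : ∀ ξ, fourierT f ξ = fourierT g ξ) :
    f = g := by
  have h1 : 𝓕 (toV f) = 𝓕 (toV g) := by
    ext v
    have := h ((eqv d n).symm v)
    simpa [fourierT_toV] using this
  have h2 : toV f = toV g := by
    have := congrArg (fun u => 𝓕⁻ u) h1
    simpa using this
  ext x
  have := congrArg (fun u => u (eqv d n x)) h2
  simpa [toV] using this

lemma fourierT_sum {d n : ℕ} {ι : Type*} (s : Finset ι) (f : ι → 𝓢(EE d n, ℂ)) (ξ : EE d n) :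
    fourierT (⇑(∑ i ∈ s, f i)) ξ = ∑ i ∈ s, fourierT (⇑(f i)) ξ := by
  classical
  have hadd : ∀ f g : 𝓢(EE d n, ℂ), fourierT (⇑(f+g)) ξ = fourierT f ξ + fourierT g ξ := by
    intro f g
    rw [fourierT_toV, fourierT_toV, fourierT_toV]
    simp [toV, FourierTransform.fourier_add]
  have h0 : fourierT (⇑(0 : 𝓢(EE d n, ℂ))) ξ = 0 := by
    simp [fourierT]
  induction s using Finset.induction_on with
  | empty => simpa using h0
  | insert a s ha ih => rw [Finset.sum_insert ha, Finset.sum_insert ha, hadd, ih]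

lemma eLpNorm_ofV {d n : ℕ} (f : 𝓢(VV d n, ℂ)) (p : ℝ≥0∞) :
    eLpNorm (⇑(ofV f)) p volume = eLpNorm (⇑f) p volume :=
  eLpNorm_comp_measurePreserving f.continuous.aestronglyMeasurable (eqv_mp d n)

lemma eLpNorm_toV {d n : ℕ} (f : 𝓢(EE d n, ℂ)) (p : ℝ≥0∞) :
    eLpNorm (⇑(toV f)) p volume = eLpNorm (⇑f) p volume := by
  rw [← eLpNorm_ofV]
  congr 1

/-- Convolution of scalar Schwartz functions. -/
def cvl {V : Type*} [NormedAddCommGroup V] [InnerProductSpace ℝ V] [FiniteDimensional ℝ V]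
    [MeasurableSpace V] [BorelSpace V] (κ g : 𝓢(V, ℂ)) : 𝓢(V, ℂ) :=
  SchwartzMap.convolution (𝕜 := ℂ) (ContinuousLinearMap.mul ℂ ℂ) κ g

lemma cvl_ap {V : Type*} [NormedAddCommGroup V] [InnerProductSpace ℝ V] [FiniteDimensional ℝ V]
    [MeasurableSpace V] [BorelSpace V] (κ g : 𝓢(V, ℂ)) (x : V) :
    cvl κ g x = ∫ t, κ t * g (x - t) := by
  unfold cvl
  rw [SchwartzMap.convolution_apply]; rfl

lemma cvl_fourier {V : Type*} [NormedAddCommGroup V] [InnerProductSpace ℝ V]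
    [FiniteDimensional ℝ V]
    [MeasurableSpace V] [BorelSpace V] (κ g : 𝓢(V, ℂ)) (x : V) :
    𝓕 (cvl κ g) x = 𝓕 κ x * 𝓕 g x := by
  unfold cvl
  rw [SchwartzMap.fourier_convolution, pairing_apply_apply]; rfl

lemma young {V : Type*} [NormedAddCommGroup V] [InnerProductSpace ℝ V] [FiniteDimensional ℝ V]
    [MeasurableSpace V] [BorelSpace V] (κ g : 𝓢(V, ℂ)) (p : ℝ≥0∞) (hp : 1 ≤ p) (hp' : p ≠ ∞) :
    eLpNorm (⇑(cvl κ g)) p volume ≤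
      eLpNorm (⇑κ) 1 volume * eLpNorm (⇑g) p volume := by
  set μ : Measure V := volume.withDensity (fun t => ‖κ t‖ₑ) with hμ
  have hκm : Measurable (fun t => ‖κ t‖ₑ) := κ.continuous.measurable.enorm
  have hgm : Measurable (⇑g) := g.continuous.measurable
  have hμu : μ Set.univ = eLpNorm (⇑κ) 1 volume := by
    rw [hμ, withDensity_apply _ MeasurableSet.univ, eLpNorm_one_eq_lintegral_enorm]
    simp
  have hp0 : p ≠ 0 := by
    rintro rfl; simp at hp
  have hr : 0 < p.toReal := ENNReal.toReal_pos hp0 hp'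
  have hr1 : 1 ≤ p.toReal := by
    have := ENNReal.toReal_mono hp' hp
    simpa using this
  have hM : eLpNorm (⇑κ) 1 volume ≠ ∞ := (κ.eLpNorm_lt_top 1 volume).ne
  set M := eLpNorm (⇑κ) 1 volume with hMdef
  have key : ∀ x, ‖cvl κ g x‖ₑ ^ p.toReal ≤
      M ^ (p.toReal - 1) * ∫⁻ t, ‖κ t‖ₑ * ‖g (x - t)‖ₑ ^ p.toReal := by
    intro x
    have h1 : ‖cvl κ g x‖ₑ ≤
        eLpNorm (fun t => g (x - t)) 1 μ := by
      rw [cvl_ap, eLpNorm_one_eq_lintegral_enorm, hμ,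
        lintegral_withDensity_eq_lintegral_mul _ hκm (by fun_prop)]
      refine (enorm_integral_le_lintegral_enorm _).trans (le_of_eq ?_)
      congr 1; ext t; simp
    have h2 := eLpNorm_le_eLpNorm_mul_rpow_measure_univ (μ := μ) (f := fun t => g (x - t)) hp
      (by fun_prop : Continuous (fun t => g (x - t))).aestronglyMeasurable
    have h3 := ENNReal.rpow_le_rpow (h1.trans h2) hr.le
    refine h3.trans (le_of_eq ?_)
    rw [ENNReal.mul_rpow_of_nonneg _ _ hr.le, hμu, mul_comm]
    congr 1
    · rw [← ENNReal.rpow_mul]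
      congr 1
      field_simp
      simp
    · rw [eLpNorm_eq_lintegral_rpow_enorm_toReal hp0 hp', ← ENNReal.rpow_mul, one_div,
        inv_mul_cancel₀ hr.ne', ENNReal.rpow_one, hμ,
        lintegral_withDensity_eq_lintegral_mul _ hκm (by fun_prop)]
      rfl
  rw [eLpNorm_eq_lintegral_rpow_enorm_toReal hp0 hp',
    eLpNorm_eq_lintegral_rpow_enorm_toReal hp0 hp']
  set I := ∫⁻ x, ‖g x‖ₑ ^ p.toReal with hI
  have h4 : ∫⁻ x, ‖cvl κ g x‖ₑ ^ p.toReal ≤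
      M ^ p.toReal * I := by
    calc _ ≤ ∫⁻ x, M ^ (p.toReal - 1) * ∫⁻ t, ‖κ t‖ₑ * ‖g (x - t)‖ₑ ^ p.toReal :=
          lintegral_mono key
      _ = M ^ (p.toReal - 1) * ∫⁻ x, ∫⁻ t, ‖κ t‖ₑ * ‖g (x - t)‖ₑ ^ p.toReal :=
          lintegral_const_mul' _ _ (ENNReal.rpow_ne_top_of_nonneg (by linarith) hM)
      _ = M ^ (p.toReal - 1) * ∫⁻ t, ∫⁻ x, ‖κ t‖ₑ * ‖g (x - t)‖ₑ ^ p.toReal := by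
          rw [lintegral_lintegral_swap]
          refine Measurable.aemeasurable ?_
          have : Measurable (Function.uncurry fun x t : V => ‖κ t‖ₑ * ‖g (x - t)‖ₑ ^ p.toReal) := by
            unfold Function.uncurry
            have h1 : Continuous fun a : V × V => κ a.2 := by fun_prop
            have h2 : Continuous fun a : V × V => g (a.1 - a.2) := by fun_prop
            exact h1.measurable.enorm.mul (h2.measurable.enorm.pow_const _)
          exact this
      _ = M ^ (p.toReal - 1) * ∫⁻ t, ‖κ t‖ₑ * I := by
          congr 1
          refine lintegral_congr fun t => ?_
          rw [lintegral_const_mul _ (by fun_prop)]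
          rw [lintegral_sub_right_eq_self (fun x => ‖g x‖ₑ ^ p.toReal) t]
      _ = M ^ (p.toReal - 1) * (M * I) := by
          rw [lintegral_mul_const _ hκm, hMdef, eLpNorm_one_eq_lintegral_enorm]
      _ = M ^ p.toReal * I := by
          rw [← mul_assoc]
          congr 1
          conv_lhs => rw [← ENNReal.rpow_one M, ← ENNReal.rpow_mul, 
            ← ENNReal.rpow_add_of_nonneg _ _ (by linarith) (by norm_num)]
          congr 1; ring
  refine (ENNReal.rpow_le_rpow h4 (by positivity)).trans (le_of_eq ?_)
  rw [ENNReal.mul_rpow_of_nonneg _ _ (by positivity), ← ENNReal.rpow_mul,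
    mul_one_div_cancel hr.ne', ENNReal.rpow_one]

lemma cutoff {d n : ℕ} (p : ℝ≥0∞) (hp : 1 ≤ p) (hp' : p ≠ ∞) (ρ : EE d n → ℝ)
    (hρ : ContDiff ℝ (⊤ : ℕ∞) ρ) (hc : HasCompactSupport ρ) :
    ∃ (M : ℝ≥0∞) (T : 𝓢(EE d n, ℂ) → 𝓢(EE d n, ℂ)), M ≠ ∞ ∧
      (∀ g ξ, fourierT (⇑(T g)) ξ = (ρ ξ : ℂ) * fourierT (⇑g) ξ) ∧
      ∀ g, eLpNorm (⇑(T g)) p volume ≤ M * eLpNorm (⇑g) p volume := by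
  have hs : ContDiff ℝ (⊤ : ℕ∞) (fun v : VV d n => (ρ ((eqv d n).symm v) : ℂ)) :=
    Complex.ofRealCLM.contDiff.comp (hρ.comp (eqv d n).symm.contDiff)
  have hcs : HasCompactSupport (fun v : VV d n => (ρ ((eqv d n).symm v) : ℂ)) := by
    have := hc.comp_homeomorph (eqv d n).symm.toHomeomorph
    exact this.comp_left (g := fun x : ℝ => (x : ℂ)) (by simp)
  set m : 𝓢(VV d n, ℂ) := hcs.toSchwartzMap hs with hm
  set κ : 𝓢(VV d n, ℂ) := 𝓕⁻ m with hκ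
  refine ⟨eLpNorm (⇑κ) 1 volume, fun g => ofV (cvl κ (toV g)),
    (κ.eLpNorm_lt_top 1 volume).ne, ?_, ?_⟩
  · intro g ξ
    rw [fourierT_toV, toV_ofV, cvl_fourier, hκ, fourierT_toV]
    simp [hm]
  · intro g
    rw [eLpNorm_ofV, ← eLpNorm_toV g]
    exact young _ _ p hp hp'

instance instHaarEE (d n : ℕ) : (volume : Measure (EE d n)).IsAddHaarMeasure :=
  Measure.prod.instIsAddHaarMeasure
    (volume : Measure (Fin d → ℝ)) (volume : Measure (Fin n → ℝ))

lemma iterD_expI (m : ℕ) : iteratedDeriv m (fun t : ℝ => Complex.exp (t * Complex.I)) =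
    fun t : ℝ => Complex.I ^ m * Complex.exp (t * Complex.I) := by
  induction m with
  | zero => simp
  | succ m ih =>
    rw [iteratedDeriv_succ, ih]
    ext t
    have h1 : HasDerivAt (fun t : ℝ => Complex.exp (t * Complex.I))
        (Complex.exp (t * Complex.I) * Complex.I) t := by
      have h0 : HasDerivAt (fun t : ℝ => (t : ℂ) * Complex.I) (1 * Complex.I) t :=
        (Complex.ofRealCLM.hasDerivAt (x := t)).mul_const Complex.I
      simpa using h0.cexp
    rw [(h1.const_mul (Complex.I ^ m)).deriv]
    ring

lemma tg_expI : Function.HasTemperateGrowth (fun t : ℝ => Complex.exp (t * Complex.I)) := by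
  refine ⟨?_, fun m => ⟨0, 1, fun t => ?_⟩⟩
  · have : ContDiff ℝ (⊤ : ℕ∞) (fun t : ℝ => (t : ℂ) * Complex.I) :=
      Complex.ofRealCLM.contDiff.mul contDiff_const
    exact this.cexp
  · rw [norm_iteratedFDeriv_eq_norm_iteratedDeriv, iterD_expI]
    simp [Complex.norm_exp_ofReal_mul_I]

lemma pr_add_left {d n : ℕ} (z w ξ : EE d n) : pr (z + w) ξ = pr z ξ + pr w ξ := by
  simp only [← pr_eq, map_add, inner_add_left]

lemma pr_add_right {d n : ℕ} (z w ξ : EE d n) : pr z (w + ξ) = pr z w + pr z ξ := by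
  simp only [← pr_eq, map_add, inner_add_right]

lemma pr_smul_left {d n : ℕ} (c : ℝ) (z ξ : EE d n) : pr (c • z) ξ = c * pr z ξ := by
  simp only [← pr_eq, map_smul, real_inner_smul_left]

/-- The pairing with a fixed vector as a linear functional. -/
def prL {d n : ℕ} (b : EE d n) : EE d n →L[ℝ] ℝ :=
  LinearMap.toContinuousLinearMap
    { toFun := fun z => pr z b
      map_add' := fun z w => pr_add_left z w b
      map_smul' := fun c z => pr_smul_left c z b }

lemma prL_apply {d n : ℕ} (b z : EE d n) : prL b z = pr z b := rfl

/-- The character `z ↦ e^{2 π i z b}`. -/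
def chr {d n : ℕ} (b z : EE d n) : ℂ := Complex.exp ((2 * Real.pi * pr z b : ℝ) * Complex.I)

lemma chr_tg {d n : ℕ} (b : EE d n) : Function.HasTemperateGrowth (chr b) := by
  have h := tg_expI.comp ((2 * Real.pi) • prL b).hasTemperateGrowth
  exact h

lemma chr_norm {d n : ℕ} (b z : EE d n) : ‖chr b z‖ = 1 := Complex.norm_exp_ofReal_mul_I _

lemma exists_adj {d n : ℕ} (A : EE d n ≃ₗ[ℝ] EE d n) :
    ∃ A' : EE d n ≃ₗ[ℝ] EE d n, ∀ z ξ, pr (A' z) ξ = pr z (A ξ) := by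
  let e := eqv d n
  let L : VV d n →L[ℝ] VV d n :=
    (e : EE d n →L[ℝ] VV d n) ∘L (LinearMap.toContinuousLinearMap (A : EE d n →ₗ[ℝ] EE d n)) ∘L
      (e.symm : VV d n →L[ℝ] EE d n)
  let M : EE d n →ₗ[ℝ] EE d n :=
    ((e.symm : VV d n →L[ℝ] EE d n) ∘L (ContinuousLinearMap.adjoint L) ∘L
      (e : EE d n →L[ℝ] VV d n) : EE d n →L[ℝ] EE d n)
  have hM : ∀ z ξ, pr (M z) ξ = pr z (A ξ) := by
    intro z ξ
    rw [← pr_eq, ← pr_eq]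
    have h1 : eqv d n (M z) = ContinuousLinearMap.adjoint L (e z) := by simp [M, e]
    rw [h1, ContinuousLinearMap.adjoint_inner_left]
    simp [L, e]
  have hinj : Function.Injective M := by
    rw [← LinearMap.ker_eq_bot, LinearMap.ker_eq_bot']
    intro z hz
    have h := hM z (A.symm z)
    rw [hz, A.apply_symm_apply, ← pr_eq, ← pr_eq] at h
    simp only [map_zero, inner_zero_left] at h
    have : eqv d n z = 0 := inner_self_eq_zero.1 h.symm
    simpa using this
  exact ⟨LinearEquiv.ofInjectiveEndo M hinj, fun z ξ => by
    simpa using hM z ξ⟩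

lemma affine {d n : ℕ} (A : EE d n ≃ₗ[ℝ] EE d n) (b : EE d n) (p : ℝ≥0∞) (hp' : p ≠ ∞) :
    ∃ (Φ : 𝓢(EE d n, ℂ) →ₗ[ℂ] 𝓢(EE d n, ℂ)) (c : ℝ≥0∞), c ≠ 0 ∧ c ≠ ∞ ∧
      Function.Surjective Φ ∧
      (∀ g ξ, fourierT (⇑(Φ g)) (A ξ + b) = 0 ↔ fourierT (⇑g) ξ = 0) ∧
      ∀ g, eLpNorm (⇑(Φ g)) p volume = c * eLpNorm (⇑g) p volume := by
  obtain ⟨A', hA'⟩ := exists_adj A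
  let Ac : EE d n ≃L[ℝ] EE d n := A'.toContinuousLinearEquiv
  have hdet : LinearMap.det (A' : EE d n →ₗ[ℝ] EE d n) ≠ 0 := (LinearEquiv.isUnit_det' A').ne_zero
  have hmap := Measure.map_linearMap_addHaar_eq_smul_addHaar (volume : Measure (EE d n)) hdet
  set c0 : ℝ≥0∞ := ENNReal.ofReal |(LinearMap.det (A' : EE d n →ₗ[ℝ] EE d n))⁻¹| with hc0
  have hc00 : c0 ≠ 0 := by
    rw [hc0]; simpa using hdet
  have hc0t : c0 ≠ ∞ := ENNReal.ofReal_ne_top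
  have hmap' : Measure.map (⇑Ac) (volume : Measure (EE d n)) = c0 • volume := hmap
  let Φ : 𝓢(EE d n, ℂ) →ₗ[ℂ] 𝓢(EE d n, ℂ) :=
    (smulLeftCLM ℂ (chr b) ∘L compCLMOfContinuousLinearEquiv ℂ Ac :
      𝓢(EE d n, ℂ) →L[ℂ] 𝓢(EE d n, ℂ))
  have hΦ : ∀ g z, Φ g z = chr b z * g (Ac z) := by
    intro g z
    simp [Φ, smulLeftCLM_apply_apply (chr_tg b)]
  refine ⟨Φ, c0 ^ (1 / p).toReal, ?_, ?_, ?_, ?_, ?_⟩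
  · simp [ENNReal.rpow_eq_zero_iff, hc00, hc0t]
  · exact ENNReal.rpow_ne_top_of_nonneg ENNReal.toReal_nonneg hc0t
  · intro f
    refine ⟨compCLMOfContinuousLinearEquiv ℂ Ac.symm (smulLeftCLM ℂ (chr (-b)) f), ?_⟩
    ext z
    rw [hΦ]
    simp only [compCLMOfContinuousLinearEquiv_apply, Function.comp,
      ContinuousLinearEquiv.symm_apply_apply, smulLeftCLM_apply_apply (chr_tg (-b)), smul_eq_mul]
    rw [← mul_assoc]
    have : chr b z * chr (-b) z = 1 := by
      unfold chr
      rw [← Complex.exp_add, ← add_mul, ← Complex.ofReal_add, ← mul_add, ← pr_add_right,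
        add_neg_cancel, ← pr_eq]
      simp
    rw [this, one_mul]
  · intro g ξ
    have h : fourierT (⇑(Φ g)) (A ξ + b) = c0.toReal • fourierT (⇑g) ξ := by
      have h1 : fourierT (⇑g) ξ = ∫ z, chr (-ξ) z * g z := by
        unfold fourierT chr
        congr 1; ext z; congr 3
        have : pr z (-ξ) = - pr z ξ := by simp [← pr_eq]
        rw [this]; unfold pr; push_cast; ring
      have h2 : fourierT (⇑(Φ g)) (A ξ + b) = ∫ z, chr (-ξ) (Ac z) * g (Ac z) := by
        unfold fourierT
        congr 1; ext z
        rw [hΦ, ← mul_assoc]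
        congr 1
        unfold chr
        rw [← Complex.exp_add, ← add_mul, ← Complex.ofReal_add]
        congr 3
        have e1 : pr (Ac z) (-ξ) = - pr z (A ξ) := by
          rw [← hA']
          simp [← pr_eq]; rfl
        have e2 := pr_add_right z (A ξ) b
        rw [e1]
        change -(2 * Real.pi * pr z (A ξ + b)) + _ = _
        rw [e2]; ring
      have h3 := MeasurableEmbedding.integral_map (μ := (volume : Measure (EE d n)))
        Ac.toHomeomorph.measurableEmbedding (fun z => chr (-ξ) z * g z)
      change ∫ y, _ ∂(Measure.map (⇑Ac) volume) = _ at h3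
      rw [hmap', integral_smul_measure] at h3
      rw [h1, h2, h3]
      rfl
    rw [h]
    simp [ENNReal.toReal_eq_zero_iff, hc00, hc0t]
  · intro g
    have h1 : eLpNorm (⇑(Φ g)) p volume = eLpNorm (fun z => g (Ac z)) p volume := by
      refine eLpNorm_congr_norm_ae (ae_of_all _ fun z => ?_)
      rw [hΦ, norm_mul, chr_norm, one_mul]
    have h2 := eLpNorm_map_measure (μ := (volume : Measure (EE d n))) (f := ⇑Ac) (g := ⇑g) (p := p)
      g.continuous.aestronglyMeasurable Ac.continuous.measurable.aemeasurable
    rw [h1]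
    change eLpNorm (⇑g ∘ ⇑Ac) p volume = _
    rw [← h2, hmap', eLpNorm_smul_measure_of_ne_top hp', smul_eq_mul]

/-- The decoupling inequality for a family of sets. -/
def DecP {d n : ℕ} {ι : Type*} [Fintype ι] (S : ι → Set (EE d n)) (q p : ℝ≥0∞) (D : ℝ) : Prop :=
  0 ≤ D ∧ ∀ f : ι → 𝓢(EE d n, ℂ), (∀ i, Function.support (fourierT (⇑(f i))) ⊆ S i) →
    eLpNorm (fun z => ∑ i, f i z) p volume ≤
      ENNReal.ofReal D * lqNorm q (fun i => eLpNorm (⇑(f i)) p volume)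

section lq
variable {ι κ : Type*} [Fintype ι] [Fintype κ] {q : ℝ≥0∞}

lemma lq_eq (hq : q ≠ ∞) (a : ι → ℝ≥0∞) :
    lqNorm q a = (∑ i : ι, a i ^ q.toReal) ^ (1 / q.toReal) := if_neg hq

lemma lq_mono (hq : q ≠ ∞) {a b : ι → ℝ≥0∞} (h : ∀ i, a i ≤ b i) :
    lqNorm q a ≤ lqNorm q b := by
  rw [lq_eq hq, lq_eq hq]
  refine ENNReal.rpow_le_rpow (Finset.sum_le_sum fun i _ => ?_) (by positivity)
  exact ENNReal.rpow_le_rpow (h i) ENNReal.toReal_nonneg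

lemma lq_smul (hq0 : q ≠ 0) (hq : q ≠ ∞) (c : ℝ≥0∞) (a : ι → ℝ≥0∞) :
    lqNorm q (fun i => c * a i) = c * lqNorm q a := by
  have hr : 0 < q.toReal := ENNReal.toReal_pos hq0 hq
  rw [lq_eq hq, lq_eq hq]
  simp_rw [ENNReal.mul_rpow_of_nonneg _ _ hr.le]
  rw [← Finset.mul_sum, ENNReal.mul_rpow_of_nonneg _ _ (by positivity), ← ENNReal.rpow_mul,
    mul_one_div_cancel hr.ne', ENNReal.rpow_one]

lemma le_lq (hq0 : q ≠ 0) (hq : q ≠ ∞) (a : ι → ℝ≥0∞) (i : ι) : a i ≤ lqNorm q a := by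
  have hr : 0 < q.toReal := ENNReal.toReal_pos hq0 hq
  rw [lq_eq hq]
  have h := Finset.single_le_sum (f := fun i => a i ^ q.toReal) (fun _ _ => zero_le)
    (Finset.mem_univ i)
  have h2 := ENNReal.rpow_le_rpow h (by positivity : 0 ≤ 1 / q.toReal)
  refine le_trans (le_of_eq ?_) h2
  rw [← ENNReal.rpow_mul, mul_one_div_cancel hr.ne', ENNReal.rpow_one]

lemma lq_prod (hq0 : q ≠ 0) (hq : q ≠ ∞) (a : ι × κ → ℝ≥0∞) :
    lqNorm q (fun i => lqNorm q (fun k => a (i, k))) = lqNorm q a := by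
  have hr : 0 < q.toReal := ENNReal.toReal_pos hq0 hq
  rw [lq_eq hq, lq_eq hq, Fintype.sum_prod_type]
  congr 1
  refine Finset.sum_congr rfl fun i _ => ?_
  rw [lq_eq hq, ← ENNReal.rpow_mul, one_div_mul_cancel hr.ne', ENNReal.rpow_one]

lemma lq_equiv (hq : q ≠ ∞) (e : ι ≃ κ) (a : κ → ℝ≥0∞) :
    lqNorm q (fun i => a (e i)) = lqNorm q a := by
  rw [lq_eq hq, lq_eq hq, e.sum_comp (fun k => a k ^ q.toReal)]
end lq

section dec
variable {d n : ℕ} {ι κ : Type*} [Fintype ι] [Fintype κ] {q p : ℝ≥0∞}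

lemma dec_mono {S S' : ι → Set (EE d n)} {D D' : ℝ} (h : DecP S q p D) (hS : ∀ i, S' i ⊆ S i)
    (hD : D ≤ D') : DecP S' q p D' := by
  refine ⟨h.1.trans hD, fun f hf => ?_⟩
  refine (h.2 f fun i => (hf i).trans (hS i)).trans ?_
  gcongr

lemma sum_coe (f : ι → 𝓢(EE d n, ℂ)) : (fun z => ∑ i, f i z) = ⇑(∑ i, f i) := by
  ext z; simp

lemma dec_affine (hq0 : q ≠ 0) (hq : q ≠ ∞) (hp : p ≠ ∞) {S S' : ι → Set (EE d n)} {D : ℝ}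
    (h : DecP S q p D)
    (A : EE d n ≃ₗ[ℝ] EE d n) (b : EE d n) (hS : ∀ i, ∀ z ∈ S' i, ∃ w ∈ S i, z = A w + b) :
    DecP S' q p D := by
  obtain ⟨Φ, c, hc0, hct, hsurj, hF, hN⟩ := affine A b p hp
  refine ⟨h.1, fun f hf => ?_⟩
  choose g hg using fun i => hsurj (f i)
  have hsup : ∀ i, Function.support (fourierT (⇑(g i))) ⊆ S i := by
    intro i ξ hξ
    have h1 : fourierT (⇑(f i)) (A ξ + b) ≠ 0 := by
      rw [← hg i]; exact fun h0 => hξ ((hF _ _).1 h0)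
    obtain ⟨w, hw, hw'⟩ := hS i _ (hf i h1)
    have : ξ = w := A.injective (add_right_cancel hw')
    rwa [this]
  have key := h.2 g hsup
  have e1 : eLpNorm (fun z => ∑ i, f i z) p volume = c * eLpNorm (fun z => ∑ i, g i z) p volume := by
    rw [sum_coe, sum_coe, ← hN, map_sum]
    simp_rw [hg]
  rw [e1]
  simp_rw [← hg, hN]
  rw [lq_smul hq0 hq, mul_left_comm]
  gcongr

lemma dec_trivial (hq0 : q ≠ 0) (hq : q ≠ ∞) (hp : 1 ≤ p) (S : ι → Set (EE d n)) :
    DecP S q p (Fintype.card ι) := by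
  refine ⟨by positivity, fun f _ => ?_⟩
  have h1 : eLpNorm (fun z => ∑ i, f i z) p volume ≤ ∑ i, eLpNorm (⇑(f i)) p volume := by
    have := eLpNorm_sum_le (μ := (volume : Measure (EE d n))) (s := Finset.univ)
      (f := fun i => ⇑(f i)) (p := p)
      (fun i _ => (f i).continuous.aestronglyMeasurable) hp
    refine le_trans (le_of_eq ?_) this
    congr 1; ext z; simp
  refine h1.trans ((Finset.sum_le_sum fun i _ =>
    le_lq hq0 hq (fun i => eLpNorm (⇑(f i)) p volume) i).trans ?_)
  simp

lemma dec_equiv (hq : q ≠ ∞) (e : ι ≃ κ) {S : κ → Set (EE d n)} {D : ℝ}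
    (h : DecP (fun i => S (e i)) q p D) : DecP S q p D := by
  refine ⟨h.1, fun f hf => ?_⟩
  have := h.2 (fun i => f (e i)) (fun i => hf (e i))
  rw [lq_equiv hq e (fun k => eLpNorm (⇑(f k)) p volume)] at this
  refine le_trans (le_of_eq ?_) this
  congr 1; ext z; exact (e.sum_comp (fun k => f k z)).symm

lemma dec_nest (hq0 : q ≠ 0) (hq : q ≠ ∞) {S1 : ι → Set (EE d n)}
    {S2 : ι × κ → Set (EE d n)} {D1 D2 : ℝ} (h1 : DecP S1 q p D1)
    (h2 : ∀ i, DecP (fun k => S2 (i, k)) q p D2) (hs : ∀ i k, S2 (i, k) ⊆ S1 i)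
    (hD2 : 0 ≤ D2) :
    DecP S2 q p (D1 * D2) := by
  refine ⟨mul_nonneg h1.1 hD2, fun f hf => ?_⟩
  have k1 := h1.2 (fun i => ∑ k, f (i, k)) (fun i ξ hξ => by
    rw [Function.mem_support, fourierT_sum] at hξ
    obtain ⟨k, _, hk⟩ := Finset.exists_ne_zero_of_sum_ne_zero hξ
    exact hs i k (hf (i, k) hk))
  have e1 : (fun z => ∑ i, f i z) = fun z => ∑ i, (∑ k, f (i, k)) z := by
    ext z; simp [Fintype.sum_prod_type]
  rw [e1]
  refine k1.trans ?_
  have k2 : ∀ i, eLpNorm (⇑(∑ k, f (i, k))) p volume ≤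
      ENNReal.ofReal D2 * lqNorm q (fun k => eLpNorm (⇑(f (i, k))) p volume) := by
    intro i
    rw [← sum_coe]
    exact (h2 i).2 (fun k => f (i, k)) (fun k => hf (i, k))
  refine (mul_le_mul_right (lq_mono hq k2) _).trans (le_of_eq ?_)
  rw [lq_smul hq0 hq, lq_prod hq0 hq (fun x => eLpNorm (⇑(f x)) p volume), ← mul_assoc,
    ENNReal.ofReal_mul h1.1]

lemma parts (hp : 1 ≤ p) (hp' : p ≠ ∞) (C c : ℝ) (hc : 0 < c) :
    ∃ (J : Type) (_ : Fintype J) (w : J → EE d n) (M : ℝ), 0 ≤ M ∧ (∀ j, ‖w j‖ ≤ C) ∧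
      ∀ g : 𝓢(EE d n, ℂ), Function.support (fourierT (⇑g)) ⊆ Metric.closedBall 0 C →
        ∃ h : J → 𝓢(EE d n, ℂ), g = ∑ j, h j ∧
          ∀ j, Function.support (fourierT (⇑(h j))) ⊆ Metric.closedBall (w j) c ∧
            eLpNorm (⇑(h j)) p volume ≤ ENNReal.ofReal M * eLpNorm (⇑g) p volume := by
  obtain ⟨t, hts, htf, hcov⟩ := finite_cover_balls_of_compact
    (isCompact_closedBall (0 : EE d n) C) hc
  have : Fintype t := htf.fintype
  obtain ⟨ρ, hρ⟩ := SmoothPartitionOfUnity.exists_isSubordinate (modelWithCornersSelf ℝ (EE d n))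
    (Metric.isClosed_closedBall (x := (0 : EE d n)) (ε := C))
    (fun j : t => Metric.ball (j : EE d n) c) (fun j => Metric.isOpen_ball)
    (by simpa using hcov)
  have hsm : ∀ j : t, ContDiff ℝ (⊤ : ℕ∞) (fun x => ρ j x) := fun j =>
    (ρ j).contMDiff.contDiff
  have hcs : ∀ j : t, HasCompactSupport (fun x => ρ j x) := fun j =>
    HasCompactSupport.intro (isCompact_closedBall (j : EE d n) c) (fun x hx => by
      by_contra h0
      exact hx (Metric.ball_subset_closedBall (hρ j (subset_tsupport _ h0))))
  choose M T hM hT hTn using fun j : t => cutoff p hp hp' (fun x => ρ j x) (hsm j) (hcs j)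
  refine ⟨t, inferInstance, fun j => j, ∑ j, (M j).toReal, by positivity, ?_, ?_⟩
  · intro j
    simpa using hts j.2
  · intro g hg
    refine ⟨fun j => T j g, ?_, fun j => ⟨?_, ?_⟩⟩
    · refine fourierT_inj fun ξ => ?_
      rw [fourierT_sum]
      simp_rw [hT]
      rw [← Finset.sum_mul]
      by_cases h0 : fourierT (⇑g) ξ = 0
      · simp [h0]
      · have h1 := ρ.sum_eq_one (hg h0)
        rw [finsum_eq_sum_of_fintype] at h1
        rw [← Complex.ofReal_sum, h1]; simp
    · intro ξ hξ
      rw [Function.mem_support, hT] at hξ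
      have h0 : ρ j ξ ≠ 0 := by
        intro h0; simp [h0] at hξ
      exact Metric.ball_subset_closedBall (hρ j (subset_tsupport _ h0))
    · refine (hTn j g).trans ?_
      gcongr
      rw [← ENNReal.ofReal_toReal (hM j)]
      exact ENNReal.ofReal_le_ofReal
        (Finset.single_le_sum (f := fun j => (M j).toReal) (fun _ _ => ENNReal.toReal_nonneg)
          (Finset.mem_univ j))

/-- comparison of families of affine images of boxes -/
lemma dec_pieces (hq0 : q ≠ 0) (hq : q ≠ ∞) (hp : 1 ≤ p) (hp' : p ≠ ∞) (C c : ℝ) (hc : 0 < c) :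
    ∃ (M : ℝ), 0 ≤ M ∧ ∀ (ι : Type) [Fintype ι] (A : ι → EE d n ≃ₗ[ℝ] EE d n) (b : ι → EE d n)
      (D : ℝ),
      (∀ w : EE d n, ‖w‖ ≤ C →
        DecP (fun i => (fun x => A i x + b i) '' Metric.closedBall w c) q p D) → 0 ≤ D →
      DecP (fun i => (fun x => A i x + b i) '' Metric.closedBall 0 C) q p (M * D) := by
  obtain ⟨J, _, w, M, hM, hw, hpart⟩ := parts (d := d) (n := n) hp hp' C c hc
  refine ⟨Fintype.card J * M, by positivity, ?_⟩
  intro ι _ A b D hD hD0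
  refine ⟨by positivity, fun f hf => ?_⟩
  choose Φ cc hc0 hct hsurj hF hN using fun i => affine (A i) (b i) p hp'
  choose g hg using fun i => hsurj i (f i)
  have hsup : ∀ i, Function.support (fourierT (⇑(g i))) ⊆ Metric.closedBall 0 C := by
    intro i ξ hξ
    have h1 : fourierT (⇑(f i)) (A i ξ + b i) ≠ 0 := by
      rw [← hg i]; exact fun h0 => hξ ((hF _ _ _).1 h0)
    obtain ⟨w, hw, hw'⟩ := hf i h1
    have : w = ξ := (A i).injective (add_right_cancel hw')
    rwa [← this]
  choose h hsum hsupp hnorm using fun i => hpart (g i) (hsup i)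
  have e1 : (fun z => ∑ i, f i z) = ∑ j, fun z => ∑ i, Φ i (h i j) z := by
    ext z
    simp only [Finset.sum_apply]
    rw [Finset.sum_comm]
    refine Finset.sum_congr rfl fun i _ => ?_
    rw [← hg i]
    conv_lhs => rw [hsum i, map_sum]
    simp
  have hmeas : ∀ j, AEStronglyMeasurable (fun z => ∑ i, Φ i (h i j) z) volume := by
    intro j
    rw [sum_coe]
    exact (SchwartzMap.continuous _).aestronglyMeasurable
  rw [e1]
  refine (eLpNorm_sum_le (fun j _ => hmeas j) hp).trans ?_
  have key : ∀ j, eLpNorm (fun z => ∑ i, Φ i (h i j) z) p volume ≤ ENNReal.ofReal D *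
      (ENNReal.ofReal M * lqNorm q (fun i => eLpNorm (⇑(f i)) p volume)) := by
    intro j
    refine ((hD (w j) (hw j)).2 (fun i => Φ i (h i j)) ?_).trans ?_
    · intro i ζ hζ
      refine ⟨(A i).symm (ζ - b i), ?_, by simp⟩
      apply hsupp i j
      intro h0
      rw [← hF i] at h0
      simp at h0
      exact hζ h0
    · rw [← lq_smul hq0 hq (ENNReal.ofReal M)]
      refine mul_le_mul_right (lq_mono hq fun i => ?_) _
      rw [← hg i, hN, hN, mul_left_comm]
      gcongr
      exact hnorm i j
  refine (Finset.sum_le_sum fun j _ => key j).trans (le_of_eq ?_)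
  rw [ENNReal.ofReal_mul (by positivity), ENNReal.ofReal_mul (by positivity)]
  simp
  ring
end dec

section quad
variable {d n : ℕ}

/-- Bound on the polar forms. -/
def HasB (Q : Fin n → QF d) (B : ℝ) : Prop :=
  ∀ i x y, |QuadraticMap.polar (⇑(Q i)) x y| ≤ B * ‖x‖ * ‖y‖

lemma hasB_mono {Q : Fin n → QF d} {B B' : ℝ} (h : HasB Q B) (hB : B ≤ B') : HasB Q B' := by
  intro i x y
  refine (h i x y).trans ?_
  gcongr

lemma Q_add (Q : QF d) (x y : Fin d → ℝ) :
    Q (x + y) = Q x + Q y + QuadraticMap.polar (⇑Q) x y := by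
  simp [QuadraticMap.polar]

lemma Q_smul (Q : QF d) (c : ℝ) (x : Fin d → ℝ) : Q (c • x) = c ^ 2 * Q x := by
  rw [QuadraticMap.map_smul]; simp [pow_two]

lemma polar_self' (Q : QF d) (x : Fin d → ℝ) : QuadraticMap.polar (⇑Q) x x = 2 * Q x := by
  rw [QuadraticMap.polar_self]; simp

lemma polar_exp (Q : QF d) (x y : Fin d → ℝ) :
    QuadraticMap.polar (⇑Q) x y =
      ∑ i, ∑ j, x i * y j * QuadraticMap.polar (⇑Q) (Pi.single i 1) (Pi.single j 1) := by
  have hx : x = ∑ i, x i • (Pi.single i (1 : ℝ) : Fin d → ℝ) := by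
    ext k; simp [Finset.sum_apply, Pi.single_apply]
  have hy : y = ∑ i, y i • (Pi.single i (1 : ℝ) : Fin d → ℝ) := by
    ext k; simp [Finset.sum_apply, Pi.single_apply]
  have : Q.polarBilin x y = ∑ i, ∑ j, x i * y j * Q.polarBilin (Pi.single i 1) (Pi.single j 1) := by
    conv_lhs => rw [hx, hy]
    simp only [map_sum, LinearMap.sum_apply, map_smul, LinearMap.smul_apply, smul_eq_mul,
      Finset.mul_sum]
    rw [Finset.sum_comm]
    refine Finset.sum_congr rfl fun i _ => Finset.sum_congr rfl fun j _ => ?_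
    ring
  simpa using this

lemma polar_bound_s16 (Q : QF d) (b : ℝ)
    (h : ∀ i j, |QuadraticMap.polar (⇑Q) (Pi.single i 1) (Pi.single j 1)| ≤ b)
    (x y : Fin d → ℝ) : |QuadraticMap.polar (⇑Q) x y| ≤ (d : ℝ) ^ 2 * b * ‖x‖ * ‖y‖ := by
  rw [polar_exp]
  have : ∀ i j, |x i * y j * QuadraticMap.polar (⇑Q) (Pi.single i 1) (Pi.single j 1)| ≤
      ‖x‖ * ‖y‖ * b := by
    intro i j
    rw [abs_mul, abs_mul]
    have h1 := norm_le_pi_norm x i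
    have h2 := norm_le_pi_norm y j
    rw [Real.norm_eq_abs] at h1 h2
    have := h i j
    gcongr
  calc _ ≤ ∑ i : Fin d, ∑ j : Fin d, ‖x‖ * ‖y‖ * b := by
        refine (Finset.abs_sum_le_sum_abs _ _).trans (Finset.sum_le_sum fun i _ => ?_)
        exact (Finset.abs_sum_le_sum_abs _ _).trans (Finset.sum_le_sum fun j _ => this i j)
    _ = _ := by simp; ring

lemma exists_hasB (Q : Fin n → QF d) : ∃ B, 0 ≤ B ∧ HasB Q B := by
  refine ⟨(d : ℝ) ^ 2 * ∑ i, ∑ j, ∑ k,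
    |QuadraticMap.polar (⇑(Q i)) (Pi.single j 1) (Pi.single k 1)|, by positivity, ?_⟩
  intro i x y
  refine polar_bound_s16 _ _ (fun j k => ?_) x y
  refine le_trans ?_ (Finset.single_le_sum (f := fun i => ∑ j, ∑ k,
    |QuadraticMap.polar (⇑(Q i)) (Pi.single j 1) (Pi.single k 1)|)
    (fun _ _ => by positivity) (Finset.mem_univ i))
  refine le_trans ?_ (Finset.single_le_sum (f := fun j => ∑ k,
    |QuadraticMap.polar (⇑(Q i)) (Pi.single j 1) (Pi.single k 1)|)
    (fun _ _ => by positivity) (Finset.mem_univ j))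
  exact Finset.single_le_sum (f := fun k =>
    |QuadraticMap.polar (⇑(Q i)) (Pi.single j 1) (Pi.single k 1)|)
    (fun _ _ => by positivity) (Finset.mem_univ k)

lemma polar_small (R : QF d) (η : ℝ)
    (h : ∀ ξ ∈ Set.univ.pi fun _ : Fin d => Set.Icc (0 : ℝ) 1, |R ξ| ≤ η) (x y : Fin d → ℝ) :
    |QuadraticMap.polar (⇑R) x y| ≤ (d : ℝ) ^ 2 * (6 * η) * ‖x‖ * ‖y‖ := by
  refine polar_bound_s16 _ _ (fun j k => ?_) x y
  set e : Fin d → (Fin d → ℝ) := fun j => Pi.single j 1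
  have he : ∀ j l, 0 ≤ e j l ∧ e j l ≤ 1 := by
    intro j l
    simp only [e, Pi.single_apply]
    split_ifs <;> norm_num
  have h1 := h (e j) (fun l _ => he j l)
  have h2 := h (e k) (fun l _ => he k l)
  have h3 := h ((1 / 2 : ℝ) • (e j + e k)) (fun l _ => by
    have := he j l; have := he k l
    simp only [Pi.smul_apply, Pi.add_apply, smul_eq_mul]
    constructor <;> linarith)
  rw [Q_smul, Q_add] at h3
  rw [abs_le] at *
  constructor <;> linarith [h1.1, h1.2, h2.1, h2.2, h3.1, h3.2]

lemma Q_bound {Q : QF d} {B : ℝ}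
    (h : ∀ x y, |QuadraticMap.polar (⇑Q) x y| ≤ B * ‖x‖ * ‖y‖) (x : Fin d → ℝ) :
    |Q x| ≤ B * ‖x‖ * ‖x‖ := by
  have := h x x
  rw [polar_self', abs_mul, abs_of_pos (by norm_num : (0:ℝ) < 2)] at this
  linarith [abs_nonneg (Q x)]

/-- Lower triangular linear equivalence. -/
def tri (α β : ℝ) (hα : α ≠ 0) (hβ : β ≠ 0) (L : (Fin d → ℝ) →ₗ[ℝ] (Fin n → ℝ)) :
    EE d n ≃ₗ[ℝ] EE d n where
  toFun w := (α • w.1, L w.1 + β • w.2)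
  map_add' x y := by ext <;> simp <;> ring
  map_smul' c x := by ext <;> simp <;> ring
  invFun w := (α⁻¹ • w.1, β⁻¹ • (w.2 - L (α⁻¹ • w.1)))
  left_inv w := by ext <;> simp [hα, hβ]
  right_inv w := by ext <;> simp [hα, hβ]

/-- the derivative of the quadratic forms -/
def polL (Q : Fin n → QF d) (s : Fin d → ℝ) (δ : ℝ) : (Fin d → ℝ) →ₗ[ℝ] (Fin n → ℝ) :=
  LinearMap.pi fun i => δ • (Q i).polarBilin s

lemma polL_apply (Q : Fin n → QF d) (s : Fin d → ℝ) (δ : ℝ) (x : Fin d → ℝ) (i : Fin n) :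
    polL Q s δ x i = δ * QuadraticMap.polar (⇑(Q i)) s x := by
  simp [polL]

lemma tri_apply (α β : ℝ) (hα : α ≠ 0) (hβ : β ≠ 0) (L : (Fin d → ℝ) →ₗ[ℝ] (Fin n → ℝ))
    (w : EE d n) : tri α β hα hβ L w = (α • w.1, L w.1 + β • w.2) := rfl

lemma mem_Ubox {Q : Fin n → QF d} {δ C : ℝ} (hC : 0 ≤ C) {a : Fin d → ℝ} {z : EE d n} :
    z ∈ Ubox Q δ C a ↔ ∃ (u : Fin d → ℝ) (v : Fin n → ℝ), ‖u‖ ≤ C ∧ ‖v‖ ≤ C ∧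
      z.1 = a + δ • u ∧
      ∀ i, z.2 i = Q i a + δ * QuadraticMap.polar (⇑(Q i)) a u + δ ^ 2 * v i := by
  simp only [pi_norm_le_iff_of_nonneg hC, Real.norm_eq_abs]
  unfold Ubox
  simp only [QuadraticMap.polar_smul_right, smul_eq_mul, Set.mem_setOf_eq, funext_iff,
    Pi.add_apply, Pi.smul_apply]

end quad

section steps
variable {d n : ℕ} {q p : ℝ≥0∞}

/-- Decoupling property at scale `k`. -/
def DP (Q : Fin n → QF d) (C : ℝ) (q p : ℝ≥0∞) (k : ℕ) (D : ℝ) : Prop :=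
  DecP (fun ν : Fin d → Fin (2 ^ k) => Ubox Q (1 / 2 ^ k) C (center k ν)) q p D

lemma dec_compare (hq0 : q ≠ 0) (hq : q ≠ ∞) (hp : 1 ≤ p) (hp' : p ≠ ∞) (B C C1 : ℝ)
    (hB : 0 ≤ B) (hC : 0 < C) (hC1 : 0 ≤ C1) :
    ∃ M : ℝ, 0 ≤ M ∧ ∀ Q : Fin n → QF d, HasB Q B → ∀ k D, DP Q C q p k D →
      DP Q C1 q p k (M * D) := by
  set c := C / (1 + B * C1) with hc
  have hden : 0 < 1 + B * C1 := by positivity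
  have hc0 : 0 < c := by positivity
  have hcC : c + B * C1 * c = C := by rw [hc]; field_simp
  have hcle : c ≤ C := by nlinarith [mul_nonneg (mul_nonneg hB hC1) hc0.le]
  obtain ⟨M, hM, H⟩ := dec_pieces (d := d) (n := n) hq0 hq hp hp' C1 c hc0
  refine ⟨M, hM, fun Q hQ k D hD => ?_⟩
  set δ : ℝ := 1 / 2 ^ k with hδ
  have hδ0 : δ ≠ 0 := by positivity
  have hδ2 : δ ^ 2 ≠ 0 := by positivity
  have key := H (Fin d → Fin (2 ^ k))
    (fun ν => tri δ (δ ^ 2) hδ0 hδ2 (polL Q (center k ν) δ))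
    (fun ν => (center k ν, fun i => Q i (center k ν))) D ?_ hD.1
  · refine dec_mono key (fun ν z hz => ?_) le_rfl
    obtain ⟨u, v, hu, hv, h1, h2⟩ := (mem_Ubox hC1).1 hz
    rw [← hδ] at h1 h2
    refine ⟨(u, v), ?_, ?_⟩
    · simp [Prod.norm_def, hu, hv]
    · ext j
      · simp [tri_apply, h1, add_comm]
      · simp [tri_apply, h2, polL_apply]; ring
  · intro w hw
    have hw1 : ‖w.1‖ ≤ C1 := (norm_fst_le w).trans hw
    refine dec_affine hq0 hq hp' hD (tri 1 1 one_ne_zero one_ne_zero (polL Q w.1 δ))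
      (δ • w.1, δ ^ 2 • w.2) ?_
    rintro ν z ⟨x, hx, rfl⟩
    rw [Metric.mem_closedBall, dist_eq_norm] at hx
    have hu : ‖x.1 - w.1‖ ≤ c := (norm_fst_le (x - w)).trans hx
    have hv : ‖x.2 - w.2‖ ≤ c := (norm_snd_le (x - w)).trans hx
    set a := center k ν
    have hsub : ∀ i, QuadraticMap.polar (⇑(Q i)) a (x.1 - w.1) =
        QuadraticMap.polar (⇑(Q i)) a x.1 - QuadraticMap.polar (⇑(Q i)) a w.1 :=
      fun i => QuadraticMap.polar_sub_right _ _ _ _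
    refine ⟨(a + δ • (x.1 - w.1), fun i => Q i a + δ * QuadraticMap.polar (⇑(Q i)) a (x.1 - w.1) +
      δ ^ 2 * ((x.2 - w.2) i - QuadraticMap.polar (⇑(Q i)) w.1 (x.1 - w.1))), ?_, ?_⟩
    · refine (mem_Ubox hC.le).2 ⟨x.1 - w.1,
        fun i => (x.2 - w.2) i - QuadraticMap.polar (⇑(Q i)) w.1 (x.1 - w.1),
        hu.trans hcle, ?_, rfl, fun i => rfl⟩
      rw [pi_norm_le_iff_of_nonneg hC.le]
      intro i
      refine (norm_sub_le _ _).trans ?_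
      rw [← hcC]
      refine add_le_add ((norm_le_pi_norm _ i).trans hv) ?_
      refine (hQ i _ _).trans ?_
      gcongr
    · ext j
      · simp [tri_apply]; ring
      · simp only [tri_apply, Prod.snd_add, Pi.add_apply, polL_apply, Pi.smul_apply, smul_eq_mul,
          Pi.sub_apply, QuadraticMap.polar_add_right, QuadraticMap.polar_smul_right, hsub]
        rw [QuadraticMap.polar_comm (Q j) w.1 a]
        ring

lemma center_nonneg (k : ℕ) (ν : Fin d → Fin (2 ^ k)) : ‖center k ν‖ ≤ 1 := by
  rw [pi_norm_le_iff_of_nonneg zero_le_one]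
  intro j
  have h1 : 0 ≤ center k ν j := by unfold center; positivity
  rw [Real.norm_eq_abs, abs_of_nonneg h1]
  unfold center
  have h2 : ((ν j : ℕ) : ℝ) + 1 ≤ 2 ^ k := by exact_mod_cast (ν j).2
  rw [pow_succ, div_add_div _ _ (by positivity) (by positivity), div_le_one (by positivity)]
  have h3 : (0:ℝ) < 2 ^ k := by positivity
  nlinarith

/-- index equivalence -/
def idx (d k K : ℕ) : (Fin d → Fin (2 ^ k)) × (Fin d → Fin (2 ^ K)) ≃
    (Fin d → Fin (2 ^ (k + K))) :=
  (Equiv.arrowProdEquivProdArrow (Fin d) (fun _ => Fin (2 ^ k)) (fun _ => Fin (2 ^ K))).symm.trans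
    (Equiv.piCongrRight fun _ => finProdFinEquiv.trans (finCongr (pow_add 2 k K).symm))

/-- lower corner -/
def corner (k : ℕ) (ν : Fin d → Fin (2 ^ k)) : Fin d → ℝ := fun j => (ν j : ℕ) / 2 ^ k

lemma center_idx (k K : ℕ) (ν : Fin d → Fin (2 ^ k)) (μ : Fin d → Fin (2 ^ K)) :
    center (k + K) (idx d k K (ν, μ)) = corner k ν + (1 / 2 ^ k : ℝ) • center K μ := by
  ext j
  simp [center, corner, idx, Equiv.arrowProdEquivProdArrow]
  field_simp
  ring

lemma center_corner (k : ℕ) (ν : Fin d → Fin (2 ^ k)) :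
    corner k ν = center k ν + (1 / 2 ^ k : ℝ) • (fun _ => -(1 / 2) : Fin d → ℝ) := by
  ext j
  simp [center, corner]
  field_simp
  ring

lemma dec_submult (hq0 : q ≠ 0) (hq : q ≠ ∞) (hp : 1 ≤ p) (hp' : p ≠ ∞) (B C : ℝ)
    (hB : 0 ≤ B) (hC : 0 < C) :
    ∃ M : ℝ, 0 ≤ M ∧ ∀ Q : Fin n → QF d, HasB Q B → ∀ k K D1 D2, DP Q C q p k D1 →
      DP Q C q p K D2 → DP Q C q p (k + K) (M * D1 * D2) := by
  have hC1 : 0 ≤ 2 + C + B * 2 * 2 + B * 2 * C := by positivity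
  obtain ⟨M, hM, H⟩ := dec_compare (d := d) (n := n) hq0 hq hp hp' B C
    (2 + C + B * 2 * 2 + B * 2 * C) hB hC hC1
  refine ⟨M, hM, fun Q hQ k K D1 D2 h1 h2 => ?_⟩
  have h1' := H Q hQ k D1 h1
  refine dec_equiv hq (idx d k K) ?_
  refine dec_nest hq0 hq h1' ?_ ?_ h2.1
  · intro ν
    set δ : ℝ := 1 / 2 ^ k with hδ
    have hδ0 : δ ≠ 0 := by positivity
    have hδ2 : δ ^ 2 ≠ 0 := by positivity
    refine dec_affine hq0 hq hp' h2 (tri δ (δ ^ 2) hδ0 hδ2 (polL Q (corner k ν) δ))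
      (corner k ν, fun i => Q i (corner k ν)) ?_
    intro μ z hz
    obtain ⟨u, v, hu, hv, e1, e2⟩ := (mem_Ubox hC.le).1 hz
    rw [center_idx] at e1 e2
    have hδδ : (1 / 2 ^ (k + K) : ℝ) = δ * (1 / 2 ^ K) := by
      rw [hδ, pow_add]; field_simp
    rw [hδδ] at e1 e2
    set δ' : ℝ := 1 / 2 ^ K
    set b := center K μ
    set c := corner k ν
    refine ⟨(b + δ' • u, fun i => Q i b + δ' * QuadraticMap.polar (⇑(Q i)) b u + δ' ^ 2 * v i),
      (mem_Ubox hC.le).2 ⟨u, v, hu, hv, rfl, fun i => rfl⟩, ?_⟩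
    ext j
    · simp [tri_apply, e1]; ring
    · simp only [tri_apply, Prod.snd_add, Pi.add_apply, polL_apply, Pi.smul_apply, smul_eq_mul,
        QuadraticMap.polar_add_right, QuadraticMap.polar_smul_right, QuadraticMap.polar_add_left,
        QuadraticMap.polar_smul_left, e2, Q_add, Q_smul]
      ring
  · intro ν μ z hz
    set δ : ℝ := 1 / 2 ^ k with hδ
    obtain ⟨u, v, hu, hv, e1, e2⟩ := (mem_Ubox hC.le).1 hz
    have hcen : center (k + K) (idx d k K (ν, μ)) =
        center k ν + δ • ((fun _ => -(1 / 2)) + center K μ) := by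
      rw [center_idx, center_corner, ← hδ, add_assoc, ← smul_add]
    rw [hcen] at e1 e2
    have hδδ : (1 / 2 ^ (k + K) : ℝ) = δ * (1 / 2 ^ K) := by
      rw [hδ, pow_add]; field_simp
    rw [hδδ] at e1 e2
    set δ' : ℝ := 1 / 2 ^ K with hδ'
    have d0 : 0 ≤ δ' := by positivity
    have d1 : δ' ≤ 1 := by
      rw [hδ', div_le_one (by positivity)]; exact one_le_pow₀ (by norm_num)
    set b : Fin d → ℝ := (fun _ => -(1 / 2)) + center K μ with hb'
    have hb : ‖b‖ ≤ 2 := by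
      refine (norm_add_le _ _).trans ?_
      have : ‖(fun _ => -(1 / 2) : Fin d → ℝ)‖ ≤ 1 := by
        rw [pi_norm_le_iff_of_nonneg zero_le_one]
        intro j; norm_num
      linarith [center_nonneg K μ]
    set a := center k ν
    have hδu : ‖δ' • u‖ ≤ C := by
      rw [norm_smul, Real.norm_eq_abs, abs_of_nonneg d0]
      nlinarith [norm_nonneg u]
    refine (mem_Ubox hC1).2 ⟨b + δ' • u, fun i => Q i b + QuadraticMap.polar (⇑(Q i)) b (δ' • u)
      + δ' ^ 2 * v i, ?_, ?_, ?_, ?_⟩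
    · refine (norm_add_le _ _).trans ?_
      have : 0 ≤ B * 2 * 2 + B * 2 * C := by positivity
      linarith
    · rw [pi_norm_le_iff_of_nonneg hC1]
      intro i
      have k1 : ‖Q i b‖ ≤ B * 2 * 2 := by
        refine (Q_bound (hQ i) b).trans ?_
        gcongr
      have k2 : ‖QuadraticMap.polar (⇑(Q i)) b (δ' • u)‖ ≤ B * 2 * C := by
        refine (hQ i _ _).trans ?_
        gcongr
      have k3 : ‖δ' ^ 2 * v i‖ ≤ C := by
        rw [norm_mul, Real.norm_eq_abs, abs_of_nonneg (by positivity)]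
        have := (norm_le_pi_norm v i).trans hv
        have : δ' ^ 2 ≤ 1 := by nlinarith
        nlinarith [norm_nonneg (v i)]
      refine (norm_add₃_le).trans ?_
      linarith
    · rw [e1, smul_add δ b, smul_smul, add_assoc]
    · intro i
      simp only [QuadraticMap.polar_add_right, QuadraticMap.polar_smul_right,
        QuadraticMap.polar_add_left, QuadraticMap.polar_smul_left, e2, Q_add, Q_smul, smul_eq_mul]
      ring

lemma dec_perturb {Q Q' : Fin n → QF d} {C η : ℝ} (hC : 0 ≤ C) {k : ℕ} {D : ℝ}
    (hη : ∀ i x y, |QuadraticMap.polar (⇑(Q' i - Q i)) x y| ≤ η * ‖x‖ * ‖y‖)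
    (hη0 : 0 ≤ η) (hs : η * (1 + C) ≤ (1 / 2 ^ k) ^ 2)
    (h : DP Q (C + 1) q p k D) : DP Q' C q p k D := by
  refine dec_mono h (fun ν z hz => ?_) le_rfl
  obtain ⟨u, v, hu, hv, e1, e2⟩ := (mem_Ubox hC).1 hz
  set a := center k ν with ha'
  set δ : ℝ := 1 / 2 ^ k with hδ
  have d0 : 0 < δ := by positivity
  have d1 : δ ≤ 1 := by
    rw [hδ, div_le_one (by positivity)]; exact one_le_pow₀ (by norm_num)
  have ha : ‖a‖ ≤ 1 := center_nonneg k ν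
  have hpol : ∀ i x y, QuadraticMap.polar (⇑(Q' i - Q i)) x y =
      QuadraticMap.polar (⇑(Q' i)) x y - QuadraticMap.polar (⇑(Q i)) x y := by
    intro i x y
    simp [QuadraticMap.polar]; ring
  refine (mem_Ubox (by linarith)).2 ⟨u, fun i => v i + (δ ^ 2)⁻¹ * ((Q' i - Q i) a +
    δ * QuadraticMap.polar (⇑(Q' i - Q i)) a u), hu.trans (by linarith), ?_, e1, ?_⟩
  · rw [pi_norm_le_iff_of_nonneg (by linarith)]
    intro i
    refine (norm_add_le _ _).trans (add_le_add ((norm_le_pi_norm v i).trans hv) ?_)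
    rw [norm_mul, norm_inv, Real.norm_of_nonneg (by positivity : 0 ≤ δ ^ 2),
      inv_mul_le_iff₀ (by positivity), mul_one]
    refine le_trans ?_ hs
    refine (norm_add_le _ _).trans ?_
    have k1 : ‖(Q' i - Q i) a‖ ≤ η * 1 * 1 := by
      refine (Q_bound (hη i) a).trans ?_
      gcongr
    have k2 : ‖QuadraticMap.polar (⇑(Q' i - Q i)) a u‖ ≤ η * 1 * C := by
      refine (hη i _ _).trans ?_
      gcongr
    rw [norm_mul, Real.norm_of_nonneg d0.le]
    nlinarith [norm_nonneg (QuadraticMap.polar (⇑(Q' i - Q i)) a u)]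
  · intro i
    rw [e2]
    simp only [hpol, QuadraticMap.sub_apply]
    field_simp
    ring

end steps

section final
variable {d n : ℕ} {q p : ℝ≥0∞}

lemma decConst_eq (Q : Fin n → QF d) (C : ℝ) (q p : ℝ≥0∞) (k : ℕ) :
    DecConst Q C q p k = sInf {D : ℝ | DP Q C q p k D} := rfl

lemma DP_trivial (hq0 : q ≠ 0) (hq : q ≠ ∞) (hp : 1 ≤ p) (Q : Fin n → QF d) (C : ℝ) (k : ℕ) :
    DP Q C q p k ((2 ^ k) ^ d : ℝ) := by
  have := dec_trivial hq0 hq hp (fun ν : Fin d → Fin (2 ^ k) => Ubox Q (1 / 2 ^ k) C (center k ν))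
  refine dec_mono this (fun _ => subset_rfl) (le_of_eq ?_)
  simp

lemma decConst_le {Q : Fin n → QF d} {C : ℝ} {k : ℕ} {D : ℝ} (h : DP Q C q p k D) :
    DecConst Q C q p k ≤ D := by
  rw [decConst_eq]
  exact csInf_le ⟨0, fun D h => h.1⟩ h

lemma DP_of_lt (hq0 : q ≠ 0) (hq : q ≠ ∞) (hp : 1 ≤ p) {Q : Fin n → QF d} {C : ℝ} {k : ℕ} {D : ℝ}
    (h : DecConst Q C q p k < D) : DP Q C q p k D := by
  rw [decConst_eq] at h
  obtain ⟨D', hD', hlt⟩ := exists_lt_of_csInf_lt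
    (s := {D : ℝ | DP Q C q p k D}) (Set.nonempty_of_mem (DP_trivial hq0 hq hp Q C k)) h
  exact dec_mono hD' (fun _ => subset_rfl) hlt.le

lemma DP_mono {Q : Fin n → QF d} {C : ℝ} {k : ℕ} {D D' : ℝ} (h : DP Q C q p k D) (hD : D ≤ D') :
    DP Q C q p k D' := dec_mono h (fun _ => subset_rfl) hD

lemma half_pow (k : ℕ) (s : ℝ) : (1 / 2 ^ k : ℝ) ^ (-s) = 2 ^ ((k : ℝ) * s) := by
  rw [Real.rpow_neg (by positivity), one_div, Real.inv_rpow (by positivity), inv_inv,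
    ← Real.rpow_natCast, ← Real.rpow_mul (by norm_num)]

theorem main (hq0 : q ≠ 0) (hq : q ≠ ∞) (hp : 1 ≤ p) (hp' : p ≠ ∞) (Q : Fin n → QF d)
    (C : ℝ) (hC : 0 < C) (ε : ℝ) (hε : 0 < ε) :
    ∃ (Cε : ℝ) (η : ℝ), 0 < η ∧
      ∀ Q' : Fin n → QF d,
        (∀ i, ∀ ξ ∈ Set.univ.pi fun _ : Fin d => Set.Icc (0 : ℝ) 1, |Q' i ξ - Q i ξ| ≤ η) →
        ∀ k : ℕ, 1 ≤ k →
          DecConst Q' C q p k ≤ Cε * (1 / 2 ^ k : ℝ) ^ (-(Gamma Q C q p + ε)) := by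
  obtain ⟨B, hB, hQB⟩ := exists_hasB Q
  obtain ⟨M1, hM1, H1⟩ := dec_compare (d := d) (n := n) hq0 hq hp hp' (B + 1) C (C + 1)
    (by linarith) hC (by linarith)
  obtain ⟨M2, hM2, H2⟩ := dec_submult (d := d) (n := n) hq0 hq hp hp' (B + 1) C (by linarith) hC
  have hQB1 : HasB Q (B + 1) := hasB_mono hQB (by linarith)
  set θ := Gamma Q C q p + ε with hθ
  -- the exponent
  have hne : ({G : ℝ | ∀ ε : ℝ, 0 < ε → ∃ Cε : ℝ, ∀ k : ℕ, 1 ≤ k →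
      DecConst Q C q p k ≤ Cε * (1 / 2 ^ k : ℝ) ^ (-(G + ε))}).Nonempty := by
    refine ⟨d, fun e he => ⟨1, fun k _ => ?_⟩⟩
    refine (decConst_le (DP_trivial hq0 hq hp Q C k)).trans ?_
    rw [half_pow, one_mul, ← pow_mul, ← Real.rpow_natCast]
    refine Real.rpow_le_rpow_of_exponent_le (by norm_num) ?_
    push_cast
    gcongr
    linarith
  obtain ⟨G, hG, hGlt⟩ := exists_lt_of_csInf_lt hne
    (show sInf _ < Gamma Q C q p + ε / 4 by
      have : 0 < ε / 4 := by positivity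
      unfold Gamma; linarith)
  obtain ⟨C0, hC0⟩ := hG (ε / 4) (by positivity)
  -- choose K
  set N := M2 * (M1 * (|C0| + 1)) with hN
  obtain ⟨K, hK1, hK⟩ : ∃ K : ℕ, 1 ≤ K ∧ N ≤ 2 ^ ((K : ℝ) * (ε / 2)) := by
    have h2 : (1 : ℝ) < 2 ^ (ε / 2) := Real.one_lt_rpow (by norm_num) (by positivity)
    obtain ⟨m, hm⟩ := pow_unbounded_of_one_lt N h2
    refine ⟨m + 1, by omega, hm.le.trans ?_⟩
    rw [← Real.rpow_natCast, ← Real.rpow_mul (by norm_num)]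
    refine Real.rpow_le_rpow_of_exponent_le (by norm_num) ?_
    push_cast
    nlinarith
  set X : ℝ := 2 ^ ((K : ℝ) * (Gamma Q C q p + ε / 2)) with hX
  have hX0 : 0 < X := by positivity
  have hDK : DP Q C q p K ((|C0| + 1) * X) := by
    refine DP_of_lt hq0 hq hp ((hC0 K hK1).trans_lt ?_)
    rw [half_pow]
    have h1 : (2 : ℝ) ^ ((K : ℝ) * (G + ε / 4)) ≤ X := by
      refine Real.rpow_le_rpow_of_exponent_le (by norm_num) ?_
      exact mul_le_mul_of_nonneg_left (by linarith) (by positivity)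
    have h2 : (0 : ℝ) < 2 ^ ((K : ℝ) * (G + ε / 4)) := by positivity
    have h3 := le_abs_self C0
    have h4 := abs_nonneg C0
    nlinarith [mul_le_mul_of_nonneg_left h1 h4, mul_le_mul_of_nonneg_right h3 h2.le]
  have hDK1 := H1 Q hQB1 K _ hDK
  -- choose η
  set η' : ℝ := min 1 ((1 / 2 ^ K) ^ 2 / (1 + C)) with hη'
  have hη'0 : 0 < η' := by positivity
  refine ⟨M2 * 2 ^ ((K : ℝ) * |θ|) * (2 ^ K) ^ d, η' / (6 * ((d : ℝ) ^ 2 + 1)), by positivity, ?_⟩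
  intro Q' hQ' k _
  have hpert : ∀ i x y, |QuadraticMap.polar (⇑(Q' i - Q i)) x y| ≤ η' * ‖x‖ * ‖y‖ := by
    intro i x y
    refine (polar_small (Q' i - Q i) _ (hQ' i) x y).trans ?_
    gcongr
    rw [← mul_div_assoc, ← mul_div_assoc, div_le_iff₀ (by positivity)]
    nlinarith
  have hQ'B : HasB Q' (B + 1) := by
    intro i x y
    have e : QuadraticMap.polar (⇑(Q' i)) x y = QuadraticMap.polar (⇑(Q i)) x y +
        QuadraticMap.polar (⇑(Q' i - Q i)) x y := by
      simp [QuadraticMap.polar]; ring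
    rw [e]
    refine (abs_add_le _ _).trans ?_
    have h1 := hQB i x y
    have h2 := hpert i x y
    have h3 : η' * ‖x‖ * ‖y‖ ≤ 1 * ‖x‖ * ‖y‖ := by
      gcongr
      exact min_le_left _ _
    linarith
  have hK' : DP Q' C q p K (M1 * ((|C0| + 1) * X)) := by
    refine dec_perturb hC.le hpert hη'0.le ?_ hDK1
    rw [← le_div_iff₀ (by positivity)]
    exact min_le_right _ _
  have hY : M2 * (M1 * ((|C0| + 1) * X)) ≤ 2 ^ ((K : ℝ) * θ) := by
    have : (2 : ℝ) ^ ((K : ℝ) * θ) = 2 ^ ((K : ℝ) * (ε / 2)) * X := by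
      rw [hX, ← Real.rpow_add (by norm_num)]
      congr 1; rw [hθ]; ring
    rw [this]
    calc _ = N * X := by rw [hN]; ring
      _ ≤ _ := by gcongr
  have iter : ∀ m : ℕ, DP Q' C q p (m * K) (2 ^ (((m * K : ℕ) : ℝ) * θ)) := by
    intro m
    induction m with
    | zero =>
      have := DP_trivial hq0 hq hp Q' C 0
      simpa using this
    | succ m ih =>
      have := H2 Q' hQ'B _ _ _ _ ih hK'
      rw [← Nat.succ_mul] at this
      refine DP_mono this ?_
      have e : (2 : ℝ) ^ (((Nat.succ m * K : ℕ) : ℝ) * θ) =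
          2 ^ (((m * K : ℕ) : ℝ) * θ) * 2 ^ ((K : ℝ) * θ) := by
        rw [← Real.rpow_add (by norm_num)]
        congr 1; push_cast; ring
      rw [e]
      calc _ = 2 ^ (((m * K : ℕ) : ℝ) * θ) * (M2 * (M1 * ((|C0| + 1) * X))) := by ring
        _ ≤ _ := by gcongr
  have hk : k / K * K + k % K = k := Nat.div_add_mod' k K
  have hr : k % K < K := Nat.mod_lt _ (by omega)
  have hfin := H2 Q' hQ'B _ _ _ _ (iter (k / K)) (DP_trivial hq0 hq hp Q' C (k % K))
  rw [hk] at hfin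
  refine (decConst_le hfin).trans ?_
  rw [half_pow]
  have e1 : (2 : ℝ) ^ (((k / K * K : ℕ) : ℝ) * θ) ≤ 2 ^ ((K : ℝ) * |θ|) * 2 ^ ((k : ℝ) * θ) := by
    rw [← Real.rpow_add (by norm_num)]
    refine Real.rpow_le_rpow_of_exponent_le (by norm_num) ?_
    have : (k : ℝ) = ((k / K * K : ℕ) : ℝ) + ((k % K : ℕ) : ℝ) := by exact_mod_cast hk.symm
    rw [this]
    have h1 : -(((k % K : ℕ) : ℝ) * θ) ≤ (K : ℝ) * |θ| := by
      calc -(((k % K : ℕ) : ℝ) * θ) = ((k % K : ℕ) : ℝ) * (-θ) := by ring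
        _ ≤ ((k % K : ℕ) : ℝ) * |θ| := by gcongr; exact neg_le_abs θ
        _ ≤ _ := by gcongr
    linarith
  have e2 : ((2 : ℝ) ^ (k % K)) ^ d ≤ (2 ^ K) ^ d := by
    gcongr
    norm_num
  calc _ ≤ M2 * (2 ^ ((K : ℝ) * |θ|) * 2 ^ ((k : ℝ) * θ)) * (2 ^ K) ^ d := by gcongr
    _ = _ := by ring
end final

end helpers

/-- Theorem 5.2, uniform decoupling: for `2 ≤ q ≤ p < ∞` and `ε > 0`
there are `C_ε < ∞` and a neighborhood of `𝐪` (in the coefficient space, described by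
uniform closeness on the unit cube) such that every tuple `𝐪̃` in this neighborhood
satisfies `Dec_{q,p}(𝐪̃, δ) ≤ C_ε δ^{-Γ_{q,p}(𝐪) - ε}` for all dyadic `δ ∈ (0,1)`. -/
theorem statement_16 (d n : ℕ) (hd : 1 ≤ d) (hn : 1 ≤ n)
    (Q : Fin n → QF d) (Cb : ℝ) (hCb : 1 ≤ Cb)
    (q p : ℝ≥0∞) (hq : 2 ≤ q) (hqp : q ≤ p) (hp : p ≠ ∞) (ε : ℝ) (hε : 0 < ε) :
    ∃ (Cε : ℝ) (η : ℝ), 0 < η ∧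
      ∀ Q' : Fin n → QF d,
        (∀ i, ∀ ξ ∈ Set.univ.pi fun _ : Fin d => Set.Icc (0 : ℝ) 1,
          |Q' i ξ - Q i ξ| ≤ η) →
        ∀ k : ℕ, 1 ≤ k →
          DecConst Q' Cb q p k ≤ Cε * (1 / 2 ^ k : ℝ) ^ (-(Gamma Q Cb q p + ε)) := by
  have hq0 : q ≠ 0 := fun h => by simp [h] at hq
  have hqt : q ≠ ∞ := fun h => hp (top_le_iff.1 (h ▸ hqp))
  have hp1 : 1 ≤ p := le_trans (by norm_num) (hq.trans hqp)
  exact main hq0 hqt hp1 hp Q Cb (by linarith) ε hε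

end GOZZK
end
end
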